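/- Let n ≥ 2 and r ≥ 1 with (n, r) ∉ {(2,1), (2,2), (3,1)} and r ≤ max{2, (n+2)/6}. If G is a finite abelian group with L(G) = L(Cₙʳ), then G ≅ Cₙʳ. -/

import Mathlib

/-- A sequence over `G₀` (a multiset with entries in `G₀`) with sum zero. -/
def IsZeroSumSeq {G : Type*} [AddCommGroup G] (G₀ : Set G) (S : Multiset G) : Prop :=
  (∀ g ∈ S, g ∈ G₀) ∧ S.sum = 0

/-- A minimal zero-sum sequence (atom) over `G₀`. -/
def IsAtomSeq {G : Type*} [AddCommGroup G] (G₀ : Set G) (A : Multiset G) : Prop :=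
  IsZeroSumSeq G₀ A ∧ A ≠ 0 ∧ ∀ B ≤ A, B ≠ 0 → B.sum = 0 → B = A

/-- The set of lengths of factorizations of `B` into atoms over `G₀`. -/
def LengthSet {G : Type*} [AddCommGroup G] (G₀ : Set G) (B : Multiset G) : Set ℕ :=
  {k | ∃ F : Multiset (Multiset G), F.card = k ∧ (∀ A ∈ F, IsAtomSeq G₀ A) ∧ F.sum = B}

/-- The set of successive distances of a set of naturals. -/
def DistSet (L : Set ℕ) : Set ℕ :=
  {d | ∃ a b, a ∈ L ∧ b ∈ L ∧ a < b ∧ b - a = d ∧ ∀ c ∈ L, ¬(a < c ∧ c < b)}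

/-- The set of distances `Δ(G₀)`. -/
def DeltaSet {G : Type*} [AddCommGroup G] (G₀ : Set G) : Set ℕ :=
  {d | ∃ B : Multiset G, IsZeroSumSeq G₀ B ∧ d ∈ DistSet (LengthSet G₀ B)}

/-- The cross number of a sequence. -/
noncomputable def crossNum {G : Type*} [AddCommGroup G] (S : Multiset G) : ℚ :=
  (S.map (fun g => (1 : ℚ) / addOrderOf g)).sum

/-- `G₀` is an LCN-set: every atom has cross number at least 1. -/
def IsLCNSet {G : Type*} [AddCommGroup G] (G₀ : Set G) : Prop :=
  ∀ A : Multiset G, IsAtomSeq G₀ A → 1 ≤ crossNum A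

/-- The set of minimal distances `Δ*(G)`. -/
def DeltaStar (G : Type*) [AddCommGroup G] : Set ℕ :=
  {d | ∃ G₀ : Set G, DeltaSet G₀ ≠ ∅ ∧ d = sInf (DeltaSet G₀)}

/-- `m(G)`: the maximum of `min Δ(G₀)` over non-half-factorial LCN-sets `G₀`. -/
noncomputable def mConst (G : Type*) [AddCommGroup G] : ℕ :=
  sSup {d | ∃ G₀ : Set G, IsLCNSet G₀ ∧ DeltaSet G₀ ≠ ∅ ∧ d = sInf (DeltaSet G₀)}

/-- The rank of a finite abelian group: the maximal `k` such that `(ZMod p)^k`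
embeds into `G` for some prime `p`. -/
noncomputable def grank (G : Type*) [AddCommGroup G] : ℕ :=
  sSup {k | ∃ p : ℕ, p.Prime ∧ ∃ f : (Fin k → ZMod p) →+ G, Function.Injective f}

/-- The system of sets of lengths `L(G)`. -/
def SystemSets (G : Type*) [AddCommGroup G] : Set (Set ℕ) :=
  {L | ∃ B : Multiset G, B.sum = 0 ∧ L = LengthSet Set.univ B}

/-- The Davenport constant: the maximal length of a minimal zero-sum sequence. -/
noncomputable def DavenportC (G : Type*) [AddCommGroup G] : ℕ :=
  sSup {k | ∃ A : Multiset G, IsAtomSeq (Set.univ : Set G) A ∧ A.card = k}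

namespace ZeroSum

set_option linter.unusedSectionVars false

variable {G : Type*} [AddCommGroup G]

/-- Minimal zero-sum sequences over the whole group. -/
abbrev Atom (A : Multiset G) : Prop := IsAtomSeq (Set.univ : Set G) A

lemma atom_iff {A : Multiset G} :
    Atom A ↔ A.sum = 0 ∧ A ≠ 0 ∧ ∀ B ≤ A, B ≠ 0 → B.sum = 0 → B = A := by
  simp [Atom, IsAtomSeq, IsZeroSumSeq]

lemma Atom.sum_eq {A : Multiset G} (h : Atom A) : A.sum = 0 := h.1.2

lemma Atom.ne_zero {A : Multiset G} (h : Atom A) : A ≠ 0 := h.2.1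

lemma Atom.eq_of_le {A B : Multiset G} (h : Atom A) (hB : B ≤ A) (h0 : B ≠ 0)
    (hs : B.sum = 0) : B = A := h.2.2 B hB h0 hs

lemma Atom.eq_of_le_atom {A B : Multiset G} (h : Atom A) (hB : B ≤ A) (h' : Atom B) : B = A :=
  h.eq_of_le hB h'.ne_zero h'.sum_eq

lemma Atom.eq_of_add {A B C : Multiset G} (h : Atom A) (hA : A = B + C) (hB : B ≠ 0)
    (hs : B.sum = 0) : C = 0 := by
  have := h.eq_of_le (hA ▸ Multiset.le_add_right B C) hB hs
  rw [hA] at this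
  simpa using this

lemma sum_sub {A B : Multiset G} [DecidableEq G] (h : B ≤ A) : (A - B).sum = A.sum - B.sum := by
  conv_rhs => rw [← tsub_add_cancel_of_le h, Multiset.sum_add]
  simp

lemma le_sum_of_mem {F : Multiset (Multiset G)} {A : Multiset G} (h : A ∈ F) : A ≤ F.sum := by
  obtain ⟨F', rfl⟩ := Multiset.exists_cons_of_mem h
  simp

/-- A multiset of atoms has zero-sum total. -/
lemma sum_sum_eq_zero {F : Multiset (Multiset G)} (h : ∀ A ∈ F, A.sum = 0) : F.sum.sum = 0 := by
  induction F using Multiset.induction_on with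
  | empty => simp
  | cons a F ih =>
    simp only [Multiset.sum_cons, Multiset.sum_add]
    rw [h a (by simp), ih (fun A hA => h A (by simp [hA]))]
    simp

lemma exists_atom_le {B : Multiset G} (hB : B.sum = 0) (h0 : B ≠ 0) : ∃ A ≤ B, Atom A := by
  induction B using Multiset.strongInductionOn with
  | _ B ih =>
    by_cases h : Atom B
    · exact ⟨B, le_rfl, h⟩
    · rw [atom_iff] at h
      push Not at h
      obtain ⟨C, hC, hC0, hCs, hne⟩ := h hB h0
      obtain ⟨A, hA, hA'⟩ := ih C (lt_of_le_of_ne hC hne) hCs hC0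
      exact ⟨A, hA.trans hC, hA'⟩

/-- Every zero-sum sequence factors into atoms, and a chosen atom divisor may be used. -/
lemma exists_fact {B : Multiset G} (hB : B.sum = 0) :
    ∃ F : Multiset (Multiset G), (∀ A ∈ F, Atom A) ∧ F.sum = B := by
  classical
  induction B using Multiset.strongInductionOn with
  | _ B ih =>
    by_cases h0 : B = 0
    · exact ⟨0, by simp, by simp [h0]⟩
    · obtain ⟨A, hA, hA'⟩ := exists_atom_le hB h0
      have hlt : B - A < B := by
        refine lt_of_le_of_ne tsub_le_self fun h => hA'.ne_zero ?_
        have := tsub_add_cancel_of_le hA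
        rw [h] at this
        simpa using this
      obtain ⟨F, hF, hs⟩ := ih (B - A) hlt (by rw [sum_sub hA, hB, hA'.sum_eq, sub_zero])
      refine ⟨A ::ₘ F, ?_, ?_⟩
      · intro C hC
        rcases Multiset.mem_cons.1 hC with rfl | hC
        exacts [hA', hF C hC]
      · rw [Multiset.sum_cons, hs, add_tsub_cancel_of_le hA]

lemma exists_fact_of_le {A B : Multiset G} (hB : B.sum = 0) (hA : Atom A) (hAB : A ≤ B) :
    ∃ F : Multiset (Multiset G), A ∈ F ∧ (∀ A ∈ F, Atom A) ∧ F.sum = B := by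
  classical
  obtain ⟨F, hF, hs⟩ := exists_fact (B := B - A) (by rw [sum_sub hAB, hB, hA.sum_eq, sub_zero])
  refine ⟨A ::ₘ F, by simp, ?_, ?_⟩
  · intro C hC
    rcases Multiset.mem_cons.1 hC with rfl | hC
    exacts [hA, hF C hC]
  · rw [Multiset.sum_cons, hs, add_tsub_cancel_of_le hAB]

lemma mem_lengthSet {B : Multiset G} {k : ℕ} : k ∈ LengthSet Set.univ B ↔
    ∃ F : Multiset (Multiset G), F.card = k ∧ (∀ A ∈ F, Atom A) ∧ F.sum = B := Iff.rfl

lemma atom_zero : Atom ({0} : Multiset G) := by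
  rw [atom_iff]
  refine ⟨by simp, by simp, fun B hB h0 _ => ?_⟩
  rcases Multiset.le_singleton.1 hB with rfl | rfl
  · exact absurd rfl h0
  · rfl

lemma Atom.eq_zero_of_mem {A : Multiset G} (h : Atom A) (h0 : (0 : G) ∈ A) : A = {0} :=
  (h.eq_of_le_atom (Multiset.singleton_le.2 h0) atom_zero).symm

lemma Atom.two_le_card {A : Multiset G} (h : Atom A) (h0 : A ≠ {0}) : 2 ≤ A.card := by
  by_contra hc
  have h1 : A.card ≠ 0 := by simpa using h.ne_zero
  have : A.card = 1 := by omega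
  obtain ⟨a, rfl⟩ := Multiset.card_eq_one.1 this
  have := h.sum_eq
  simp at this
  exact h0 (by rw [this])

lemma atom_pair {g : G} (hg : g ≠ 0) : Atom ({g, -g} : Multiset G) := by
  rw [atom_iff]
  refine ⟨by simp, by simp, fun B hB h0 hs => ?_⟩
  refine Multiset.eq_of_le_of_card_le hB ?_
  by_contra hc
  have h1 : B.card ≠ 0 := by simpa using h0
  have : B.card = 1 := by simp at hc; omega
  obtain ⟨a, rfl⟩ := Multiset.card_eq_one.1 this
  simp at hB hs
  rcases hB with h | h <;> simp_all

lemma atom_replicate (g : G) (hg : 0 < addOrderOf g) : Atom (Multiset.replicate (addOrderOf g) g) := by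
  rw [atom_iff]
  refine ⟨by simp, ?_, fun B hB h0 hs => ?_⟩
  · intro h
    have := congrArg Multiset.card h
    simp at this
    exact hg.ne' (by simpa using this)
  · obtain ⟨m, hm, rfl⟩ := Multiset.le_replicate_iff.1 hB
    have h1 : m ≠ 0 := fun h => h0 (by simp [h])
    have h2 := addOrderOf_dvd_of_nsmul_eq_zero (by simpa using hs)
    have := Nat.le_of_dvd (Nat.pos_of_ne_zero h1) h2
    rw [le_antisymm hm this]

/-- Additive weight of a sequence. -/
def wt (φ : G → ℕ) : Multiset G →+ ℕ :=
  Multiset.sumAddMonoidHom.comp (Multiset.mapAddMonoidHom φ)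

lemma wt_apply (φ : G → ℕ) (A : Multiset G) : wt φ A = (A.map φ).sum := rfl

@[simp] lemma wt_singleton (φ : G → ℕ) (g : G) : wt φ {g} = φ g := by simp [wt_apply]

@[simp] lemma wt_cons (φ : G → ℕ) (g : G) (A : Multiset G) : wt φ (g ::ₘ A) = φ g + wt φ A := by
  simp [wt_apply]

@[simp] lemma wt_replicate (φ : G → ℕ) (k : ℕ) (g : G) :
    wt φ (Multiset.replicate k g) = k * φ g := by
  simp [wt_apply]

lemma wt_mono (φ : G → ℕ) {A B : Multiset G} (h : A ≤ B) : wt φ A ≤ wt φ B := by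
  obtain ⟨C, rfl⟩ := Multiset.le_iff_exists_add.1 h
  simp

lemma wt_sum (φ : G → ℕ) (F : Multiset (Multiset G)) : wt φ F.sum = (F.map (wt φ)).sum :=
  map_multiset_sum _ _

lemma le_wt_of_mem (φ : G → ℕ) {A : Multiset G} {g : G} (h : g ∈ A) : φ g ≤ wt φ A := by
  simpa using wt_mono φ (Multiset.singleton_le.2 h)

lemma card_mul_le_wt (φ : G → ℕ) {F : Multiset (Multiset G)} {α : ℕ} (h : ∀ A ∈ F, α ≤ wt φ A) :
    F.card * α ≤ wt φ F.sum := by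
  rw [wt_sum]
  simpa using Multiset.card_nsmul_le_sum (s := F.map (wt φ)) (a := α) (by simpa using h)

lemma wt_le_card_mul (φ : G → ℕ) {F : Multiset (Multiset G)} {β : ℕ} (h : ∀ A ∈ F, wt φ A ≤ β) :
    wt φ F.sum ≤ F.card * β := by
  rw [wt_sum]
  simpa using Multiset.sum_le_card_nsmul (F.map (wt φ)) β (by simpa using h)

lemma card_le_wt (φ : G → ℕ) {A : Multiset G} (h : ∀ g ∈ A, 1 ≤ φ g) : A.card ≤ wt φ A := by
  rw [wt_apply]
  simpa using Multiset.card_nsmul_le_sum (s := A.map φ) (a := 1) (by simpa using h)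

lemma wt_le_card (φ : G → ℕ) {A : Multiset G} {c : ℕ} (h : ∀ g ∈ A, φ g ≤ c) :
    wt φ A ≤ A.card * c := by
  rw [wt_apply]
  simpa using Multiset.sum_le_card_nsmul (A.map φ) c (by simpa using h)

/-- All factorizations of a zero-sum sequence over `G₀` have congruent lengths modulo `d`. -/
def Uniform (d : ℕ) (G₀ : Set G) : Prop :=
  ∀ F F' : Multiset (Multiset G), (∀ A ∈ F, Atom A) → (∀ A ∈ F', Atom A) → F.sum = F'.sum →
    (∀ g ∈ F.sum, g ∈ G₀) → F.card ≡ F'.card [MOD d]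

lemma uniform_of_weight {d n : ℕ} (hn : 0 < n) {G₀ : Set G} (φ : G → ℕ)
    (h : ∀ A, Atom A → (∀ g ∈ A, g ∈ G₀) → wt φ A ≡ n [MOD d * n]) : Uniform d G₀ := by
  have key : ∀ F : Multiset (Multiset G), (∀ A ∈ F, Atom A) → (∀ g ∈ F.sum, g ∈ G₀) →
      F.card * n ≡ wt φ F.sum [MOD d * n] := by
    intro F
    induction F using Multiset.induction_on with
    | empty => intros; simp; rfl
    | cons a F ih =>
      intro h1 h2
      simp only [Multiset.card_cons, Multiset.sum_cons, map_add, add_mul, one_mul]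
      rw [add_comm (wt φ a)]
      exact Nat.ModEq.add (ih (fun A hA => h1 A (by simp [hA])) fun g hg => h2 g (by simp [hg]))
        (h a (h1 a (by simp)) fun g hg => h2 g (by simp [hg])).symm
  intro F F' h1 h2 h3 h4
  refine Nat.ModEq.mul_right_cancel' hn.ne' ((key F h1 h4).trans ?_)
  rw [h3]
  exact (key F' h2 (h3 ▸ h4)).symm

/-- The weight `n / ord g`, that is `n` times the cross number of a single element. -/
noncomputable def ordWt (n : ℕ) (g : G) : ℕ := n / addOrderOf g

lemma exists_fact_nsmul {n : ℕ} (hn : 0 < n) (B : Multiset G) (hB : ∀ g ∈ B, n • g = 0) :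
    ∃ F : Multiset (Multiset G), F.card = wt (ordWt n) B ∧ (∀ A ∈ F, Atom A) ∧ F.sum = n • B := by
  induction B using Multiset.induction_on with
  | empty => exact ⟨0, by simp⟩
  | cons g B ih =>
    obtain ⟨F, h1, h2, h3⟩ := ih fun x hx => hB x (by simp [hx])
    have hd : addOrderOf g ∣ n := addOrderOf_dvd_of_nsmul_eq_zero (hB g (by simp))
    have hp : 0 < addOrderOf g := Nat.pos_of_dvd_of_pos hd hn
    refine ⟨Multiset.replicate (n / addOrderOf g) (Multiset.replicate (addOrderOf g) g) + F, ?_, ?_, ?_⟩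
    · simp [h1, ordWt]
    · intro A hA
      rcases Multiset.mem_add.1 hA with hA | hA
      · rw [Multiset.eq_of_mem_replicate hA]
        exact atom_replicate g hp
      · exact h2 A hA
    · rw [Multiset.sum_add, h3, Multiset.sum_replicate, ← Multiset.nsmul_singleton, smul_smul,
        Nat.div_mul_cancel hd, ← Multiset.singleton_add, nsmul_add]

lemma Uniform.wt_modEq {d n : ℕ} (hn : 0 < n) {G₀ : Set G} (h : Uniform d G₀)
    (hG : ∀ g ∈ G₀, n • g = 0) {A : Multiset G} (hA : Atom A) (hA' : ∀ g ∈ A, g ∈ G₀) :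
    wt (ordWt n) A ≡ n [MOD d] := by
  obtain ⟨F, h1, h2, h3⟩ := exists_fact_nsmul hn A fun g hg => hG g (hA' g hg)
  have := h F (Multiset.replicate n A) h2
    (fun B hB => by rw [Multiset.eq_of_mem_replicate hB]; exact hA) (by simp [h3])
    (fun g hg => hA' g (by rw [h3] at hg; exact Multiset.mem_of_mem_nsmul hg))
  simpa [h1] using this

lemma ordWt_pos {n : ℕ} (hn : 0 < n) {g : G} (hg : n • g = 0) : 1 ≤ ordWt n g := by
  have hd : addOrderOf g ∣ n := addOrderOf_dvd_of_nsmul_eq_zero hg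
  exact Nat.div_pos (Nat.le_of_dvd hn hd) (Nat.pos_of_dvd_of_pos hd hn)

lemma ordWt_mul {n : ℕ} {g : G} (hg : n • g = 0) : addOrderOf g * ordWt n g = n :=
  Nat.mul_div_cancel' (addOrderOf_dvd_of_nsmul_eq_zero hg)

lemma Atom.card_le [Fintype G] {A : Multiset G} (h : Atom A) : A.card ≤ Fintype.card G := by
  obtain ⟨l, rfl⟩ := Quot.exists_rep A
  change Multiset.card (l : Multiset G) ≤ _
  have h' : Atom (l : Multiset G) := h
  rw [Multiset.coe_card]
  have key : ∀ i j : ℕ, i < j → j < l.length → (l.take i).sum ≠ (l.take j).sum := by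
    intro i j hij hj heq
    have e : l.take j = l.take i ++ (l.drop i).take (j - i) := by
      conv_lhs => rw [show j = i + (j - i) by omega]
      rw [List.take_add]
    rw [e, List.sum_append] at heq
    have hs : ((l.drop i).take (j - i)).sum = 0 := by simpa using heq.symm
    have hsub : (((l.drop i).take (j - i) : List G) : Multiset G) ≤ (l : Multiset G) :=
      Multiset.coe_le.2 (((List.take_sublist _ _).trans (List.drop_sublist _ _)).subperm)
    have hlen : ((l.drop i).take (j - i)).length = j - i := by
      simp; omega
    have := h'.eq_of_le hsub (by
      intro h0
      have := congrArg Multiset.card h0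
      rw [Multiset.coe_card, hlen] at this
      simp at this; omega) (by simpa using hs)
    have := congrArg Multiset.card this
    rw [Multiset.coe_card, hlen, Multiset.coe_card] at this
    omega
  have inj : Function.Injective fun i : Fin l.length => (l.take i).sum := by
    intro i j hij
    rcases lt_trichotomy (i : ℕ) j with h | h | h
    · exact absurd hij (key i j h j.2)
    · exact Fin.ext h
    · exact absurd hij.symm (key j i h i.2)
  simpa using Fintype.card_le_of_injective _ inj

lemma mem_msum {α : Type*} {F : Multiset (Multiset α)} {g : α} :
    g ∈ F.sum ↔ ∃ A ∈ F, g ∈ A := Multiset.mem_join (S := F)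

lemma exists_add_of_le_add {α : Type*} {A B C : Multiset α} (h : A ≤ B + C) :
    ∃ A₁ A₂, A = A₁ + A₂ ∧ A₁ ≤ B ∧ A₂ ≤ C := by
  classical
  refine ⟨A ∩ B, A - B, ?_, Multiset.inter_le_right, ?_⟩
  · rw [add_comm, Multiset.sub_add_inter]
  · exact tsub_le_iff_left.2 h

lemma exists_le_map {α β : Type*} {f : α → β} {A : Multiset α} {B : Multiset β}
    (h : B ≤ A.map f) : ∃ C ≤ A, B = C.map f := by
  classical
  induction A using Multiset.induction_on generalizing B with
  | empty => exact ⟨0, le_rfl, by simpa using h⟩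
  | cons a A ih =>
    rw [Multiset.map_cons, ← Multiset.singleton_add] at h
    obtain ⟨B₁, B₂, rfl, h1, h2⟩ := exists_add_of_le_add h
    obtain ⟨C, hC, rfl⟩ := ih h2
    rcases Multiset.le_singleton.1 h1 with rfl | rfl
    · exact ⟨C, hC.trans (Multiset.le_cons_self _ _), by simp⟩
    · exact ⟨a ::ₘ C, Multiset.cons_le_cons a hC, by simp⟩

lemma atom_map {H : Type*} [AddCommGroup H] {f : H →+ G} (hf : Function.Injective f)
    {A : Multiset H} (h : Atom A) : Atom (A.map f) := by
  rw [atom_iff]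
  refine ⟨by rw [← map_multiset_sum, h.sum_eq, map_zero], by simpa using h.ne_zero, ?_⟩
  intro B hB h0 hs
  obtain ⟨C, hC, rfl⟩ := exists_le_map hB
  rw [← map_multiset_sum, map_eq_zero_iff f hf] at hs
  rw [h.eq_of_le hC (by simpa using h0) hs]

/-- A proper subgroup has a strictly smaller Davenport constant. -/
lemma exists_larger_atom [Finite G] {H : Type*} [AddCommGroup H] {f : H →+ G}
    (hf : Function.Injective f) (hs : ¬ Function.Surjective f) {A : Multiset H} (h : Atom A) :
    ∃ B : Multiset G, Atom B ∧ A.card < B.card := by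
  classical
  obtain ⟨g, hg⟩ := not_forall.1 hs
  have hg' : g ∉ f.range := hg
  have hex : ∃ m, 0 < m ∧ m • g ∈ f.range := by
    refine ⟨addOrderOf g, addOrderOf_pos g, ?_⟩
    rw [addOrderOf_nsmul_eq_zero]
    exact zero_mem _
  obtain ⟨hm0, hm⟩ := Nat.find_spec hex
  have hmin : ∀ c, 0 < c → c < Nat.find hex → c • g ∉ f.range := fun c h1 h2 h3 =>
    Nat.find_min hex h2 ⟨h1, h3⟩
  set m := Nat.find hex
  have hm2 : 2 ≤ m := by
    by_contra hc
    have : m = 1 := by omega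
    rw [this, one_smul] at hm
    exact hg' hm
  obtain ⟨a, ha⟩ := Multiset.exists_mem_of_ne_zero h.ne_zero
  obtain ⟨A', rfl⟩ := Multiset.exists_cons_of_mem ha
  refine ⟨Multiset.replicate (m - 1) g + ({f a - (m - 1) • g} + A'.map f), ?_, ?_⟩
  swap
  · simp; omega
  have hA := h.sum_eq
  rw [Multiset.sum_cons] at hA
  have hA1 : f a + (A'.map f).sum = 0 := by
    rw [← map_multiset_sum, ← map_add, hA, map_zero]
  rw [atom_iff]
  refine ⟨?_, ?_, ?_⟩
  · simp only [Multiset.sum_add, Multiset.sum_replicate, Multiset.sum_singleton]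
    rw [← hA1]; abel
  · intro h0
    have := congrArg Multiset.card h0
    simp at this
  · intro C hC h0 hCs
    obtain ⟨C₁, C', rfl, h1, h12⟩ := exists_add_of_le_add hC
    obtain ⟨C₂, C₃, rfl, h2, h3⟩ := exists_add_of_le_add h12
    obtain ⟨c, hc, rfl⟩ := Multiset.le_replicate_iff.1 h1
    obtain ⟨E, hE, rfl⟩ := exists_le_map h3
    rw [Multiset.sum_add, Multiset.sum_add, Multiset.sum_replicate] at hCs
    rcases Multiset.le_singleton.1 h2 with rfl | rfl
    · have hc0 : c = 0 := by
        by_contra hc0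
        refine hmin c (by omega) (by omega) ?_
        have : c • g = f (-E.sum) := by
          rw [map_neg, map_multiset_sum]
          exact eq_neg_of_add_eq_zero_left (by simpa using hCs)
        rw [this]; exact ⟨_, rfl⟩
      subst hc0
      simp only [zero_smul, Multiset.sum_zero, zero_add, Multiset.replicate_zero] at hCs h0
      rw [← map_multiset_sum, map_eq_zero_iff f hf] at hCs
      have := h.eq_of_le (hE.trans (Multiset.le_cons_self _ _)) (by simpa using h0) hCs
      subst this
      exact absurd (Multiset.card_le_card hE) (by simp)
    · have hc1 : c = m - 1 := by
        by_contra hc1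
        refine hmin (m - 1 - c) (by omega) (by omega) ?_
        have : (m - 1 - c) • g = f (a + E.sum) := by
          rw [map_add, map_multiset_sum]
          simp only [Multiset.sum_singleton] at hCs
          have e : (m - 1) • g = c • g + (m - 1 - c) • g := by
            rw [← add_smul]; congr 1; omega
          rw [e] at hCs
          have : f a + (E.map f).sum - (m - 1 - c) • g = 0 := by rw [← hCs]; abel
          exact (sub_eq_zero.1 this).symm
        rw [this]; exact ⟨_, rfl⟩
      subst hc1
      simp only [Multiset.sum_singleton] at hCs
      have h4 : f (a + E.sum) = 0 := by
        rw [map_add, map_multiset_sum, ← hCs]; abel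
      rw [map_eq_zero_iff f hf] at h4
      have := h.eq_of_le (Multiset.cons_le_cons a hE) (by simp) (by simpa using h4)
      rw [(Multiset.cons_inj_right a).1 this]

lemma atom_card_le_of_systemSets_eq {H : Type*} [AddCommGroup H] [Nontrivial H]
    (hL : SystemSets G = SystemSets H) {A : Multiset G} (hA : Atom A) :
    ∃ B : Multiset H, Atom B ∧ A.card ≤ B.card := by
  classical
  rcases le_or_gt A.card 2 with h2 | h2
  · obtain ⟨h, hh⟩ := exists_ne (0 : H)
    exact ⟨_, atom_pair hh, by simpa using h2⟩
  have h0 : (0 : G) ∉ A := fun h => by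
    rw [hA.eq_zero_of_mem h] at h2; simp at h2
  set B : Multiset G := A + A.map Neg.neg with hB
  have hneg : Atom (A.map Neg.neg) := atom_map (f := negAddMonoidHom) neg_injective hA
  have m2 : 2 ∈ LengthSet Set.univ B := by
    refine ⟨{A, A.map Neg.neg}, by simp, ?_, by simp [hB]⟩
    intro C hC
    simp at hC
    rcases hC with rfl | rfl
    exacts [hA, hneg]
  have mk : A.card ∈ LengthSet Set.univ B := by
    refine ⟨A.map fun g => {g, -g}, by simp, ?_, ?_⟩
    · intro C hC
      obtain ⟨g, hg, rfl⟩ := Multiset.mem_map.1 hC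
      exact atom_pair fun h => h0 (h ▸ hg)
    · rw [hB]
      generalize A = S
      induction S using Multiset.induction_on with
      | empty => simp
      | cons a S ih =>
        rw [Multiset.map_cons, Multiset.sum_cons, ih]
        rw [Multiset.map_cons, Multiset.add_cons, Multiset.cons_add, Multiset.insert_eq_cons,
          Multiset.cons_add, Multiset.singleton_add, Multiset.cons_swap]
  have hmem : LengthSet Set.univ B ∈ SystemSets G :=
    ⟨B, by rw [hB, Multiset.sum_add, hA.sum_eq, hneg.sum_eq, add_zero], rfl⟩
  rw [hL] at hmem
  obtain ⟨C, hC, hCL⟩ := hmem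
  rw [hCL] at m2 mk
  obtain ⟨F, hF2, hF, hFs⟩ := m2
  obtain ⟨F', hF2', hF', hFs'⟩ := mk
  obtain ⟨U, V, rfl⟩ := Multiset.card_eq_two.1 hF2
  have hU : Atom U := hF U (by simp)
  have hV : Atom V := hF V (by simp)
  have hC0 : (0 : H) ∉ C := by
    intro h0
    have aux : ∀ X : Multiset H, Atom X → C = {0} + X → False := by
      intro X hX hCX
      rw [← hFs'] at h0
      obtain ⟨Y, hY, h0Y⟩ := mem_msum.1 h0
      have hY0 := Atom.eq_zero_of_mem (hF' Y hY) h0Y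
      subst hY0
      obtain ⟨F'', rfl⟩ := Multiset.exists_cons_of_mem hY
      rw [Multiset.sum_cons, hCX, add_right_inj] at hFs'
      have hne : F'' ≠ 0 := by
        rintro rfl
        simp at hF2'; omega
      obtain ⟨Z, hZ⟩ := Multiset.exists_mem_of_ne_zero hne
      obtain ⟨F₃, rfl⟩ := Multiset.exists_cons_of_mem hZ
      rw [Multiset.sum_cons] at hFs'
      have hZa : Atom Z := hF' Z (by simp)
      have h5 := hX.eq_of_add hFs'.symm hZa.ne_zero hZa.sum_eq
      have h6 : F₃ = 0 := by
        by_contra hne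
        obtain ⟨W, hW⟩ := Multiset.exists_mem_of_ne_zero hne
        have := le_sum_of_mem hW
        rw [h5] at this
        exact Atom.ne_zero (hF' W (by simp [hW])) (by simpa using this)
      subst h6
      simp at hF2'; omega
    have : (0 : H) ∈ U + V := by rw [← hFs] at h0; simpa using h0
    rcases Multiset.mem_add.1 this with h | h
    · have e := hU.eq_zero_of_mem h
      exact aux V hV (by rw [← hFs, e]; simp)
    · have e := hV.eq_zero_of_mem h
      exact aux U hU (by rw [← hFs, e]; simp [add_comm])
  have hcard : A.card * 2 ≤ C.card := by
    have h1 := card_mul_le_wt (fun _ => 1) (F := F') (α := 2) (fun X hX => by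
      rw [wt_apply]
      simp only [Multiset.map_const', Multiset.sum_replicate, smul_eq_mul, mul_one]
      refine Atom.two_le_card (hF' X hX) ?_
      rintro rfl
      exact hC0 (hFs' ▸ mem_msum.2 ⟨_, hX, by simp⟩))
    rw [hFs', hF2', wt_apply] at h1
    simpa using h1
  have : C.card = U.card + V.card := by rw [← hFs]; simp
  rcases le_total U.card V.card with h | h
  · exact ⟨V, hV, by omega⟩
  · exact ⟨U, hU, by omega⟩

lemma exists_max_atom [Finite G] : ∃ A : Multiset G, Atom A ∧ ∀ B : Multiset G, Atom B → B.card ≤ A.card := by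
  classical
  cases nonempty_fintype G
  obtain ⟨A, hA, hmax⟩ := Nat.findGreatest_spec (P := fun k => ∃ A : Multiset G, Atom A ∧ A.card = k)
    (n := Fintype.card G) (m := 1) Fintype.card_pos ⟨({0} : Multiset G), atom_zero, by simp⟩
  exact ⟨A, hA, fun B hB => hmax ▸ Nat.le_findGreatest hB.card_le ⟨B, hB, rfl⟩⟩

/-- An embedding between finite groups with the same systems of sets of lengths is onto. -/
lemma nonempty_equiv_of_injective [Finite G] {H : Type*} [AddCommGroup H] [Finite H] [Nontrivial H]
    (hL : SystemSets G = SystemSets H) {f : H →+ G} (hf : Function.Injective f) :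
    Nonempty (G ≃+ H) := by
  by_cases hs : Function.Surjective f
  · exact ⟨(AddEquiv.ofBijective f ⟨hf, hs⟩).symm⟩
  · obtain ⟨A, hA, hmax⟩ := exists_max_atom (G := H)
    obtain ⟨B, hB, hlt⟩ := exists_larger_atom hf hs hA
    obtain ⟨C, hC, hle⟩ := atom_card_le_of_systemSets_eq hL hB
    have := hmax C hC
    omega

/-- The invariant of the system of sets of lengths used to compare groups: arbitrarily long sets of
lengths with elements in ratio `a : b`, all of whose elements are congruent modulo `d`. -/
def QProp (G : Type*) [AddCommGroup G] (d a b : ℕ) : Prop :=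
  ∀ k : ℕ, 1 ≤ k → ∃ L ∈ SystemSets G, k * a ∈ L ∧ k * b ∈ L ∧ ∀ x ∈ L, ∀ y ∈ L, x ≡ y [MOD d]

lemma QProp.congr {H : Type*} [AddCommGroup H] (hL : SystemSets G = SystemSets H) {d a b : ℕ}
    (h : QProp G d a b) : QProp H d a b := by
  intro k hk
  rw [← hL]
  exact h k hk

lemma atoms_nsmul {F : Multiset (Multiset G)} (h : ∀ A ∈ F, Atom A) (k : ℕ) :
    ∀ A ∈ k • F, Atom A := fun A hA => h A (Multiset.mem_of_mem_nsmul hA)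

lemma msum_nsmul {α : Type*} (k : ℕ) (F : Multiset (Multiset α)) : (k • F).sum = k • F.sum :=
  Multiset.sum_nsmul _ _

lemma Uniform.qProp {d : ℕ} {G₀ : Set G} (h : Uniform d G₀) {F F' : Multiset (Multiset G)}
    (hF : ∀ A ∈ F, Atom A) (hF' : ∀ A ∈ F', Atom A) (hs : F.sum = F'.sum)
    (hG : ∀ g ∈ F.sum, g ∈ G₀) : QProp G d F.card F'.card := by
  intro k hk
  refine ⟨LengthSet Set.univ (k • F.sum), ⟨_, ?_, rfl⟩, ?_, ?_, ?_⟩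
  · rw [Multiset.sum_nsmul, sum_sum_eq_zero fun A hA => (Atom.sum_eq (hF A hA)), smul_zero]
  · exact mem_lengthSet.2 ⟨k • F, by simp, atoms_nsmul hF k, msum_nsmul k F⟩
  · exact mem_lengthSet.2 ⟨k • F', by simp, atoms_nsmul hF' k, by rw [msum_nsmul, hs]⟩
  · rintro x ⟨E, rfl, hE, hEs⟩ y ⟨E', rfl, hE', hEs'⟩
    refine h E E' hE hE' (hEs.trans hEs'.symm) fun g hg => hG g ?_
    rw [hEs] at hg
    exact Multiset.mem_of_mem_nsmul hg

lemma wt_le_add {φ ψ : G → ℕ} {F : Multiset (Multiset G)} {β : ℕ}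
    (h : ∀ A ∈ F, wt φ A ≤ β + wt ψ A) : wt φ F.sum ≤ F.card * β + wt ψ F.sum := by
  induction F using Multiset.induction_on with
  | empty => simp
  | cons A F ih =>
    have h1 := h A (by simp)
    have h2 := ih fun A hA => h A (by simp [hA])
    simp only [Multiset.sum_cons, map_add, Multiset.card_cons, add_mul]
    omega

lemma le_wt_add {φ ψ : G → ℕ} {F : Multiset (Multiset G)} {α : ℕ}
    (h : ∀ A ∈ F, α ≤ wt φ A + wt ψ A) : F.card * α ≤ wt φ F.sum + wt ψ F.sum := by
  induction F using Multiset.induction_on with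
  | empty => simp
  | cons A F ih =>
    have h1 := h A (by simp)
    have h2 := ih fun A hA => h A (by simp [hA])
    simp only [Multiset.sum_cons, map_add, Multiset.card_cons, add_mul]
    omega

lemma wt_mul (c : ℕ) (φ : G → ℕ) (A : Multiset G) : wt (fun g => c * φ g) A = c * wt φ A := by
  induction A using Multiset.induction_on with
  | empty => simp
  | cons a A ih => simp [ih, mul_add]

lemma wt_congr {φ ψ : G → ℕ} {A : Multiset G} (h : ∀ g ∈ A, φ g = ψ g) : wt φ A = wt ψ A := by
  rw [wt_apply, wt_apply, Multiset.map_congr rfl h]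

lemma wt_eq_sum [Fintype G] [DecidableEq G] (φ : G → ℕ) (A : Multiset G) :
    wt φ A = ∑ g, A.count g * φ g := by
  rw [wt_apply, Finset.sum_multiset_map_count]
  simp only [smul_eq_mul]
  refine Finset.sum_subset (Finset.subset_univ _) fun g _ hg => ?_
  rw [Multiset.count_eq_zero.2 (by simpa using hg), zero_mul]

/-- A group with arbitrarily long sets of lengths in ratio `a : b` has a single uniform subset whose
atoms cannot all have nearly equal weight. -/
lemma QProp.exists_uniform [Finite G] {d a b : ℕ} (h : QProp G d a b) :
    ∃ G₀ : Set G, Uniform d G₀ ∧ ∀ (φ : G → ℕ) (α β : ℕ),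
      (∀ A, Atom A → (∀ g ∈ A, g ∈ G₀) → α ≤ wt φ A ∧ wt φ A ≤ β) → b * α ≤ a * β := by
  classical
  cases nonempty_fintype G
  by_contra! hcon
  choose! φ α β hw hlt using hcon
  have hwit : ∀ s : Set G, ∃ N : ℕ, ¬ Uniform d s → ∃ F F' : Multiset (Multiset G),
      (∀ A ∈ F, Atom A) ∧ (∀ A ∈ F', Atom A) ∧ F.sum = F'.sum ∧ (∀ g ∈ F.sum, g ∈ s) ∧
      ¬ F.card ≡ F'.card [MOD d] ∧ F.sum.card ≤ N := by
    intro s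
    by_cases hs : Uniform d s
    · exact ⟨0, fun h => absurd hs h⟩
    · have hs' := hs
      unfold Uniform at hs'
      push Not at hs'
      obtain ⟨F, F', h1, h2, h3, h4, h5⟩ := hs'
      exact ⟨F.sum.card, fun _ => ⟨F, F', h1, h2, h3, h4, h5, le_rfl⟩⟩
  choose N hN using hwit
  set N₀ := ∑ s, N s with hN₀
  have hNle : ∀ s, N s ≤ N₀ := fun s =>
    Finset.single_le_sum (f := N) (fun _ _ => Nat.zero_le _) (Finset.mem_univ s)
  set M : Set G → ℕ := fun s => Fintype.card G * ∑ g, φ s g with hM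
  set k := (Fintype.card G * N₀) * (∑ s, (M s + α s)) + 1 with hk
  obtain ⟨L, ⟨B, hB, rfl⟩, ⟨F₁, hc1, hF1, hs1⟩, ⟨F₂, hc2, hF2, hs2⟩, huni⟩ := h k (by omega)
  set s : Set G := {g | N₀ ≤ B.count g} with hs
  have hsu : Uniform d s := by
    by_contra hnu
    obtain ⟨F, F', h1, h2, h3, h4, h5, h6⟩ := hN s hnu
    have hle : F.sum ≤ B := by
      rw [Multiset.le_iff_count]
      intro g
      by_cases hg : g ∈ F.sum
      · exact ((Multiset.count_le_card _ _).trans (h6.trans (hNle s))).trans (h4 g hg)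
      · rw [Multiset.count_eq_zero.2 hg]; exact Nat.zero_le _
    obtain ⟨R, rfl⟩ := Multiset.le_iff_exists_add.1 hle
    rw [Multiset.sum_add, sum_sum_eq_zero fun A hA => Atom.sum_eq (h1 A hA), zero_add] at hB
    obtain ⟨E, hE, rfl⟩ := exists_fact hB
    have := huni (F.card + E.card) ⟨F + E, by simp, fun A hA =>
        (Multiset.mem_add.1 hA).elim (h1 A) (hE A), by simp⟩
      (F'.card + E.card) ⟨F' + E, by simp, fun A hA =>
        (Multiset.mem_add.1 hA).elim (h2 A) (hE A), by simp [h3]⟩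
    exact h5 (Nat.ModEq.add_right_cancel' _ this)
  set χ : G → ℕ := fun g => if g ∈ s then 0 else 1 with hχ
  set ψ : G → ℕ := fun g => if g ∈ s then φ s g else 0 with hψ
  have hT : wt χ B ≤ Fintype.card G * N₀ := by
    rw [wt_eq_sum]
    refine (Finset.sum_le_card_nsmul _ _ N₀ ?_).trans (by simp)
    intro g _
    by_cases hg : g ∈ s
    · simp [hχ, hg]
    · simp only [hχ, hg, if_false, mul_one]
      exact (not_le.1 hg).le
  have hA : ∀ A, Atom A → α s ≤ wt ψ A + α s * wt χ A ∧ wt ψ A ≤ β s + M s * wt χ A := by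
    intro A hA
    by_cases hAs : ∀ g ∈ A, g ∈ s
    · have := hw s hsu A hA hAs
      have e : wt ψ A = wt (φ s) A := wt_congr fun g hg => by simp [hψ, hAs g hg]
      rw [e]
      exact ⟨this.1.trans (Nat.le_add_right _ _), this.2.trans (Nat.le_add_right _ _)⟩
    · push Not at hAs
      obtain ⟨g, hg, hgs⟩ := hAs
      have h1 : 1 ≤ wt χ A := by simpa [hχ, hgs] using le_wt_of_mem χ hg
      constructor
      · nlinarith
      · have : wt ψ A ≤ M s := by
          refine (wt_le_card ψ (c := ∑ g, φ s g) fun x _ => ?_).trans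
            (Nat.mul_le_mul_right _ hA.card_le)
          refine le_trans ?_ (Finset.single_le_sum (f := φ s) (fun _ _ => Nat.zero_le _)
            (Finset.mem_univ x))
          simp only [hψ]; split_ifs <;> omega
        nlinarith
  have e1 := wt_le_add (φ := ψ) (ψ := fun g => M s * χ g) (F := F₁) (β := β s) fun A hAF => by
    rw [wt_mul]; exact (hA A (hF1 A hAF)).2
  have e2 := le_wt_add (φ := ψ) (ψ := fun g => α s * χ g) (F := F₂) (α := α s) fun A hAF => by
    rw [wt_mul]; exact (hA A (hF2 A hAF)).1
  rw [wt_mul, hs1, hc1] at e1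
  rw [wt_mul, hs2, hc2] at e2
  have e3 : M s + α s ≤ ∑ s, (M s + α s) :=
    Finset.single_le_sum (f := fun s => M s + α s) (fun _ _ => Nat.zero_le _) (Finset.mem_univ s)
  have e4 : wt χ B * (M s + α s) ≤ (Fintype.card G * N₀) * (∑ s, (M s + α s)) :=
    Nat.mul_le_mul hT e3
  have e5 : k * (a * β s) + k ≤ k * (b * α s) := by
    have := hlt s hsu
    nlinarith
  have e6 : k * b * α s ≤ k * a * β s + wt χ B * (M s + α s) := by
    nlinarith
  rw [mul_assoc, mul_assoc] at e6
  omega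

lemma exists_max_of_le {α : Type*} {P : α → Prop} (f : α → ℕ) (N : ℕ) (hex : ∃ a, P a)
    (hN : ∀ a, P a → f a ≤ N) : ∃ a, P a ∧ ∀ b, P b → f b ≤ f a := by
  classical
  obtain ⟨a, ha⟩ := hex
  obtain ⟨b, hb, he⟩ := Nat.findGreatest_spec (P := fun k => ∃ a, P a ∧ f a = k) (hN a ha)
    ⟨a, ha, rfl⟩
  exact ⟨b, hb, fun c hc => he ▸ Nat.le_findGreatest (hN c hc) ⟨c, hc, rfl⟩⟩

lemma card_eq_sum_count_map [DecidableEq G] {F : Multiset (Multiset G)} (f : Multiset G → G)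
    {S : Finset G} (h : ∀ V ∈ F, f V ∈ S) : F.card = ∑ g ∈ S, (F.map f).count g := by
  rw [Multiset.sum_count_eq_card, Multiset.card_map]
  intro a ha
  obtain ⟨V, hV, rfl⟩ := Multiset.mem_map.1 ha
  exact h V hV

lemma count_map_mul_le [DecidableEq G] {F : Multiset (Multiset G)} (f : Multiset G → G) (g : G)
    (c : ℕ) (h : ∀ V ∈ F, f V = g → c ≤ V.count g) :
    (F.map f).count g * c ≤ F.sum.count g := by
  induction F using Multiset.induction_on with
  | empty => simp
  | cons A F ih =>
    have h1 := h A (by simp)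
    have h2 := ih fun A hA => h A (by simp [hA])
    simp only [Multiset.sum_cons, Multiset.count_add, Multiset.map_cons, Multiset.count_cons]
    by_cases hA : g = f A
    · have := h1 hA.symm
      rw [if_pos hA, add_mul]; omega
    · rw [if_neg hA, add_zero]; omega

lemma not_le_nsmul [DecidableEq G] {U A : Multiset G} {k : ℕ} (h : ¬ U ≤ k • A) :
    ∃ g, k * A.count g < U.count g := by
  by_contra! hc
  exact h (Multiset.le_iff_count.2 fun g => by simpa using hc g)

lemma mem_of_le_nsmul {U A : Multiset G} {k : ℕ} (h : U ≤ k • A) {g : G} (hg : g ∈ U) : g ∈ A :=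
  Multiset.mem_of_mem_nsmul (Multiset.mem_of_le h hg)

lemma le_nsmul_of_subset {U A : Multiset G} (h : ∀ g ∈ U, g ∈ A) : U ≤ U.card • A := by
  classical
  rw [Multiset.le_iff_count]
  intro g
  by_cases hg : g ∈ U
  · have := Multiset.one_le_count_iff_mem.2 (h g hg)
    rw [Multiset.count_nsmul]
    nlinarith [Multiset.count_le_card g U]
  · rw [Multiset.count_eq_zero.2 hg]; exact Nat.zero_le _

lemma atom_eq_replicate {U : Multiset G} (hU : Atom U) {g : G} {m : ℕ} (hm : 0 < m)
    (hg : addOrderOf g = m) (hle : Multiset.replicate m g ≤ U) : U = Multiset.replicate m g := by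
  subst hg
  exact (hU.eq_of_le_atom hle (atom_replicate g hm)).symm

/-- Powers `j • A` of an atom with `j` minimal such that `A` is not the only atom below. -/
lemma exists_min_power [Finite G] [DecidableEq G] {A : Multiset G} (hA : Atom A)
    (hex : ∃ U, Atom U ∧ U ≠ A ∧ ∀ g ∈ U, g ∈ A) :
    ∃ (j : ℕ) (F : Multiset (Multiset G)), 2 ≤ j ∧ (∀ U, Atom U → U ≠ A → ¬ U ≤ (j - 1) • A) ∧
      F.sum = j • A ∧ (∀ V ∈ F, Atom V ∧ V ≠ A ∧ ∀ g ∈ V, g ∈ A) ∧ 2 ≤ F.card ∧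
      F.card ≤ A.toFinset.card ∧ ∀ g ∈ A, (j - 1) * A.count g < addOrderOf g := by
  classical
  have hex' : ∃ j : ℕ, ∃ U, Atom U ∧ U ≠ A ∧ U ≤ j • A := by
    obtain ⟨U, h1, h2, h3⟩ := hex
    exact ⟨U.card, U, h1, h2, le_nsmul_of_subset h3⟩
  obtain ⟨U, hU, hUA, hle⟩ := Nat.find_spec hex'
  have hmin := fun i => Nat.find_min hex' (m := i)
  set j := Nat.find hex'
  have hj2 : 2 ≤ j := by
    by_contra hc
    have : j = 0 ∨ j = 1 := by omega
    rcases this with h | h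
    · rw [h, zero_smul] at hle
      exact hU.ne_zero (by simpa using hle)
    · rw [h, one_smul] at hle
      exact hUA (hA.eq_of_le_atom hle hU)
  have hmin' : ∀ V, Atom V → V ≠ A → ¬ V ≤ (j - 1) • A := fun V h1 h2 h3 =>
    hmin (j - 1) (by omega) ⟨V, h1, h2, h3⟩
  obtain ⟨F, hUF, hF, hFs⟩ := exists_fact_of_le (by rw [Multiset.sum_nsmul, hA.sum_eq, smul_zero])
    hU hle
  have hjA : j • A = A + (j - 1) • A := by
    rw [← succ_nsmul', Nat.sub_add_cancel (by omega)]
  have hneA : ∀ V ∈ F, V ≠ A := by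
    rintro V hV rfl
    obtain ⟨F', rfl⟩ := Multiset.exists_cons_of_mem hV
    rw [Multiset.sum_cons, hjA, add_right_inj] at hFs
    have : U ∈ F' := (Multiset.mem_cons.1 hUF).resolve_left hUA
    exact hmin' U hU hUA (hFs ▸ le_sum_of_mem this)
  have hsub : ∀ V ∈ F, ∀ g ∈ V, g ∈ A := fun V hV g hg =>
    Multiset.mem_of_mem_nsmul (hFs ▸ Multiset.mem_of_le (le_sum_of_mem hV) hg)
  have hch : ∀ V ∈ F, ∃ g, (j - 1) * A.count g < V.count g := fun V hV =>
    not_le_nsmul (hmin' V (hF V hV) (hneA V hV))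
  have hne : ∃ g, g ∈ A := Multiset.exists_mem_of_ne_zero hA.ne_zero
  choose! f hf using hch
  refine ⟨j, F, hj2, hmin', hFs, fun V hV => ⟨hF V hV, hneA V hV, hsub V hV⟩, ?_, ?_, ?_⟩
  · by_contra hc
    obtain ⟨F', rfl⟩ := Multiset.exists_cons_of_mem hUF
    have : F' = 0 := by
      rw [← Multiset.card_eq_zero]; rw [Multiset.card_cons] at hc; omega
    subst this
    simp only [Multiset.sum_cons, Multiset.sum_zero, add_zero] at hFs
    have := hU.eq_of_add (hFs.trans hjA) hA.ne_zero hA.sum_eq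
    rw [hFs, hjA, this, add_zero] at hUA
    exact hUA rfl
  · rw [card_eq_sum_count_map f (S := A.toFinset)]
    · rw [Finset.card_eq_sum_ones]
      refine Finset.sum_le_sum fun g hg => ?_
      have h1 := count_map_mul_le (F := F) f g ((j - 1) * A.count g + 1) fun V hV h => by
        have := hf V hV; rw [h] at this; omega
      rw [hFs, Multiset.count_nsmul] at h1
      have h2 : 1 ≤ A.count g := Multiset.one_le_count_iff_mem.2 (by simpa using hg)
      by_contra hc
      obtain ⟨i, hi⟩ : ∃ i, j = i + 2 := ⟨j - 2, by omega⟩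
      have e : j - 1 = i + 1 := by omega
      rw [e, hi] at h1
      have h3 : 2 ≤ (F.map f).count g := by omega
      have h4 := (Nat.mul_le_mul_right ((i + 1) * A.count g + 1) h3).trans h1
      ring_nf at h4
      omega
    · intro V hV
      have := hf V hV
      have h1 : f V ∈ V := Multiset.count_pos.1 (by omega)
      simpa using hsub V hV _ h1
  · intro g hg
    by_contra hc
    have hle' : Multiset.replicate (addOrderOf g) g ≤ (j - 1) • A := by
      rw [← Multiset.le_count_iff_replicate_le, Multiset.count_nsmul]
      omega
    have hat := atom_replicate g (addOrderOf_pos g)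
    have hAe : Multiset.replicate (addOrderOf g) g = A := by
      by_contra h
      exact hmin' _ hat h hle'
    refine hUA ?_
    have hUg : ∀ x ∈ U, x = g := fun x hx => by
      have := mem_of_le_nsmul hle hx
      rw [← hAe] at this
      exact Multiset.eq_of_mem_replicate this
    have hUr := Multiset.eq_replicate_card.2 hUg
    have h0 := hU.sum_eq
    rw [hUr, Multiset.sum_replicate] at h0
    have h1 := addOrderOf_dvd_of_nsmul_eq_zero h0
    have h2 : 0 < U.card := Multiset.card_pos.2 hU.ne_zero
    rw [← hAe]
    refine atom_eq_replicate hU (addOrderOf_pos g) rfl ?_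
    rw [hUr, Multiset.replicate_le_replicate]
    exact Nat.le_of_dvd h2 h1

lemma wt_count_lt [Finite G] [DecidableEq G] {A V : Multiset G} (h : V ≠ A)
    (hle : wt (fun g => V.count g) V ≤ wt (fun g => A.count g) A) :
    wt (fun g => A.count g) V < wt (fun g => A.count g) A := by
  cases nonempty_fintype G
  rw [wt_eq_sum, wt_eq_sum] at *
  obtain ⟨x, hx⟩ : ∃ x, V.count x ≠ A.count x := by
    by_contra! hc
    exact h (Multiset.ext.2 hc)
  have : ∑ g, 2 * (V.count g * A.count g) < ∑ g, (V.count g * V.count g + A.count g * A.count g) := by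
    refine Finset.sum_lt_sum (fun g _ => ?_) ⟨x, Finset.mem_univ _, ?_⟩
    · have := sq_nonneg ((V.count g : ℤ) - A.count g)
      zify; nlinarith
    · have : 0 < ((V.count x : ℤ) - A.count x) ^ 2 := by
        refine sq_pos_of_ne_zero (sub_ne_zero.2 (by exact_mod_cast hx))
      zify; nlinarith
  rw [Finset.sum_add_distrib, ← Finset.mul_sum] at this
  omega

lemma card_ne_of_sum_eq_nsmul [Finite G] [DecidableEq G] {A : Multiset G}
    {F : Multiset (Multiset G)} {j : ℕ} (hs : F.sum = j • A) (hF : 0 < F.card)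
    (h : ∀ V ∈ F, V ≠ A ∧ wt (fun g => V.count g) V ≤ wt (fun g => A.count g) A) : F.card ≠ j := by
  intro hj
  set c := wt (fun g => A.count g) A with hc
  have hlt : ∀ V ∈ F, wt (fun g => A.count g) V + 1 ≤ c := fun V hV =>
    wt_count_lt (h V hV).1 (h V hV).2
  obtain ⟨V, hV⟩ := Multiset.exists_mem_of_ne_zero (Multiset.card_pos.1 hF)
  have h1 := hlt V hV
  have h2 := wt_le_card_mul (fun g => A.count g) (F := F) (β := c - 1) fun V hV => by
    have := hlt V hV; omega
  rw [hs, map_nsmul, ← hc, hj, smul_eq_mul] at h2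
  have : j * (c - 1) < j * c := Nat.mul_lt_mul_of_pos_left (by omega) (by omega)
  omega

lemma over_nsmul {A : Multiset G} {G₀ : Set G} (h : ∀ g ∈ A, g ∈ G₀) (k : ℕ) :
    ∀ g ∈ k • A, g ∈ G₀ := fun g hg => h g (Multiset.mem_of_mem_nsmul hg)

lemma Uniform.card_modEq {d : ℕ} {G₀ : Set G} (h : Uniform d G₀) {A : Multiset G} (hA : Atom A)
    (hG : ∀ g ∈ A, g ∈ G₀) {F : Multiset (Multiset G)} (hF : ∀ V ∈ F, Atom V) {j : ℕ}
    (hs : F.sum = j • A) : F.card ≡ j [MOD d] := by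
  have := h F (Multiset.replicate j A) hF (fun V hV => by rwa [Multiset.eq_of_mem_replicate hV])
    (by simpa using hs) (by rw [hs]; exact over_nsmul hG j)
  simpa using this

lemma wt_ordWt_eq_of_zero {n : ℕ} : wt (ordWt n) ({0} : Multiset G) = n := by simp [ordWt]

lemma two_le_wt {n : ℕ} (hn : 0 < n) {A : Multiset G} (hA : Atom A) (h : ∀ g ∈ A, n • g = 0)
    (hlt : wt (ordWt n) A < n) : 2 ≤ wt (ordWt n) A := by
  have h0 : A ≠ {0} := by
    rintro rfl
    rw [wt_ordWt_eq_of_zero] at hlt; omega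
  exact (hA.two_le_card h0).trans (card_le_wt _ fun g hg => ordWt_pos hn (h g hg))

/-- In a uniform set with an atom of small weight, the distance is at most `n - 2`. -/
lemma Uniform.add_two_le {n d : ℕ} (hn : 0 < n) {G₀ : Set G} (h : Uniform d G₀)
    (hG : ∀ g ∈ G₀, n • g = 0) {A : Multiset G} (hA : Atom A) (hA' : ∀ g ∈ A, g ∈ G₀)
    (hlt : wt (ordWt n) A < n) : d + wt (ordWt n) A ≤ n := by
  have h1 := h.wt_modEq hn hG hA hA'
  have h3 := (Nat.modEq_iff_dvd' hlt.le).1 h1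
  have := Nat.le_of_dvd (by omega) h3
  omega

lemma wt_replicate_addOrderOf {n : ℕ} {g : G} (h : n • g = 0) :
    wt (ordWt n) (Multiset.replicate (addOrderOf g) g) = n := by
  rw [wt_replicate, ordWt_mul h]

set_option maxHeartbeats 1600000 in
/-- The structure of uniform sets with large distance having an atom of small weight. -/
lemma Uniform.exists_basis_atom [Finite G] {n d : ℕ} {G₀ : Set G} (h : Uniform d G₀)
    (hG : ∀ g ∈ G₀, n • g = 0) (h2d : n < 2 * d + 2) {A₀ : Multiset G} (hA₀ : Atom A₀)
    (hA₀' : ∀ g ∈ A₀, g ∈ G₀) (hlt : wt (ordWt n) A₀ < n) :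
    ∃ A, Atom A ∧ (∀ g ∈ A, g ∈ G₀) ∧ A.Nodup ∧ A.card + d = n ∧ (∀ g ∈ A, addOrderOf g = n) ∧
      ∀ U, Atom U → (∀ g ∈ U, g ∈ A) → U = A ∨ ∃ g ∈ A, U = Multiset.replicate n g := by
  classical
  have hn : 0 < n := by omega
  have small : ∀ U, Atom U → (∀ g ∈ U, g ∈ G₀) → wt (ordWt n) U < n → wt (ordWt n) U + d = n := by
    intro U hU hUG hlt
    have h1 := h.wt_modEq hn hG hU hUG
    obtain ⟨c, hc⟩ := (Nat.modEq_iff_dvd' hlt.le).1 h1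
    have h2 := two_le_wt hn hU (fun g hg => hG g (hUG g hg)) hlt
    have : c = 1 := by
      have h3 : c ≠ 0 := by rintro rfl; omega
      by_contra h1
      have : 2 ≤ c := by omega
      nlinarith [Nat.sub_add_cancel hlt.le]
    subst this; omega
  have hd : d < n := by
    have := small A₀ hA₀ hA₀' hlt
    have := two_le_wt hn hA₀ (fun g hg => hG g (hA₀' g hg)) hlt
    omega
  obtain ⟨A, ⟨hA, hAG, hAw⟩, hmax⟩ := exists_max_of_le
    (P := fun A => Atom A ∧ (∀ g ∈ A, g ∈ G₀) ∧ wt (ordWt n) A + d = n)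
    (fun A => wt (fun g => A.count g) A) (n * n) ⟨A₀, hA₀, hA₀', small A₀ hA₀ hA₀' hlt⟩ (by
      rintro A ⟨hA, hAG, hAw⟩
      have h1 : A.card ≤ n := (card_le_wt (ordWt n) fun g hg => ordWt_pos hn (hG g (hAG g hg))).trans
        (by omega)
      exact (wt_le_card _ fun g _ => (Multiset.count_le_card g A).trans h1).trans
        (Nat.mul_le_mul_right _ h1))
  have hd1 : 1 ≤ d := by
    have := small A₀ hA₀ hA₀' hlt
    omega
  have ord_dvd : ∀ g ∈ A, addOrderOf g ∣ n := fun g hg =>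
    addOrderOf_dvd_of_nsmul_eq_zero (hG g (hAG g hg))
  obtain ⟨j, F, hj2, hjmin, hFs, hF, hF2, hFc, hord⟩ := exists_min_power hA (by
    obtain ⟨g, hg⟩ := Multiset.exists_mem_of_ne_zero hA.ne_zero
    refine ⟨Multiset.replicate (addOrderOf g) g, atom_replicate g (addOrderOf_pos g), ?_, ?_⟩
    · intro he
      have := wt_replicate_addOrderOf (hG g (hAG g hg))
      rw [he] at this; omega
    · intro x hx
      rwa [Multiset.eq_of_mem_replicate hx])
  have hwge : ∀ U, Atom U → (∀ g ∈ U, g ∈ A) → n ≤ wt (ordWt n) U + d := by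
    intro U hU hUA
    by_contra hc
    have := small U hU (fun g hg => hAG g (hUA g hg)) (by omega)
    omega
  have hmod := h.card_modEq hA hAG (fun V hV => (hF V hV).1) hFs
  have htj : F.card ≤ j := by
    have h1 := card_mul_le_wt (ordWt n) (F := F) (α := n - d) fun V hV => by
      have := hwge V (hF V hV).1 (hF V hV).2.2; omega
    rw [hFs, map_nsmul, show wt (ordWt n) A = n - d by omega, smul_eq_mul] at h1
    exact Nat.le_of_mul_le_mul_right h1 (by omega)
  have htne : F.card ≠ j := by
    intro htj
    refine card_ne_of_sum_eq_nsmul hFs (by omega) (fun V hV => ⟨(hF V hV).2.1, ?_⟩) htj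
    refine hmax V ⟨(hF V hV).1, fun g hg => hAG g ((hF V hV).2.2 g hg), ?_⟩
    obtain ⟨F', rfl⟩ := Multiset.exists_cons_of_mem hV
    have h1 := card_mul_le_wt (ordWt n) (F := F') (α := n - d) fun W hW => by
      have := hwge W (hF W (by simp [hW])).1 (hF W (by simp [hW])).2.2; omega
    have h2 := congrArg (wt (ordWt n)) hFs
    have h3 := hwge V (hF V hV).1 (hF V hV).2.2
    rw [map_nsmul, show wt (ordWt n) A = n - d by omega, smul_eq_mul, Multiset.sum_cons, map_add,
      ← htj, Multiset.card_cons, add_mul] at h2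
    omega
  have hjd : F.card + d ≤ j := by
    have := Nat.le_of_dvd (by omega) ((Nat.modEq_iff_dvd' htj).1 hmod)
    omega
  have hcount1 : ∀ g ∈ A, A.count g = 1 ∧ addOrderOf g = n := by
    intro g hg
    have h1 := hord g hg
    have h2 : 1 ≤ A.count g := Multiset.one_le_count_iff_mem.2 hg
    have h3 := ord_dvd g hg
    have h4 : addOrderOf g = n := by
      obtain ⟨c, hc⟩ := h3
      have h5 : d + 1 ≤ (j - 1) * A.count g := by
        have : d + 1 ≤ j - 1 := by omega
        nlinarith
      rcases Nat.lt_or_ge c 2 with h6 | h6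
      · interval_cases c
        · omega
        · omega
      · nlinarith
    refine ⟨?_, h4⟩
    by_contra hne
    have : 2 ≤ A.count g := by omega
    have : d + 1 ≤ j - 1 := by omega
    nlinarith
  have hnodup : A.Nodup := Multiset.nodup_iff_count_le_one.2 fun g => by
    by_cases hg : g ∈ A
    · exact (hcount1 g hg).1.le
    · rw [Multiset.count_eq_zero.2 hg]; exact Nat.zero_le _
  have hwcard : ∀ U : Multiset G, (∀ g ∈ U, g ∈ A) → wt (ordWt n) U = U.card := by
    intro U hU
    rw [wt_congr (ψ := fun _ => 1) fun g hg => by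
      simp [ordWt, (hcount1 g (hU g hg)).2, Nat.div_self hn]]
    simp [wt_apply]
  have hAcard : A.card + d = n := by rw [← hwcard A fun g hg => hg]; exact hAw
  have bigcount : ∀ U, Atom U → U ≠ A → (∀ g ∈ U, g ∈ A) → ∃ g ∈ A, j ≤ U.count g := by
    intro U hU hUA hsub
    obtain ⟨g, hg⟩ := not_le_nsmul (hjmin U hU hUA)
    have hgU : g ∈ U := Multiset.count_pos.1 (by omega)
    refine ⟨g, hsub g hgU, ?_⟩
    rw [(hcount1 g (hsub g hgU)).1] at hg
    omega
  have cardge : ∀ U, Atom U → U ≠ A → (∀ g ∈ U, g ∈ A) → n ≤ U.card := by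
    intro U hU hUA hsub
    by_contra hc
    have h1 := small U hU (fun g hg => hAG g (hsub g hg)) (by rw [hwcard U hsub]; omega)
    rw [hwcard U hsub] at h1
    obtain ⟨g, _, h2⟩ := bigcount U hU hUA hsub
    have := Multiset.count_le_card g U
    omega
  have rep_at : ∀ g ∈ A, Atom (Multiset.replicate n g) := fun g hg => by
    have := atom_replicate g (addOrderOf_pos g)
    rwa [(hcount1 g hg).2] at this
  have cardeq : ∀ U, Atom U → U ≠ A → (∀ g ∈ U, g ∈ A) → U.card = n := by
    intro U hU hUA hsub
    by_cases hrep : ∃ g ∈ A, U = Multiset.replicate n g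
    · obtain ⟨g, _, rfl⟩ := hrep; simp
    push Not at hrep
    have hcn : ∀ g, U.count g < n := by
      intro g
      by_contra hc
      have hg : g ∈ U := Multiset.count_pos.1 (by omega)
      exact hrep g (hsub g hg) (atom_eq_replicate hU hn (hcount1 g (hsub g hg)).2
        (Multiset.le_count_iff_replicate_le.1 (by omega)))
    obtain ⟨S, hS⟩ : ∃ S, n • U.dedup = U + S := by
      refine Multiset.le_iff_exists_add.1 (Multiset.le_iff_count.2 fun g => ?_)
      rw [Multiset.count_nsmul]
      by_cases hg : g ∈ U
      · rw [Multiset.count_dedup, if_pos hg]; have := hcn g; omega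
      · rw [Multiset.count_eq_zero.2 hg]; exact Nat.zero_le _
    obtain ⟨E, hE1, hE, hEs⟩ := exists_fact_nsmul hn U.dedup fun g hg =>
      hG g (hAG g (hsub g (by simpa using hg)))
    have hSub : ∀ g ∈ S, g ∈ U := fun g hg => by
      have : g ∈ n • U.dedup := hS ▸ Multiset.mem_add.2 (Or.inr hg)
      simpa using Multiset.mem_of_mem_nsmul this
    have hS0 : S.sum = 0 := by
      have := congrArg Multiset.sum hS
      rw [← hEs, sum_sum_eq_zero fun A hA => Atom.sum_eq (hE A hA), Multiset.sum_add, hU.sum_eq,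
        zero_add] at this
      exact this.symm
    obtain ⟨F', hF', rfl⟩ := exists_fact hS0
    have hF'A : ∀ V ∈ F', n ≤ V.card := by
      intro V hV
      have hVU : ∀ g ∈ V, g ∈ U := fun g hg => hSub g (Multiset.mem_of_le (le_sum_of_mem hV) hg)
      refine cardge V (hF' V hV) ?_ fun g hg => hsub g (hVU g hg)
      rintro rfl
      exact hUA (hU.eq_of_le_atom ((Multiset.le_iff_subset hnodup).2 hVU) hA).symm
    have hu : wt (ordWt n) U.dedup = U.dedup.card := hwcard _ fun g hg => hsub g (by simpa using hg)
    have hm := h (U ::ₘ F') E (fun V hV => (Multiset.mem_cons.1 hV).elim (fun e => e ▸ hU) (hF' V))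
      hE (by rw [Multiset.sum_cons, hEs, hS]) (fun g hg => by
        rw [Multiset.sum_cons] at hg
        exact hAG g (hsub g ((Multiset.mem_add.1 hg).elim id (hSub g))))
    rw [Multiset.card_cons, hE1, hu] at hm
    have hul : U.dedup.card + 1 ≤ A.card := by
      rw [Nat.add_one_le_iff]
      refine Multiset.card_lt_card (lt_of_le_of_ne ((Multiset.le_iff_subset
        (Multiset.nodup_dedup U)).2 fun g hg => hsub g (by simpa using hg)) fun he => hUA ?_)
      exact (hU.eq_of_le_atom (he ▸ Multiset.dedup_le U) hA).symm
    have hcard := congrArg Multiset.card hS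
    rw [Multiset.card_nsmul, Multiset.card_add] at hcard
    have hUge := cardge U hU hUA hsub
    have hF'w := card_mul_le_wt (fun _ => 1) (F := F') (α := n) fun V hV => by
      simpa [wt_apply] using hF'A V hV
    have e1 : wt (fun _ => 1) F'.sum = F'.sum.card := by simp [wt_apply]
    rw [e1] at hF'w
    have hmle : F'.card + 1 ≤ U.dedup.card := by
      by_contra hc
      have : U.dedup.card ≤ F'.card := by omega
      nlinarith
    have hF'pos : 1 ≤ F'.card := by
      by_contra hc
      have : F' = 0 := Multiset.card_eq_zero.1 (by omega)
      subst this
      simp only [Multiset.sum_zero, add_zero] at hS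
      obtain ⟨g, hg⟩ := Multiset.exists_mem_of_ne_zero hU.ne_zero
      have := hcn g
      rw [← hS, Multiset.count_nsmul, Multiset.count_dedup, if_pos hg] at this
      omega
    have hdvd := (Nat.modEq_iff_dvd' hmle).1 hm
    have hz : U.dedup.card - (F'.card + 1) = 0 :=
      Nat.eq_zero_of_dvd_of_lt hdvd (by omega)
    have : U.dedup.card = F'.card + 1 := by omega
    rw [this] at hcard
    nlinarith
  have hjn : j = n := by
    have h1 : wt (ordWt n) F.sum = F.card * n := by
      refine le_antisymm (wt_le_card_mul _ fun V hV => ?_) (card_mul_le_wt _ fun V hV => ?_) <;>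
      · obtain ⟨a, b, c⟩ := hF V hV
        rw [hwcard V c, cardeq V a b c]
    rw [hFs, map_nsmul, hwcard A fun g hg => hg, smul_eq_mul] at h1
    obtain ⟨c, hc⟩ := (Nat.modEq_iff_dvd' htj).1 hmod
    have hjle : j ≤ n := by
      obtain ⟨g, hg⟩ := Multiset.exists_mem_of_ne_zero hA.ne_zero
      have := hord g hg
      rw [(hcount1 g hg).1, (hcount1 g hg).2] at this
      omega
    obtain ⟨i, hi⟩ : ∃ i, j = F.card + i := ⟨j - F.card, by omega⟩
    have hi' : i = d * c := by omega
    have h2 : d * j = d * (c * n) := by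
      have e : A.card = n - d := by omega
      have : j * n = j * A.card + j * d := by rw [← mul_add, hAcard]
      rw [h1] at this
      rw [hi, hi'] at this ⊢
      nlinarith
    have h3 := Nat.eq_of_mul_eq_mul_left hd1 h2
    have : c = 1 := by
      have : c ≠ 0 := by rintro rfl; omega
      by_contra hne
      have : 2 ≤ c := by omega
      nlinarith
    rw [h3, this, one_mul]
  refine ⟨A, hA, hAG, hnodup, hAcard, fun g hg => (hcount1 g hg).2, fun U hU hsub => ?_⟩
  by_cases hUA : U = A
  · exact Or.inl hUA
  · obtain ⟨g, hg, hjg⟩ := bigcount U hU hUA hsub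
    exact Or.inr ⟨g, hg, atom_eq_replicate hU hn (hcount1 g hg).2
      (Multiset.le_count_iff_replicate_le.1 (hjn ▸ hjg))⟩

lemma exists_min {α : Type*} {P : α → Prop} (f : α → ℕ) (hex : ∃ a, P a) :
    ∃ a, P a ∧ ∀ b, P b → f a ≤ f b := by
  classical
  have h : ∃ k a, P a ∧ f a = k := by
    obtain ⟨a, ha⟩ := hex
    exact ⟨f a, a, ha, rfl⟩
  obtain ⟨a, ha, he⟩ := Nat.find_spec h
  exact ⟨a, ha, fun b hb => he ▸ Nat.find_min' h ⟨b, hb, rfl⟩⟩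

/-- Up to an integer coprime to `p`, a finite set is generated by few of its elements. -/
lemma exists_small_generators [Finite G] {p s : ℕ} (hp : p.Prime)
    (hs : Nat.card {g : G // p • g = 0} ≤ p ^ s) (S : Finset G) :
    ∃ E ⊆ S, E.card ≤ s ∧ ∃ q : ℕ, q.Coprime p ∧
      ∀ g ∈ S, q • g ∈ Submodule.span ℤ (E : Set G) := by
  classical
  obtain ⟨E, ⟨hES, q, hq, hqE⟩, hmin⟩ := exists_min
    (P := fun E : Finset G => E ⊆ S ∧ ∃ q : ℕ, q.Coprime p ∧
      ∀ g ∈ S, q • g ∈ Submodule.span ℤ (E : Set G)) Finset.card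
    ⟨S, subset_rfl, 1, Nat.coprime_one_left p, fun g hg => by
      rw [one_smul]; exact Submodule.subset_span hg⟩
  refine ⟨E, hES, ?_, q, hq, hqE⟩
  set K := Submodule.span ℤ (E : Set G) with hK
  set f : K →+ K := nsmulAddMonoidHom p with hf
  have hker : Nat.card f.ker ≤ p ^ s := by
    refine le_trans (Nat.card_le_card_of_injective
      (fun x : f.ker => (⟨((x : K) : G), ?_⟩ : {g : G // p • g = 0})) ?_) hs
    · have := x.2
      rw [AddMonoidHom.mem_ker] at this
      have h2 : p • (x : K) = 0 := this
      have h3 := congrArg K.subtype h2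
      rw [map_nsmul, map_zero] at h3
      exact h3
    · intro x y hxy
      have h2 : ((x : K) : G) = ((y : K) : G) := Subtype.mk_eq_mk.1 hxy
      exact Subtype.ext (Subtype.ext h2)
  have hidx : Nat.card (K ⧸ f.range) ≤ p ^ s := by
    have := AddSubgroup.index_range (f := f)
    rw [AddSubgroup.index] at this
    rw [this]; exact hker
  have hmem : ∀ e : E, (e : G) ∈ K := fun e => Submodule.subset_span (Finset.mem_coe.2 e.2)
  set ι : E → K := fun e => ⟨e, hmem e⟩ with hι
  set Φ : (E → Fin p) → K ⧸ f.range := fun c =>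
    QuotientAddGroup.mk (∑ e : E, (c e : ℕ) • ι e) with hΦ
  have hinj : Function.Injective Φ := by
    intro c c' hcc
    by_contra hne
    obtain ⟨e₀, he₀⟩ := Function.ne_iff.1 hne
    rw [hΦ, QuotientAddGroup.eq] at hcc
    obtain ⟨y, hy⟩ := hcc
    have hy2 := congrArg K.subtype hy
    obtain ⟨b, -, hb⟩ := Submodule.mem_span_finset.1 y.2
    simp only [hf, nsmulAddMonoidHom_apply, map_add, map_neg, map_sum, map_nsmul, hι,
      Submodule.subtype_apply] at hy2
    rw [← hb, ← Finset.sum_coe_sort E (fun a => b a • a)] at hy2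
    set u : E → ℤ := fun e => (c' e : ℤ) - c e - p * b e with hu
    have hz : ∑ e : E, u e • (e : G) = 0 := by
      simp only [hu, sub_smul, Finset.sum_sub_distrib, mul_smul, ← Finset.smul_sum]
      simp only [natCast_zsmul]
      rw [hy2]
      abel
    set N := (u e₀).natAbs with hN
    have hcop : N.Coprime p := by
      rw [Nat.coprime_comm, Nat.Prime.coprime_iff_not_dvd hp, hN, ← Int.natCast_dvd]
      intro hd
      have h1 : (p : ℤ) ∣ (c' e₀ : ℤ) - c e₀ := by
        have := dvd_add hd (dvd_mul_right (p : ℤ) (b e₀))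
        simpa [hu] using this
      have h2 := (c' e₀).2
      have h3 := (c e₀).2
      have h4 : (c' e₀ : ℤ) - c e₀ ≠ 0 := by
        intro h0
        apply he₀
        apply Fin.ext
        omega
      have h5 := Int.le_of_dvd (b := |(c' e₀ : ℤ) - c e₀|) (abs_pos.2 h4) ((dvd_abs _ _).2 h1)
      have h6 : |(c' e₀ : ℤ) - c e₀| < p := abs_lt.2 ⟨by omega, by omega⟩
      omega
    have hspan : ∀ x ∈ K, N • x ∈ Submodule.span ℤ ((E.erase e₀ : Finset G) : Set G) := by
      have h0 : u e₀ • (e₀ : G) ∈ Submodule.span ℤ ((E.erase e₀ : Finset G) : Set G) := by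
        have : u e₀ • (e₀ : G) = - ∑ e ∈ Finset.univ.erase e₀, u e • (e : G) := by
          rw [← Finset.add_sum_erase _ _ (Finset.mem_univ e₀)] at hz
          exact eq_neg_of_add_eq_zero_left hz
        rw [this]
        refine neg_mem (Submodule.sum_mem _ fun e he => Submodule.smul_mem _ _
          (Submodule.subset_span ?_))
        have : (e : G) ≠ e₀ := fun h => (Finset.ne_of_mem_erase he) (Subtype.ext h)
        simp [this]
      have hN0 : N • (e₀ : G) ∈ Submodule.span ℤ ((E.erase e₀ : Finset G) : Set G) := by
        rcases Int.natAbs_eq (u e₀) with h | h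
        · rwa [h, ← hN, natCast_zsmul] at h0
        · rw [h, ← hN, neg_smul, natCast_zsmul] at h0
          exact neg_mem_iff.1 h0
      intro x hx
      have hle : K ≤ (Submodule.span ℤ ((E.erase e₀ : Finset G) : Set G)).comap
          (N • (LinearMap.id : G →ₗ[ℤ] G)) := by
        rw [hK, Submodule.span_le]
        intro e he
        simp only [SetLike.mem_coe, Submodule.mem_comap, LinearMap.smul_apply, LinearMap.id_apply]
        by_cases hee : e = e₀
        · rw [hee]; exact hN0
        · exact Submodule.smul_of_tower_mem _ N (Submodule.subset_span (by simpa [hee] using he))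
      simpa using hle hx
    have := hmin (E.erase e₀) ⟨(Finset.erase_subset _ _).trans hES, q * N,
      Nat.Coprime.mul_left hq hcop, fun g hg => by
        rw [mul_comm, mul_smul]; exact hspan _ (hqE g hg)⟩
    rw [Finset.card_erase_of_mem e₀.2] at this
    have : 0 < E.card := Finset.card_pos.2 ⟨_, e₀.2⟩
    omega
  have := (Nat.card_le_card_of_injective Φ hinj).trans hidx
  simp only [Nat.card_eq_fintype_card, Fintype.card_fun, Fintype.card_fin, Fintype.card_coe] at this
  exact (Nat.pow_le_pow_iff_right hp.one_lt).1 this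

lemma one_of_coprime_closed {Q : ℕ → Prop} (hadd : ∀ a b, Q a → Q b → Q (a + b))
    (hsub : ∀ a b, Q (a + b) → Q a → Q b) (hcop : ∀ p : ℕ, p.Prime → ∃ q, q.Coprime p ∧ Q q) :
    Q 1 := by
  have hQ0 : Q 0 := by
    obtain ⟨q, _, hq⟩ := hcop 2 Nat.prime_two
    exact hsub q 0 hq hq
  have hpos : ∃ q, 0 < q ∧ Q q := by
    obtain ⟨q, h1, hq⟩ := hcop 2 Nat.prime_two
    refine ⟨q, Nat.pos_of_ne_zero ?_, hq⟩
    rintro rfl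
    simp at h1
  obtain ⟨q₀, ⟨h0, hq₀⟩, hmin⟩ := exists_min (P := fun q => 0 < q ∧ Q q) (fun q => q) hpos
  by_cases h1 : q₀ = 1
  · exact h1 ▸ hq₀
  have hp := Nat.minFac_prime h1
  obtain ⟨q, hqp, hq⟩ := hcop _ hp
  have hmul : ∀ k, Q (q₀ * k) := by
    intro k
    induction k with
    | zero => simpa using hQ0
    | succ k ih => rw [mul_add, mul_one]; exact hadd _ _ ih hq₀
  have hr : Q (q % q₀) := hsub _ _ (by rwa [Nat.div_add_mod]) (hmul (q / q₀))
  have : q % q₀ = 0 := by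
    by_contra hne
    have := hmin _ ⟨Nat.pos_of_ne_zero hne, hr⟩
    have := Nat.mod_lt q h0
    omega
  exact absurd ((Nat.minFac_dvd q₀).trans (Nat.dvd_of_mod_eq_zero this))
    ((Nat.Prime.coprime_iff_not_dvd hp).1 hqp.symm)

lemma emod_zsmul {n : ℕ} {e : G} (he : n • e = 0) (x : ℤ) : (x % n) • e = x • e := by
  conv_rhs => rw [← Int.emod_add_mul_ediv x n, add_smul, mul_comm, mul_smul, natCast_zsmul, he,
    smul_zero, add_zero]

lemma exists_nat_coeff {n : ℕ} (hn : 0 < n) {E : Finset G} (hE : ∀ e ∈ E, n • e = 0) {x : G}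
    (hx : x ∈ Submodule.span ℤ (E : Set G)) : ∃ a : G → ℕ, x = ∑ e ∈ E, a e • e := by
  obtain ⟨f, -, rfl⟩ := Submodule.mem_span_finset.1 hx
  refine ⟨fun e => (f e % n).toNat, Finset.sum_congr rfl fun e he => ?_⟩
  rw [← emod_zsmul (hE e he), ← natCast_zsmul,
    Int.toNat_of_nonneg (Int.emod_nonneg _ (by omega))]

/-- Every zero-sum sequence over `S` is, in the group of quotients, a combination of atoms with
small support. -/
lemma exists_relation [Finite G] [DecidableEq G] {n s : ℕ} (hn : 0 < n) {S : Finset G}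
    (hS : ∀ g ∈ S, n • g = 0)
    (hs : ∀ p : ℕ, p.Prime → Nat.card {g : G // p • g = 0} ≤ p ^ s) {W : Multiset G → Prop}
    (hW : ∀ A, Atom A → (∀ g ∈ A, g ∈ S) → A.toFinset.card ≤ s + 1 → W A)
    {B : Multiset G} (hB : B.sum = 0) (hBS : ∀ g ∈ B, g ∈ S) :
    ∃ X Y : Multiset (Multiset G), (∀ A ∈ X, W A) ∧ (∀ A ∈ Y, W A) ∧ B + X.sum = Y.sum := by
  set Z : Multiset G → Prop := fun B => ∃ X Y : Multiset (Multiset G),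
    (∀ A ∈ X, W A) ∧ (∀ A ∈ Y, W A) ∧ B + X.sum = Y.sum with hZ
  have hzero : Z 0 := ⟨0, 0, by simp, by simp, by simp⟩
  have hadd : ∀ B C, Z B → Z C → Z (B + C) := by
    rintro B C ⟨X, Y, h1, h2, h3⟩ ⟨X', Y', h1', h2', h3'⟩
    refine ⟨X + X', Y + Y', fun A hA => (Multiset.mem_add.1 hA).elim (h1 A) (h1' A),
      fun A hA => (Multiset.mem_add.1 hA).elim (h2 A) (h2' A), ?_⟩
    rw [Multiset.sum_add, Multiset.sum_add, ← h3, ← h3', add_add_add_comm]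
  have hsub : ∀ B C, Z (B + C) → Z B → Z C := by
    rintro B C ⟨X, Y, h1, h2, h3⟩ ⟨X', Y', h1', h2', h3'⟩
    refine ⟨X + Y', Y + X', fun A hA => (Multiset.mem_add.1 hA).elim (h1 A) (h2' A),
      fun A hA => (Multiset.mem_add.1 hA).elim (h2 A) (h1' A), ?_⟩
    rw [Multiset.sum_add, Multiset.sum_add, ← h3, ← h3']
    ac_rfl
  have hbase : ∀ R : Multiset G, R.sum = 0 → (∀ g ∈ R, g ∈ S) → R.toFinset.card ≤ s + 1 → Z R := by
    intro R hR hRS hc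
    obtain ⟨F, hF, rfl⟩ := exists_fact hR
    refine ⟨0, F, by simp, fun A hA => hW A (hF A hA)
      (fun g hg => hRS g (Multiset.mem_of_le (le_sum_of_mem hA) hg)) ?_, by simp⟩
    refine (Finset.card_le_card fun g hg => ?_).trans hc
    simp only [Multiset.mem_toFinset] at hg ⊢
    exact Multiset.mem_of_le (le_sum_of_mem hA) hg
  have h1 : Z (1 • B) := by
    refine one_of_coprime_closed (Q := fun q => Z (q • B)) ?_ ?_ ?_
    · intro a b ha hb
      rw [add_smul]; exact hadd _ _ ha hb
    · intro a b ha hb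
      rw [add_smul] at ha; exact hsub _ _ ha hb
    · intro p hp
      obtain ⟨E, hES, hEs, q, hqp, hq⟩ := exists_small_generators hp (hs p hp) S
      have hco : ∀ g ∈ S, ∃ a : G → ℕ, -(q • g) = ∑ e ∈ E, a e • e := fun g hg =>
        exists_nat_coeff hn (fun e he => hS e (hES he)) (neg_mem (hq g hg))
      choose! a ha using hco
      set R : G → Multiset G := fun g => ∑ e ∈ E, Multiset.replicate (a g e) e with hR
      have hRE : ∀ g, ∀ x ∈ R g, x ∈ E := by
        intro g x hx
        obtain ⟨e, he, hxe⟩ := Multiset.mem_sum.1 hx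
        rwa [Multiset.eq_of_mem_replicate hxe]
      have hRsum : ∀ g ∈ S, (R g).sum = -(q • g) := by
        intro g hg
        rw [ha g hg, hR]
        change Multiset.sumAddMonoidHom _ = _
        rw [map_sum]
        simp
      refine ⟨q, hqp, ?_⟩
      have key : ∀ C : Multiset G, (∀ g ∈ C, g ∈ S) →
          Z (q • C + (C.map R).sum) ∧ (C.map R).sum.sum = -(q • C.sum) := by
        intro C
        induction C using Multiset.induction_on with
        | empty => intro _; simpa using hzero
        | cons g C ih =>
          intro hC
          obtain ⟨i1, i2⟩ := ih fun x hx => hC x (by simp [hx])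
          have hg := hC g (by simp)
          constructor
          · have e : q • (g ::ₘ C) + ((g ::ₘ C).map R).sum =
                (Multiset.replicate q g + R g) + (q • C + (C.map R).sum) := by
              rw [Multiset.map_cons, Multiset.sum_cons, ← Multiset.singleton_add, smul_add,
                Multiset.nsmul_singleton]
              ac_rfl
            rw [e]
            refine hadd _ _ (hbase _ ?_ ?_ ?_) i1
            · rw [Multiset.sum_add, hRsum g hg]; simp
            · intro x hx
              rcases Multiset.mem_add.1 hx with h | h
              · rwa [Multiset.eq_of_mem_replicate h]
              · exact hES (hRE g x h)
            · refine (Finset.card_le_card (t := insert g E) fun x hx => ?_).trans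
                ((Finset.card_insert_le _ _).trans (by omega))
              rw [Multiset.mem_toFinset] at hx
              rcases Multiset.mem_add.1 hx with h | h
              · rw [Multiset.eq_of_mem_replicate h]; exact Finset.mem_insert_self _ _
              · exact Finset.mem_insert_of_mem (hRE g x h)
          · rw [Multiset.map_cons, Multiset.sum_cons, Multiset.sum_add, i2, hRsum g hg,
              Multiset.sum_cons, smul_add, neg_add]
      obtain ⟨k1, k2⟩ := key B hBS
      refine hsub (B.map R).sum _ (by rwa [add_comm]) (hbase _ ?_ ?_ ?_)
      · rw [k2, hB]; simp
      · intro x hx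
        obtain ⟨A, hA, hxA⟩ := mem_msum.1 hx
        obtain ⟨g, _, rfl⟩ := Multiset.mem_map.1 hA
        exact hES (hRE g x hxA)
      · refine (Finset.card_le_card (t := E) fun x hx => ?_).trans (by omega)
        rw [Multiset.mem_toFinset] at hx
        obtain ⟨A, hA, hxA⟩ := mem_msum.1 hx
        obtain ⟨g, _, rfl⟩ := Multiset.mem_map.1 hA
        exact hRE g x hxA
  rwa [one_smul] at h1

/-- Distances of uniform sets all of whose atoms have weight at least `n`. -/
theorem Uniform.lcn [Finite G] {n d s : ℕ} (hn : 0 < n) {G₀ : Set G} (h : Uniform d G₀)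
    (hG : ∀ g ∈ G₀, n • g = 0)
    (hs : ∀ p : ℕ, p.Prime → Nat.card {g : G // p • g = 0} ≤ p ^ s)
    (hge : ∀ A, Atom A → (∀ g ∈ A, g ∈ G₀) → n ≤ wt (ordWt n) A)
    (hex : ∃ A, Atom A ∧ (∀ g ∈ A, g ∈ G₀) ∧ n < wt (ordWt n) A) :
    d + 1 ≤ s ∨ (2 * d + 3 ≤ n + s ∧
      ∃ A, Atom A ∧ (∀ g ∈ A, g ∈ G₀) ∧ (d + 1) * n ≤ wt (ordWt n) A) := by
  classical
  obtain ⟨A₀, ⟨hA₀, hA₀G, hA₀w⟩, hmin⟩ := exists_min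
    (P := fun A => Atom A ∧ (∀ g ∈ A, g ∈ G₀) ∧ n < wt (ordWt n) A)
    (fun A => A.toFinset.card) hex
  set S := A₀.toFinset with hSdef
  have hSG : ∀ g ∈ S, g ∈ G₀ := fun g hg => hA₀G g (by simpa [hSdef] using hg)
  have full : ∀ U, Atom U → (∀ g ∈ U, g ∈ S) → n < wt (ordWt n) U → U.toFinset = S := by
    intro U hU hUS hw
    have := hmin U ⟨hU, fun g hg => hSG g (hUS g hg), hw⟩
    exact Finset.eq_of_subset_of_card_le (fun g hg => hUS g (by simpa using hg)) this
  have hgeS : ∀ U, Atom U → (∀ g ∈ U, g ∈ S) → n ≤ wt (ordWt n) U := fun U hU hUS =>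
    hge U hU fun g hg => hSG g (hUS g hg)
  rcases le_or_gt S.card (s + 1) with hm | hm
  · left
    cases nonempty_fintype G
    obtain ⟨A₁, ⟨hA₁, hA₁S⟩, hmax₁⟩ := exists_max_of_le
      (P := fun A => Atom A ∧ (∀ g ∈ A, g ∈ S)) (fun A => wt (ordWt n) A) (Fintype.card G * n)
      ⟨A₀, hA₀, fun g hg => by simpa [hSdef] using hg⟩ (fun A ⟨hA, hAS⟩ =>
        (wt_le_card _ fun g _ => Nat.div_le_self _ _).trans (Nat.mul_le_mul_right _ hA.card_le))
    obtain ⟨A, ⟨hA, hAS, hAw⟩, hmax₂⟩ := exists_max_of_le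
      (P := fun A => Atom A ∧ (∀ g ∈ A, g ∈ S) ∧ wt (ordWt n) A = wt (ordWt n) A₁)
      (fun A => wt (fun g => A.count g) A) (Fintype.card G * Fintype.card G)
      ⟨A₁, hA₁, hA₁S, rfl⟩ (fun A ⟨hA, hAS, _⟩ =>
        (wt_le_card _ fun g _ => (Multiset.count_le_card g A).trans hA.card_le).trans
          (Nat.mul_le_mul_right _ hA.card_le))
    have hmaxw : ∀ U, Atom U → (∀ g ∈ U, g ∈ S) → wt (ordWt n) U ≤ wt (ordWt n) A :=
      fun U hU hUS => hAw ▸ hmax₁ U ⟨hU, hUS⟩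
    have hAn : n < wt (ordWt n) A :=
      hA₀w.trans_le (hmaxw A₀ hA₀ fun g hg => by simpa [hSdef] using hg)
    have hAG : ∀ g ∈ A, g ∈ G₀ := fun g hg => hSG g (hAS g hg)
    obtain ⟨j, F, hj2, -, hFs, hF, hF2, hFc, -⟩ := exists_min_power hA (by
      obtain ⟨g, hg⟩ := Multiset.exists_mem_of_ne_zero hA.ne_zero
      refine ⟨Multiset.replicate (addOrderOf g) g, atom_replicate g (addOrderOf_pos g), ?_, ?_⟩
      · intro he
        have := wt_replicate_addOrderOf (hG g (hAG g hg))
        rw [he] at this; omega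
      · intro x hx
        rwa [Multiset.eq_of_mem_replicate hx])
    have hmod := h.card_modEq hA hAG (fun V hV => (hF V hV).1) hFs
    have hVS : ∀ V ∈ F, ∀ g ∈ V, g ∈ S := fun V hV g hg => hAS g ((hF V hV).2.2 g hg)
    have htj : j ≤ F.card := by
      have h1 := wt_le_card_mul (ordWt n) (F := F) (β := wt (ordWt n) A) fun V hV =>
        hmaxw V (hF V hV).1 (hVS V hV)
      rw [hFs, map_nsmul, smul_eq_mul] at h1
      exact Nat.le_of_mul_le_mul_right h1 (by omega)
    have htne : F.card ≠ j := by
      intro htj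
      refine card_ne_of_sum_eq_nsmul hFs (by omega) (fun V hV => ⟨(hF V hV).2.1, ?_⟩) htj
      refine hmax₂ V ⟨(hF V hV).1, hVS V hV, ?_⟩
      rw [← hAw]
      refine le_antisymm (hmaxw V (hF V hV).1 (hVS V hV)) ?_
      obtain ⟨F', rfl⟩ := Multiset.exists_cons_of_mem hV
      have h1 := wt_le_card_mul (ordWt n) (F := F') (β := wt (ordWt n) A) fun W hW =>
        hmaxw W (hF W (by simp [hW])).1 (hVS W (by simp [hW]))
      have h2 := congrArg (wt (ordWt n)) hFs
      rw [map_nsmul, smul_eq_mul, Multiset.sum_cons, map_add, ← htj, Multiset.card_cons,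
        add_mul] at h2
      omega
    have := Nat.le_of_dvd (by omega) ((Nat.modEq_iff_dvd' htj).1 hmod.symm)
    have hAc : A.toFinset.card ≤ S.card :=
      Finset.card_le_card fun g hg => hAS g (by simpa using hg)
    omega
  · right
    set W : Multiset G → Prop := fun A => Atom A ∧ (∀ g ∈ A, g ∈ S) ∧ A.toFinset.card ≤ s + 1
      with hW
    have hWw : ∀ A, W A → wt (ordWt n) A = n := by
      rintro A ⟨hA, hAS, hAc⟩
      refine le_antisymm (not_lt.1 fun hlt => ?_) (hgeS A hA hAS)
      rw [full A hA hAS hlt] at hAc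
      omega
    have hWsum : ∀ X : Multiset (Multiset G), (∀ A ∈ X, W A) →
        wt (ordWt n) X.sum = X.card * n := fun X hX =>
      le_antisymm (wt_le_card_mul _ fun A hA => (hWw A (hX A hA)).le)
        (card_mul_le_wt _ fun A hA => (hWw A (hX A hA)).ge)
    have hbig : ∀ U, Atom U → (∀ g ∈ U, g ∈ S) → n < wt (ordWt n) U →
        (d + 1) * n ≤ wt (ordWt n) U := by
      intro U hU hUS hw
      obtain ⟨X, Y, hX, hY, hXY⟩ := exists_relation (W := W) hn (fun g hg => hG g (hSG g hg)) hs
        (fun A h1 h2 h3 => ⟨h1, h2, h3⟩) hU.sum_eq hUS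
      have h1 := congrArg (wt (ordWt n)) hXY
      rw [map_add, hWsum X hX, hWsum Y hY] at h1
      have h2 := h (U ::ₘ X) Y
        (fun V hV => (Multiset.mem_cons.1 hV).elim (fun e => e ▸ hU) fun hV => (hX V hV).1)
        (fun V hV => (hY V hV).1) (by rw [Multiset.sum_cons, hXY]) (fun g hg => by
          rw [Multiset.sum_cons, hXY] at hg
          obtain ⟨A, hA, hgA⟩ := mem_msum.1 hg
          exact hSG g ((hY A hA).2.1 g hgA))
      rw [Multiset.card_cons] at h2
      have h3 : X.card + 1 < Y.card := by
        by_contra hc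
        have : Y.card ≤ X.card + 1 := by omega
        nlinarith
      have := Nat.le_of_dvd (by omega) ((Nat.modEq_iff_dvd' h3.le).1 h2)
      have : (d + 1 + X.card) * n ≤ Y.card * n := Nat.mul_le_mul_right _ (by omega)
      nlinarith
    refine ⟨?_, A₀, hA₀, hA₀G, hbig A₀ hA₀ (fun g hg => by simpa [hSdef] using hg) hA₀w⟩
    set NF : Multiset G → Prop := fun B => ∃ F : Multiset (Multiset G),
      (∀ A ∈ F, Atom A ∧ (∀ g ∈ A, g ∈ S) ∧ wt (ordWt n) A = n) ∧ F.sum = B with hNF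
    have hA₀NF : ¬ NF A₀ := by
      rintro ⟨F, hF, hFs⟩
      obtain ⟨V, hV⟩ : ∃ V, V ∈ F := by
        refine Multiset.exists_mem_of_ne_zero ?_
        rintro rfl
        exact hA₀.ne_zero (by simpa using hFs.symm)
      have := hA₀.eq_of_le_atom (hFs ▸ le_sum_of_mem hV) (hF V hV).1
      have h2 := (hF V hV).2.2
      rw [this] at h2; omega
    have hpair : ∃ VW : Multiset G × Multiset G, VW.1.sum = 0 ∧ (∀ g ∈ VW.1, g ∈ S) ∧
        ¬ NF VW.1 ∧ W VW.2 ∧ NF (VW.1 + VW.2) := by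
      obtain ⟨X, Y, hX, hY, hXY⟩ := exists_relation (W := W) hn (fun g hg => hG g (hSG g hg)) hs
        (fun A h1 h2 h3 => ⟨h1, h2, h3⟩) hA₀.sum_eq (fun g hg => by simpa [hSdef] using hg)
      have hYNF : NF (A₀ + X.sum) :=
        ⟨Y, fun A hA => ⟨(hY A hA).1, (hY A hA).2.1, hWw A (hY A hA)⟩, hXY.symm⟩
      clear hXY
      induction X using Multiset.induction_on with
      | empty => exact absurd (by simpa using hYNF) hA₀NF
      | cons A X ih =>
        by_cases hc : NF (A₀ + X.sum)
        · exact ih (fun B hB => hX B (by simp [hB])) hc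
        · refine ⟨(A₀ + X.sum, A), ?_, ?_, hc, hX A (by simp), ?_⟩
          · rw [Multiset.sum_add, hA₀.sum_eq,
              sum_sum_eq_zero fun B hB => Atom.sum_eq (hX B (by simp [hB])).1, add_zero]
          · intro g hg
            rcases Multiset.mem_add.1 hg with hg | hg
            · simpa [hSdef] using hg
            · obtain ⟨B, hB, hgB⟩ := mem_msum.1 hg
              exact (hX B (by simp [hB])).2.1 g hgB
          · rw [Multiset.sum_cons] at hYNF
            convert hYNF using 1
            change A₀ + X.sum + A = A₀ + (A + X.sum)
            ac_rfl
    obtain ⟨⟨V, A⟩, ⟨hV0, hVS, hVNF, hA, F, hF, hFs⟩, hVmin⟩ := exists_min (fun VW => VW.1.card) hpair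
    simp only at hV0 hVS hVNF hA hFs hVmin
    have hnle : ∀ X ∈ F, ¬ X ≤ V := by
      intro X hX hXV
      obtain ⟨V', rfl⟩ := Multiset.le_iff_exists_add.1 hXV
      obtain ⟨F', rfl⟩ := Multiset.exists_cons_of_mem hX
      have hXat := (hF X hX).1
      rw [Multiset.sum_cons, add_assoc, add_right_inj] at hFs
      rw [Multiset.sum_add, hXat.sum_eq, zero_add] at hV0
      have := hVmin (V', A) ⟨hV0, fun g hg => hVS g (Multiset.mem_add.2 (Or.inr hg)), ?_, hA,
        F', fun B hB => hF B (by simp [hB]), hFs⟩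
      · have h1 := Multiset.card_pos.2 hXat.ne_zero
        simp only [Multiset.card_add] at this
        omega
      · rintro ⟨E, hE, rfl⟩
        exact hVNF ⟨X ::ₘ E, fun B hB => (Multiset.mem_cons.1 hB).elim (fun e => e ▸ hF X hX) (hE B),
          by rw [Multiset.sum_cons]⟩
    obtain ⟨U, hUV, hU, hUw⟩ : ∃ U ≤ V, Atom U ∧ n < wt (ordWt n) U := by
      obtain ⟨E, hE, rfl⟩ := exists_fact hV0
      by_contra! hc
      refine hVNF ⟨E, fun B hB => ?_, rfl⟩
      have hBS : ∀ g ∈ B, g ∈ S := fun g hg => hVS g (Multiset.mem_of_le (le_sum_of_mem hB) hg)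
      exact ⟨hE B hB, hBS, le_antisymm (hc B (le_sum_of_mem hB) (hE B hB)) (hgeS B (hE B hB) hBS)⟩
    have hUS : ∀ g ∈ U, g ∈ S := fun g hg => hVS g (Multiset.mem_of_le hUV hg)
    have hUfull := full U hU hUS hUw
    have hVpos : ∀ g ∈ S, 1 ≤ V.count g := fun g hg => by
      rw [← hUfull, Multiset.mem_toFinset] at hg
      exact Multiset.one_le_count_iff_mem.2 (Multiset.mem_of_le hUV hg)
    have ht : d + 2 ≤ F.card := by
      have h1 := hbig U hU hUS hUw
      have h2 := wt_mono (ordWt n) hUV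
      have h3 := wt_le_card_mul (ordWt n) (F := F) (β := n) fun X hX => (hF X hX).2.2.le
      rw [hFs, map_add, hWw A hA] at h3
      refine Nat.le_of_mul_le_mul_right (c := n) ?_ hn
      nlinarith
    have hch : ∀ X ∈ F, ∃ g, V.count g < X.count g := fun X hX => by
      have := hnle X hX
      rw [← one_smul ℕ V] at this
      simpa using not_le_nsmul this
    choose! f hf using hch
    have hXle : ∀ X ∈ F, ∀ g, X.count g ≤ V.count g + A.count g := fun X hX g => by
      have := Multiset.count_le_of_le g (le_sum_of_mem hX)
      rwa [hFs, Multiset.count_add] at this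
    have hcard := card_eq_sum_count_map (F := F) f (S := A.toFinset) fun X hX => by
      have h1 := hf X hX
      have h2 := hXle X hX (f X)
      rw [Multiset.mem_toFinset, ← Multiset.count_pos]
      omega
    have hterm : ∀ g ∈ A.toFinset, 2 * (F.map f).count g ≤ A.count g + 1 := by
      intro g hg
      have h1 := count_map_mul_le (F := F) f g (V.count g + 1) fun X hX h => by
        have := hf X hX; rw [h] at this; omega
      rw [hFs, Multiset.count_add] at h1
      have h2 := hVpos g (hA.2.1 g (by simpa using hg))
      have h3 : 1 ≤ A.count g := Multiset.one_le_count_iff_mem.2 (by simpa using hg)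
      generalize (F.map f).count g = c at *
      by_contra hc
      rcases Nat.lt_or_ge c 1 with h4 | h4
      · omega
      · obtain ⟨i, rfl⟩ : ∃ i, c = i + 1 := ⟨c - 1, by omega⟩
        nlinarith
    have hsum : ∑ g ∈ A.toFinset, 2 * (F.map f).count g ≤ ∑ g ∈ A.toFinset, (A.count g + 1) :=
      Finset.sum_le_sum hterm
    rw [← Finset.mul_sum, ← hcard, Finset.sum_add_distrib, Multiset.toFinset_sum_count_eq] at hsum
    have hAcard : A.card ≤ n := by
      have := card_le_wt (ordWt n) (A := A) fun g hg => ordWt_pos hn (hG g (hSG g (hA.2.1 g hg)))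
      rwa [hWw A hA] at this
    have := hA.2.2
    simp only [Finset.sum_const, smul_eq_mul, mul_one] at hsum
    omega

/-- `G` contains a subgroup isomorphic to `Cₙᵏ`. -/
def Embeds (n k : ℕ) (G : Type*) [AddCommGroup G] : Prop :=
  ∃ f : (Fin k → ZMod n) →+ G, Function.Injective f

lemma exists_hom_pi {n k : ℕ} [NeZero n] (g : Fin k → G) (hg : ∀ i, n • g i = 0) :
    ∃ f : (Fin k → ZMod n) →+ G, ∀ x, f x = ∑ i, (x i).val • g i := by
  let F : Fin k → ZMod n →+ G := fun i =>
    ZMod.lift n ⟨zmultiplesHom G (g i), by simpa using hg i⟩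
  have hF : ∀ i (x : ZMod n), F i x = x.val • g i := by
    intro i x
    have := ZMod.lift_coe n ⟨zmultiplesHom G (g i), by simpa using hg i⟩ (x.val : ℤ)
    rw [Int.cast_natCast, ZMod.natCast_zmod_val] at this
    rw [this]
    simp only [zmultiplesHom_apply, natCast_zsmul]
  exact ⟨∑ i, (F i).comp (Pi.evalAddMonoidHom _ i), fun x => by
    simp [AddMonoidHom.finsetSum_apply, hF]⟩

lemma embeds_of_indep {n k : ℕ} [NeZero n] (g : Fin k → G) (hg : ∀ i, n • g i = 0)
    (h : ∀ c : Fin k → ℕ, (∀ i, c i < n) → ∑ i, c i • g i = 0 → ∀ i, c i = 0) :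
    Embeds n k G := by
  obtain ⟨f, hf⟩ := exists_hom_pi g hg
  refine ⟨f, (injective_iff_map_eq_zero f).2 fun x hx => ?_⟩
  have := h (fun i => (x i).val) (fun i => ZMod.val_lt _) (by rwa [hf] at hx)
  ext i
  simpa using this i

lemma Embeds.mono {n k l : ℕ} (hkl : k ≤ l) (h : Embeds n l G) : Embeds n k G := by
  obtain ⟨f, hf⟩ := h
  let e : (Fin k → ZMod n) →+ (Fin l → ZMod n) :=
    { toFun := fun x i => if h : i.1 < k then x ⟨i, h⟩ else 0
      map_zero' := by ext i; simp
      map_add' := fun x y => by ext i; by_cases h : i.1 < k <;> simp [h] }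
  refine ⟨f.comp e, hf.comp fun x y hxy => ?_⟩
  ext i
  have := congrFun hxy (Fin.castLE hkl i)
  simpa [e] using this

lemma embeds_of_module {p k : ℕ} [Fact p.Prime] {K : Type*} [AddCommGroup K] [Finite K]
    [Module (ZMod p) K] (h : p ^ k < Nat.card K) : Embeds p (k + 1) K := by
  rw [Module.natCard_eq_pow_finrank (K := ZMod p), Nat.card_zmod] at h
  have hk : k + 1 ≤ Module.finrank (ZMod p) K :=
    (Nat.pow_lt_pow_iff_right (Fact.out : p.Prime).one_lt).1 h
  have hli : LinearIndependent (ZMod p) (Module.finBasis (ZMod p) K ∘ Fin.castLE hk) :=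
    (Module.finBasis (ZMod p) K).linearIndependent.comp _ (Fin.castLE_injective hk)
  rw [linearIndependent_iff_injective_fintypeLinearCombination] at hli
  exact ⟨(Fintype.linearCombination (ZMod p) _).toAddMonoidHom, hli⟩

lemma embeds_of_lt_card [Finite G] {p k : ℕ} (hp : p.Prime)
    (h : ¬ Nat.card {g : G // p • g = 0} ≤ p ^ k) : Embeds p (k + 1) G := by
  have := Fact.mk hp
  let K : AddSubgroup G := (nsmulAddMonoidHom p : G →+ G).ker
  have hK : ∀ x : K, p • x = 0 := fun x => Subtype.ext (by
    have := (AddMonoidHom.mem_ker (f := (nsmulAddMonoidHom p : G →+ G))).1 x.2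
    rw [nsmulAddMonoidHom_apply] at this
    rw [AddSubgroup.coe_nsmul, this, AddSubgroup.coe_zero])
  let : Module (ZMod p) K := AddCommGroup.zmodModule hK
  have hc : Nat.card {g : G // p • g = 0} = Nat.card K := Nat.card_congr
    (Equiv.subtypeEquivRight fun x => by simp [K, AddMonoidHom.mem_ker])
  rw [hc, not_le] at h
  obtain ⟨f, hf⟩ := embeds_of_module h
  exact ⟨K.subtype.comp f, Subtype.val_injective.comp hf⟩

lemma Uniform.embeds [Finite G] {n d : ℕ} {G₀ : Set G} (h : Uniform d G₀) (hn : 0 < n)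
    (hG : ∀ g ∈ G₀, n • g = 0) (h2d : n < 2 * d + 2) {A₀ : Multiset G} (hA₀ : Atom A₀)
    (hA₀' : ∀ g ∈ A₀, g ∈ G₀) (hlt : wt (ordWt n) A₀ < n) : Embeds n (n - d - 1) G := by
  classical
  have : NeZero n := ⟨hn.ne'⟩
  obtain ⟨A, hA, hAG, hnd, hc, hord, hat⟩ := h.exists_basis_atom hG h2d hA₀ hA₀' hlt
  obtain ⟨g₀, hg₀⟩ := Multiset.exists_mem_of_ne_zero hA.ne_zero
  obtain ⟨A', rfl⟩ := Multiset.exists_cons_of_mem hg₀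
  rw [Multiset.nodup_cons] at hnd
  rw [Multiset.card_cons] at hc
  have hl : A'.toFinset.card = n - d - 1 := by
    rw [Multiset.toFinset_card_of_nodup hnd.2]; omega
  let e := (A'.toFinset.equivFinOfCardEq hl).symm
  have heA : ∀ i, (e i : G) ∈ A' := fun i => Multiset.mem_toFinset.1 (e i).2
  have heinj : ∀ i j, (e i : G) = e j ↔ i = j := fun i j => by simp
  refine embeds_of_indep (fun i => (e i : G)) (fun i => hG _ (hAG _ (by simp [heA]))) ?_
  intro c hcn hsum i
  by_contra hci
  let B : Multiset G := ∑ i, Multiset.replicate (c i) (e i : G)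
  have hB : B.sum = 0 := by
    rw [← hsum]
    have := map_sum (Multiset.sumAddMonoidHom (M := G))
      (fun i => Multiset.replicate (c i) (e i : G)) Finset.univ
    refine this.trans (Finset.sum_congr rfl fun i _ => ?_)
    simp
  have hcount : ∀ j, B.count (e j : G) = c j := by
    intro j
    simp [B, Multiset.count_sum', Multiset.count_replicate, heinj]
  have hmem : ∀ x ∈ B, ∃ j, x = e j := by
    intro x hx
    obtain ⟨j, -, hj⟩ := Multiset.mem_sum.1 hx
    exact ⟨j, Multiset.eq_of_mem_replicate hj⟩
  have hB0 : B ≠ 0 := by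
    intro h0
    have := hcount i
    rw [h0] at this
    simp at this
    omega
  obtain ⟨U, hUB, hU⟩ := exists_atom_le hB hB0
  rcases hat U hU (fun g hg => by
    obtain ⟨j, rfl⟩ := hmem g (Multiset.mem_of_le hUB hg)
    simp [heA]) with rfl | ⟨g, hg, rfl⟩
  · obtain ⟨j, hj⟩ := hmem g₀ (Multiset.mem_of_le hUB (by simp))
    exact hnd.1 (hj ▸ heA j)
  · obtain ⟨j, rfl⟩ := hmem g (Multiset.mem_of_le hUB (Multiset.mem_replicate.2 ⟨hn.ne', rfl⟩))
    have := Multiset.count_le_of_le (e j : G) hUB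
    rw [hcount, Multiset.count_replicate_self] at this
    exact absurd (hcn j) (by omega)

lemma QProp.cases [Finite G] {n d a b s : ℕ} (hn : 0 < n) (hG : ∀ g : G, n • g = 0) (hab : a < b)
    (hQ : QProp G d a b) (hs : ∀ p : ℕ, p.Prime → Nat.card {g : G // p • g = 0} ≤ p ^ s) :
    (d + 2 ≤ n ∧ (n < 2 * d + 2 → Embeds n (n - d - 1) G)) ∨ d + 1 ≤ s ∨
      (2 * d + 3 ≤ n + s ∧ ∃ A : Multiset G, Atom A ∧ (d + 1) * n ≤ wt (ordWt n) A) := by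
  obtain ⟨G₀, hU, hw⟩ := hQ.exists_uniform
  by_cases hlt : ∃ A, Atom A ∧ (∀ g ∈ A, g ∈ G₀) ∧ wt (ordWt n) A < n
  · obtain ⟨A, hA, hA', hl⟩ := hlt
    left
    have h2 := two_le_wt hn hA (fun g _ => hG g) hl
    have h1 := hU.add_two_le hn (fun g _ => hG g) hA hA' hl
    exact ⟨by omega, fun h2d => hU.embeds hn (fun g _ => hG g) h2d hA hA' hl⟩
  · push Not at hlt
    right
    have hex : ∃ A, Atom A ∧ (∀ g ∈ A, g ∈ G₀) ∧ n < wt (ordWt n) A := by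
      by_contra hc
      push Not at hc
      have := hw (ordWt n) n n fun A hA hA' => ⟨hlt A hA hA', hc A hA hA'⟩
      have := Nat.le_of_mul_le_mul_right this hn
      omega
    rcases hU.lcn hn (fun g _ => hG g) hs hlt hex with h | ⟨h, A, hA, -, hA'⟩
    · exact Or.inl h
    · exact Or.inr ⟨h, A, hA, hA'⟩

lemma Atom.of_map {H : Type*} [AddCommGroup H] {f : H →+ G} (hf : Function.Injective f)
    {A : Multiset H} (h : Atom (A.map f)) : Atom A := by
  rw [atom_iff]
  refine ⟨hf ?_, fun h0 => h.ne_zero (by simp [h0]), fun B hB h0 hs => ?_⟩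
  · rw [map_multiset_sum, map_zero, h.sum_eq]
  · refine Multiset.eq_of_le_of_card_le hB ?_
    have := h.eq_of_le (Multiset.map_le_map hB) (by simpa using h0)
      (by rw [← map_multiset_sum, hs, map_zero])
    simpa using (congrArg Multiset.card this).ge

lemma Uniform.image {H : Type*} [AddCommGroup H] {f : H →+ G} (hf : Function.Injective f) {d : ℕ}
    {G₁ : Set H} (h : Uniform d G₁) : Uniform d (f '' G₁) := by
  have hg : ∀ g ∈ f '' G₁, f (Function.invFun f g) = g := by
    rintro _ ⟨x, -, rfl⟩
    rw [Function.leftInverse_invFun hf x]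
  have hg' : ∀ g ∈ f '' G₁, Function.invFun f g ∈ G₁ := by
    rintro _ ⟨x, hx, rfl⟩
    rwa [Function.leftInverse_invFun hf x]
  have key : ∀ F : Multiset (Multiset G), (∀ A ∈ F, Atom A) → (∀ g ∈ F.sum, g ∈ f '' G₁) →
      ∀ A ∈ F.map (Multiset.map (Function.invFun f)), Atom A := by
    intro F hF hFG A hA
    obtain ⟨B, hB, rfl⟩ := Multiset.mem_map.1 hA
    refine Atom.of_map hf ?_
    rw [Multiset.map_map]
    have := Multiset.map_congr rfl fun x hx => hg x (hFG x (mem_msum.2 ⟨B, hB, hx⟩))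
    rw [Multiset.map_id'] at this
    exact (congrArg Atom this).mpr (hF B hB)
  have hsum : ∀ F : Multiset (Multiset G), (F.map (Multiset.map (Function.invFun f))).sum =
      F.sum.map (Function.invFun f) := fun F =>
    (map_multiset_sum (Multiset.mapAddMonoidHom (Function.invFun f)) F).symm
  intro F F' hF hF' hs hFG
  have := h _ _ (key F hF hFG) (key F' hF' (hs ▸ hFG)) (by rw [hsum, hsum, hs]) (by
    intro x hx
    rw [hsum] at hx
    obtain ⟨y, hy, rfl⟩ := Multiset.mem_map.1 hx
    exact hg' y (hFG y hy))
  simpa using this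

/-- A uniform set of a subgroup yields lengths of the whole group. -/
lemma Uniform.qProp_of_injective {H : Type*} [AddCommGroup H] {f : H →+ G}
    (hf : Function.Injective f) {d : ℕ} {G₁ : Set H} (h : Uniform d G₁)
    {F F' : Multiset (Multiset H)}
    (hF : ∀ A ∈ F, Atom A) (hF' : ∀ A ∈ F', Atom A) (hs : F.sum = F'.sum)
    (hG : ∀ g ∈ F.sum, g ∈ G₁) : QProp G d F.card F'.card := by
  have hsum : ∀ F : Multiset (Multiset H), (F.map (Multiset.map f)).sum = F.sum.map f := fun F =>
    (map_multiset_sum (Multiset.mapAddMonoidHom f) F).symm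
  have key : ∀ F : Multiset (Multiset H), (∀ A ∈ F, Atom A) →
      ∀ A ∈ F.map (Multiset.map f), Atom A := by
    intro F hF A hA
    obtain ⟨B, hB, rfl⟩ := Multiset.mem_map.1 hA
    exact atom_map hf (hF B hB)
  have := (h.image hf).qProp (key F hF) (key F' hF') (by rw [hsum, hsum, hs]) (by
    intro x hx
    rw [hsum] at hx
    obtain ⟨y, hy, rfl⟩ := Multiset.mem_map.1 hx
    exact ⟨y, hG y hy, rfl⟩)
  simpa using this

section Basis

variable {n k : ℕ}

/-- The standard basis vectors of `Cₙᵏ` together with a constant vector. -/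
def stdSet (n k : ℕ) (c : ZMod n) : Set (Fin k → ZMod n) :=
  {g | g = (fun _ => c) ∨ ∃ i, g = Pi.single i 1}

lemma sum_coord {c : ZMod n} (hc : ∀ i : Fin k, (fun _ => c) ≠ (Pi.single i 1 : Fin k → ZMod n))
    [Fact (1 < n)] {A : Multiset (Fin k → ZMod n)} (hA : ∀ g ∈ A, g ∈ stdSet n k c) (i : Fin k) :
    A.sum i = A.count (Pi.single i 1) + A.count (fun _ => c) * c := by
  induction A using Multiset.induction_on with
  | empty => simp
  | cons g A ih =>
    rw [Multiset.sum_cons, Pi.add_apply, ih fun x hx => hA x (by simp [hx]),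
      Multiset.count_cons, Multiset.count_cons]
    rcases hA g (by simp) with rfl | ⟨j, rfl⟩
    · rw [if_neg (hc i).symm, if_pos rfl]
      push_cast
      ring
    · rw [if_neg (hc j)]
      by_cases hij : i = j
      · subst hij
        simp
        ring
      · rw [if_neg, Pi.single_eq_of_ne hij]
        · simp
        · intro h
          have := congrFun h i
          rw [Pi.single_eq_same, Pi.single_eq_of_ne hij] at this
          exact one_ne_zero this

lemma wt_coord {c : ZMod n} (hc : ∀ i : Fin k, (fun _ => c) ≠ (Pi.single i 1 : Fin k → ZMod n))
    [Fact (1 < n)] {A : Multiset (Fin k → ZMod n)} (hA : ∀ g ∈ A, g ∈ stdSet n k c) (m : ℕ) :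
    wt (fun g => if g = fun _ => c then m else 1) A =
      ∑ i, A.count (Pi.single i 1) + A.count (fun _ => c) * m := by
  induction A using Multiset.induction_on with
  | empty => simp
  | cons g A ih =>
    rw [wt_cons, ih fun x hx => hA x (by simp [hx])]
    simp only [Multiset.count_cons, Finset.sum_add_distrib]
    rcases hA g (by simp) with rfl | ⟨j, rfl⟩
    · simp [(hc _).symm]
      ring
    · have : ∀ i, (Pi.single i 1 : Fin k → ZMod n) = Pi.single j 1 ↔ i = j := by
        intro i
        refine ⟨fun h => ?_, fun h => by rw [h]⟩
        by_contra hij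
        have := congrFun h i
        rw [Pi.single_eq_same, Pi.single_eq_of_ne hij] at this
        exact one_ne_zero this
      simp only [this, if_neg (hc j), if_neg (hc j).symm]
      simp
      ring

lemma addOrderOf_single [Fact (1 < n)] (i : Fin k) :
    addOrderOf (Pi.single i 1 : Fin k → ZMod n) = n := by
  have h := addOrderOf_injective (AddMonoidHom.single (fun _ : Fin k => ZMod n) i)
    (Pi.single_injective (M := fun _ : Fin k => ZMod n) i) 1
  rw [ZMod.addOrderOf_one] at h
  exact h

lemma addOrderOf_const [Fact (1 < n)] (hk : 0 < k) {c : ZMod n} (hc : IsUnit c) :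
    addOrderOf (fun _ : Fin k => c) = n := by
  refine Nat.dvd_antisymm (addOrderOf_dvd_of_nsmul_eq_zero ?_) ?_
  · ext i
    simp
  · have := congrFun (addOrderOf_nsmul_eq_zero (fun _ : Fin k => c)) ⟨0, hk⟩
    rw [Pi.smul_apply, nsmul_eq_mul, Pi.zero_apply, hc.mul_left_eq_zero,
      ZMod.natCast_eq_zero_iff] at this
    exact this

/-- An atom over the standard set is a multiple of a single element, or involves everything
with multiplicities below `n`. -/
lemma stdSet_cases [Fact (1 < n)] {c : ZMod n} (hu : IsUnit c) (hk : 0 < k)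
    (hc : ∀ i : Fin k, (fun _ => c) ≠ (Pi.single i 1 : Fin k → ZMod n))
    {A : Multiset (Fin k → ZMod n)} (hA : Atom A) (hA' : ∀ g ∈ A, g ∈ stdSet n k c) :
    A = Multiset.replicate n (fun _ => c) ∨ (∃ i, A = Multiset.replicate n (Pi.single i 1)) ∨
      (0 < A.count (fun _ => c) ∧ A.count (fun _ => c) < n ∧
        ∀ i, 0 < A.count (Pi.single i 1) ∧ A.count (Pi.single i 1) < n) := by
  have hn : 1 < n := Fact.out
  by_cases h1 : n ≤ A.count (fun _ => c)
  · exact Or.inl (atom_eq_replicate hA (by omega) (addOrderOf_const hk hu)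
      (Multiset.le_count_iff_replicate_le.1 h1))
  by_cases h2 : ∃ i, n ≤ A.count (Pi.single i 1)
  · obtain ⟨i, hi⟩ := h2
    exact Or.inr (Or.inl ⟨i, atom_eq_replicate hA (by omega) (addOrderOf_single i)
      (Multiset.le_count_iff_replicate_le.1 hi)⟩)
  push Not at h1 h2
  have hsum : ∀ i, ((A.count (Pi.single i 1) : ℕ) : ZMod n) + A.count (fun _ => c) * c = 0 := by
    intro i
    rw [← sum_coord hc hA' i, hA.sum_eq, Pi.zero_apply]
  have h0 : 0 < A.count (fun _ => c) := by
    by_contra h0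
    have h0 : A.count (fun _ => c) = 0 := by omega
    have : ∀ i, A.count (Pi.single i 1) = 0 := by
      intro i
      have := hsum i
      rw [h0, Nat.cast_zero, zero_mul, add_zero, ZMod.natCast_eq_zero_iff] at this
      exact Nat.eq_zero_of_dvd_of_lt this (h2 i)
    obtain ⟨g, hg⟩ := Multiset.exists_mem_of_ne_zero hA.ne_zero
    rcases hA' g hg with rfl | ⟨i, rfl⟩
    · exact Multiset.count_ne_zero.2 hg h0
    · exact Multiset.count_ne_zero.2 hg (this i)
  refine Or.inr (Or.inr ⟨h0, h1, fun i => ⟨?_, h2 i⟩⟩)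
  by_contra hi
  have hi : A.count (Pi.single i 1) = 0 := by omega
  have := hsum i
  rw [hi, Nat.cast_zero, zero_add, hu.mul_left_eq_zero, ZMod.natCast_eq_zero_iff] at this
  exact h0.ne' (Nat.eq_zero_of_dvd_of_lt this h1)

/-- The sequence `g₀ e₁^m ⋯ eₖ^m`. -/
def stdSeq (n k : ℕ) (c : ZMod n) (m : ℕ) : Multiset (Fin k → ZMod n) :=
  (fun _ => c) ::ₘ ∑ i, Multiset.replicate m (Pi.single i 1)

lemma mem_stdSeq {c : ZMod n} {m : ℕ} : ∀ g ∈ stdSeq n k c m, g ∈ stdSet n k c := by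
  intro g hg
  rcases Multiset.mem_cons.1 hg with rfl | hg
  · exact Or.inl rfl
  · obtain ⟨i, -, hi⟩ := Multiset.mem_sum.1 hg
    exact Or.inr ⟨i, Multiset.eq_of_mem_replicate hi⟩

lemma count_stdSeq_const {c : ZMod n} {m : ℕ}
    (hc : ∀ i : Fin k, (fun _ => c) ≠ (Pi.single i 1 : Fin k → ZMod n)) :
    (stdSeq n k c m).count (fun _ => c) = 1 := by
  simp [stdSeq, Multiset.count_sum', Multiset.count_replicate, (hc _).symm]

lemma count_stdSeq_single [Fact (1 < n)] {c : ZMod n} {m : ℕ}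
    (hc : ∀ i : Fin k, (fun _ => c) ≠ (Pi.single i 1 : Fin k → ZMod n)) (j : Fin k) :
    (stdSeq n k c m).count (Pi.single j 1) = m := by
  have : ∀ i, (Pi.single i 1 : Fin k → ZMod n) = Pi.single j 1 ↔ i = j := by
    intro i
    refine ⟨fun h => ?_, fun h => by rw [h]⟩
    by_contra hij
    have := congrFun h i
    rw [Pi.single_eq_same, Pi.single_eq_of_ne hij] at this
    exact one_ne_zero this
  simp [stdSeq, Multiset.count_sum', Multiset.count_replicate, (hc j).symm, this]

lemma card_stdSeq {c : ZMod n} {m : ℕ} : (stdSeq n k c m).card = 1 + k * m := by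
  simp [stdSeq, Multiset.card_sum, add_comm]

lemma sum_stdSeq [Fact (1 < n)] {c : ZMod n} {m : ℕ}
    (hc : ∀ i : Fin k, (fun _ => c) ≠ (Pi.single i 1 : Fin k → ZMod n)) (hm : (m : ZMod n) = -c) :
    (stdSeq n k c m).sum = 0 := by
  ext i
  rw [sum_coord hc mem_stdSeq, count_stdSeq_const hc, count_stdSeq_single hc, hm]
  simp

lemma atom_stdSeq [Fact (1 < n)] (hk : 0 < k) {c : ZMod n} (hu : IsUnit c) {m : ℕ} (hmn : m < n)
    (hc : ∀ i : Fin k, (fun _ => c) ≠ (Pi.single i 1 : Fin k → ZMod n)) (hm : (m : ZMod n) = -c) :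
    Atom (stdSeq n k c m) := by
  have hn : 1 < n := Fact.out
  obtain ⟨U, hU, hUa⟩ := exists_atom_le (sum_stdSeq hc hm) (by simp [stdSeq])
  have hle : ∀ g, U.count g ≤ _ := fun g => Multiset.count_le_of_le g hU
  have hUG : ∀ g ∈ U, g ∈ stdSet n k c := fun g hg => mem_stdSeq g (Multiset.mem_of_le hU hg)
  suffices U = stdSeq n k c m from this ▸ hUa
  rcases stdSet_cases hu hk hc hUa hUG with rfl | ⟨i, rfl⟩ | ⟨h1, h2, h3⟩
  · have := hle (fun _ => c)
    rw [count_stdSeq_const hc, Multiset.count_replicate_self] at this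
    omega
  · have := hle (Pi.single i 1)
    rw [count_stdSeq_single hc, Multiset.count_replicate_self] at this
    omega
  · have hct : U.count (fun _ => c) = 1 := by
      have := hle (fun _ => c)
      rw [count_stdSeq_const hc] at this
      omega
    refine Multiset.eq_of_le_of_card_le hU ?_
    rw [card_stdSeq]
    have hw := wt_coord hc hUG 1
    have h4 : wt (fun g => if g = fun _ => c then 1 else 1) U = U.card := by
      simp [wt_apply]
    rw [h4, hct] at hw
    rw [hw]
    have : ∀ i, U.count (Pi.single i 1) = m := by
      intro i
      have := sum_coord hc hUG i
      rw [hUa.sum_eq, hct, Pi.zero_apply, Nat.cast_one, one_mul] at this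
      have h5 : ((U.count (Pi.single i 1) : ℕ) : ZMod n) = m := by
        rw [hm]; exact eq_neg_of_add_eq_zero_left this.symm
      rw [ZMod.natCast_eq_natCast_iff] at h5
      exact h5.eq_of_lt_of_lt (h3 i).2 hmn
    simp [this]
    omega

lemma stdSet_qProp [Fact (1 < n)] (hk : 0 < k) {c : ZMod n} (hu : IsUnit c) {m : ℕ} (hmn : m < n)
    (hc : ∀ i : Fin k, (fun _ => c) ≠ (Pi.single i 1 : Fin k → ZMod n)) (hm : (m : ZMod n) = -c)
    {d : ℕ} (h : Uniform d (stdSet n k c)) {f : (Fin k → ZMod n) →+ G}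
    (hf : Function.Injective f) : QProp G d n (1 + k * m) ∧ QProp G d (1 + k * m) n := by
  have hn : 1 < n := Fact.out
  have hA := atom_stdSeq hk hu hmn hc hm
  let F : Multiset (Multiset (Fin k → ZMod n)) :=
    Multiset.replicate n (fun _ => c) ::ₘ
      ∑ i, Multiset.replicate m (Multiset.replicate n (Pi.single i 1))
  have hFc : F.card = 1 + k * m := by simp [F, Multiset.card_sum, add_comm]
  have hF : ∀ A ∈ F, Atom A := by
    intro A hA
    rcases Multiset.mem_cons.1 hA with rfl | hA
    · have := atom_replicate (fun _ : Fin k => c) (by rw [addOrderOf_const hk hu]; omega)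
      rwa [addOrderOf_const hk hu] at this
    · obtain ⟨i, -, hi⟩ := Multiset.mem_sum.1 hA
      rw [Multiset.eq_of_mem_replicate hi]
      have := atom_replicate (Pi.single i 1 : Fin k → ZMod n)
        (by rw [addOrderOf_single]; omega)
      rwa [addOrderOf_single] at this
  have hFs : F.sum = n • stdSeq n k c m := by
    have := map_sum (Multiset.sumAddMonoidHom (M := Multiset (Fin k → ZMod n)))
      (fun i : Fin k => Multiset.replicate m (Multiset.replicate n (Pi.single i (1 : ZMod n)
        : Fin k → ZMod n))) Finset.univ
    simp only [Multiset.coe_sumAddMonoidHom] at this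
    simp only [F, Multiset.sum_cons, stdSeq, this, Multiset.nsmul_cons, Finset.smul_sum,
      Multiset.nsmul_singleton, Multiset.sum_replicate, Multiset.nsmul_replicate]
    simp [mul_comm]
  have hF' : ∀ A ∈ Multiset.replicate n (stdSeq n k c m), Atom A := fun A h' => by
    rwa [Multiset.eq_of_mem_replicate h']
  have hG : ∀ g ∈ F.sum, g ∈ stdSet n k c := by
    rw [hFs]
    exact over_nsmul mem_stdSeq n
  have hs : F.sum = (Multiset.replicate n (stdSeq n k c m)).sum := by simp [hFs]
  have h1 := h.qProp_of_injective hf hF hF' hs hG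
  have h2 := h.qProp_of_injective hf hF' hF hs.symm (hs ▸ hG)
  rw [hFc, Multiset.card_replicate] at h1 h2
  exact ⟨h2, h1⟩

lemma Embeds.qProp_basis (hk : 1 ≤ k) (hkn : k + 1 < n) (h : Embeds n k G) :
    QProp G (n - k - 1) (k + 1) n := by
  obtain ⟨f, hf⟩ := h
  have : Fact (1 < n) := ⟨by omega⟩
  have hu : IsUnit (-1 : ZMod n) := isUnit_one.neg
  have hc : ∀ i : Fin k, (fun _ => (-1 : ZMod n)) ≠ (Pi.single i 1 : Fin k → ZMod n) := by
    intro i h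
    have := congrFun h i
    rw [Pi.single_eq_same] at this
    have : ((2 : ℕ) : ZMod n) = 0 := by
      push_cast
      linear_combination -this
    rw [ZMod.natCast_eq_zero_iff] at this
    have := Nat.le_of_dvd (by norm_num) this
    omega
  have hm : ((1 : ℕ) : ZMod n) = -(-1) := by simp
  have hU : Uniform (n - k - 1) (stdSet n k (-1)) := by
    refine uniform_of_weight (n := n) (by omega)
      (fun g => if g = fun _ => (-1 : ZMod n) then n - k else 1) fun A hA hA' => ?_
    have hw := wt_coord hc hA' (n - k)
    rcases stdSet_cases hu hk hc hA hA' with rfl | ⟨i, rfl⟩ | ⟨h1, h2, h3⟩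
    · rw [wt_replicate]
      simp only [if_true]
      obtain ⟨t, rfl⟩ : ∃ t, n = k + 1 + t := ⟨n - k - 1, by omega⟩
      have e1 : k + 1 + t - k = t + 1 := by omega
      have e2 : k + 1 + t - k - 1 = t := by omega
      rw [e1]
      simp only [Nat.add_sub_cancel]
      have : (k + 1 + t) * (t + 1) = k + 1 + t + t * (k + 1 + t) := by ring
      rw [this]
      exact Nat.ModEq.symm (by simp [Nat.ModEq])
    · rw [wt_replicate, if_neg (hc i).symm, mul_one]
    · have hle : stdSeq n k (-1) 1 ≤ A := by
        rw [Multiset.le_iff_count]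
        intro g
        by_cases hg : g ∈ stdSeq n k (-1) 1
        · rcases mem_stdSeq g hg with rfl | ⟨i, rfl⟩
          · rw [count_stdSeq_const hc]; exact h1
          · rw [count_stdSeq_single hc]; exact (h3 i).1
        · rw [Multiset.count_eq_zero.2 hg]; exact Nat.zero_le _
      have hA2 := hA.eq_of_le hle (by simp [stdSeq]) (sum_stdSeq hc hm)
      rw [hw, ← hA2, count_stdSeq_const hc]
      simp only [count_stdSeq_single hc]
      simp
      rw [Nat.add_sub_cancel' (by omega)]
  have := (stdSet_qProp hk hu (by omega) hc hm hU hf).2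
  rwa [mul_one, add_comm] at this

lemma const_one_ne (hk : 2 ≤ k) (hn : 1 < n) (i : Fin k) :
    (fun _ => (1 : ZMod n)) ≠ (Pi.single i 1 : Fin k → ZMod n) := by
  have : Fact (1 < n) := ⟨hn⟩
  intro h
  obtain ⟨j, hj⟩ : ∃ j : Fin k, j ≠ i := by
    have : Nontrivial (Fin k) := Fin.nontrivial_iff_two_le.2 hk
    exact exists_ne i
  have := congrFun h j
  rw [Pi.single_eq_of_ne hj] at this
  exact one_ne_zero this

lemma natCast_pred_eq_neg_one (hn : 1 < n) : ((n - 1 : ℕ) : ZMod n) = -1 := by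
  rw [Nat.cast_sub (by omega)]
  simp

lemma Embeds.qProp_full (hk : 2 ≤ k) (hn : 1 < n) (h : Embeds n k G) :
    QProp G (k - 1) n (1 + k * (n - 1)) := by
  obtain ⟨f, hf⟩ := h
  have : Fact (1 < n) := ⟨by omega⟩
  have hc := fun i => const_one_ne hk hn i
  have hm := natCast_pred_eq_neg_one hn
  refine (stdSet_qProp (by omega) isUnit_one (by omega) hc hm ?_ hf).1
  refine uniform_of_weight (n := n) (by omega)
    (fun g => if g = fun _ => (1 : ZMod n) then k else 1) fun A hA hA' => ?_
  have hw := wt_coord hc hA' k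
  have key : k * n ≡ n [MOD (k - 1) * n] := by
    obtain ⟨t, rfl⟩ : ∃ t, k = t + 1 := ⟨k - 1, by omega⟩
    rw [add_mul, one_mul, Nat.add_sub_cancel]
    simp [Nat.ModEq]
  rcases stdSet_cases isUnit_one (by omega) hc hA hA' with rfl | ⟨i, rfl⟩ | ⟨h1, h2, h3⟩
  · rw [wt_replicate]
    simp only [if_true]
    rw [mul_comm n k]
    exact key
  · rw [wt_replicate, if_neg (hc i).symm, mul_one]
  · have : ∀ i, A.count (Pi.single i 1) = n - A.count (fun _ => 1) := by
      intro i
      have := sum_coord hc hA' i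
      rw [hA.sum_eq, mul_one, Pi.zero_apply, ← Nat.cast_add, eq_comm,
        ZMod.natCast_eq_zero_iff] at this
      have h4 := (h3 i).2
      have h5 := (h3 i).1
      obtain ⟨q, hq⟩ := this
      have hq1 : 0 < q := by
        rcases Nat.eq_zero_or_pos q with rfl | h
        · omega
        · exact h
      have hq2 : q < 2 := by
        by_contra hq2
        have : n * 2 ≤ n * q := Nat.mul_le_mul_left n (by omega)
        omega
      have : q = 1 := by omega
      rw [this] at hq
      omega
    rw [hw]
    simp only [this]
    simp only [Finset.sum_const, Finset.card_univ, Fintype.card_fin, smul_eq_mul]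
    rw [mul_comm (A.count _) k, ← mul_add, Nat.sub_add_cancel h2.le]
    exact key

lemma Embeds.exists_atom (hk : 1 ≤ k) (hn : 1 < n) (h : Embeds n k G) :
    ∃ A : Multiset G, Atom A ∧ A.card = 1 + k * (n - 1) := by
  obtain ⟨f, hf⟩ := h
  have : Fact (1 < n) := ⟨by omega⟩
  rcases Nat.lt_or_ge 1 k with hk2 | hk2
  · exact ⟨_, atom_map hf (atom_stdSeq (by omega) isUnit_one (by omega)
      (fun i => const_one_ne hk2 hn i) (natCast_pred_eq_neg_one hn)),
      by rw [Multiset.card_map, card_stdSeq]⟩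
  · have h := atom_replicate (Pi.single ⟨0, hk⟩ 1 : Fin k → ZMod n)
      (by rw [addOrderOf_single]; omega)
    rw [addOrderOf_single] at h
    refine ⟨_, atom_map hf h, ?_⟩
    have : k = 1 := by omega
    simp [this]
    omega

end Basis

lemma nsmul_pi_zmod (n r : ℕ) (g : Fin r → ZMod n) : n • g = 0 := by
  ext i
  simp

lemma card_torsion_pi_le {n r : ℕ} [NeZero n] {p : ℕ} (hp : p.Prime) :
    Nat.card {g : Fin r → ZMod n // p • g = 0} ≤ p ^ r := by
  classical
  have h1 : Nat.card {x : ZMod n // p • x = 0} ≤ p := by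
    have := IsAddCyclic.card_nsmul_eq_zero_le (α := ZMod n) hp.pos
    rwa [Nat.card_eq_fintype_card, Fintype.card_subtype]
  have e : {g : Fin r → ZMod n // p • g = 0} ≃ (Fin r → {x : ZMod n // p • x = 0}) :=
    { toFun := fun g i => ⟨g.1 i, congrFun g.2 i⟩
      invFun := fun g => ⟨fun i => (g i).1, funext fun i => (g i).2⟩
      left_inv := fun g => rfl
      right_inv := fun g => rfl }
  rw [Nat.card_congr e, Nat.card_fun, Nat.card_fin]
  exact Nat.pow_le_pow_left h1 r

lemma embeds_pi (n r : ℕ) : Embeds n r (Fin r → ZMod n) :=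
  ⟨AddMonoidHom.id _, Function.injective_id⟩

lemma Embeds.le_of_pi {n k r : ℕ} (hn : 1 < n) (h : Embeds n k (Fin r → ZMod n)) : k ≤ r := by
  have : NeZero n := ⟨by omega⟩
  obtain ⟨f, hf⟩ := h
  have := Nat.card_le_card_of_injective f hf
  rw [Nat.card_fun, Nat.card_fun, Nat.card_fin, Nat.card_fin, Nat.card_zmod] at this
  exact (Nat.pow_le_pow_iff_right hn).1 this

lemma QProp.cases_pi {n r d a b : ℕ} (hn : 1 < n) (hab : a < b)
    (hQ : QProp (Fin r → ZMod n) d a b) :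
    (d + 2 ≤ n ∧ (n < 2 * d + 2 → n ≤ d + 1 + r)) ∨ d + 1 ≤ r ∨
      (2 * d + 3 ≤ n + r ∧
        ∃ A : Multiset (Fin r → ZMod n), Atom A ∧ (d + 1) * n ≤ wt (ordWt n) A) := by
  have : NeZero n := ⟨by omega⟩
  rcases hQ.cases (by omega) (nsmul_pi_zmod n r) hab (fun p hp => card_torsion_pi_le hp) with
    ⟨h1, h2⟩ | h
  · refine Or.inl ⟨h1, fun h => ?_⟩
    have := (h2 h).le_of_pi hn
    omega
  · exact Or.inr h

lemma embeds_one {g : G} {m : ℕ} (hm : 0 < m) (hg : addOrderOf g = m) : Embeds m 1 G := by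
  have : NeZero m := ⟨by omega⟩
  refine embeds_of_indep (fun _ => g) (fun _ => by rw [← hg]; exact addOrderOf_nsmul_eq_zero g) ?_
  intro c hc h i
  simp only [Finset.univ_unique, Finset.sum_singleton] at h
  have h2 := addOrderOf_dvd_of_nsmul_eq_zero h
  rw [hg] at h2
  have := Nat.eq_zero_of_dvd_of_lt h2 (hc _)
  rwa [Subsingleton.elim i default]

/-- The exponent of `G` as an element order. -/
lemma exists_exponent (G : Type*) [AddCommGroup G] [Finite G] :
    ∃ m, 0 < m ∧ (∀ g : G, m • g = 0) ∧ ∃ g : G, addOrderOf g = m := by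
  refine ⟨AddMonoid.exponent G, AddMonoid.exponent_pos.2 (AddMonoid.ExponentExists.of_finite),
    AddMonoid.exponent_nsmul_eq_zero, AddMonoid.exists_addOrderOf_eq_exponent ?_⟩
  exact AddMonoid.ExponentExists.of_finite

section Finite

variable [Finite G] {n r : ℕ}

lemma Embeds.qProp_one {m : ℕ} (hm : 2 < m) (h : Embeds m 1 G) : QProp G (m - 2) 2 m := by
  have := h.qProp_basis le_rfl (by omega)
  rwa [Nat.sub_sub] at this

lemma order_le_of_systemSets_eq (hn : 1 < n) (hrn : r < n)
    (hL : SystemSets G = SystemSets (Fin r → ZMod n)) (g : G) : addOrderOf g ≤ n := by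
  by_contra hc
  have hQ := ((embeds_one (addOrderOf_pos g) rfl).qProp_one (by omega)).congr hL
  rcases hQ.cases_pi hn (by omega) with h | h | h <;> omega

lemma qProp_of_lt_card {p s : ℕ} (hs : 1 ≤ s) (hp : p.Prime)
    (h : ¬ Nat.card {g : G // p • g = 0} ≤ p ^ s) :
    QProp G s p (1 + (s + 1) * (p - 1)) ∧ p < 1 + (s + 1) * (p - 1) := by
  have h2 := hp.two_le
  refine ⟨by simpa using (embeds_of_lt_card hp h).qProp_full (by omega) (by omega), ?_⟩
  have : 2 * (p - 1) ≤ (s + 1) * (p - 1) := Nat.mul_le_mul_right _ (by omega)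
  omega

lemma equiv_of_embeds (hn : 1 < n) (hr : 1 ≤ r)
    (hL : SystemSets G = SystemSets (Fin r → ZMod n)) (h : Embeds n r G) :
    Nonempty (G ≃+ (Fin r → ZMod n)) := by
  have : NeZero n := ⟨by omega⟩
  have : Fact (1 < n) := ⟨hn⟩
  have : Nonempty (Fin r) := ⟨⟨0, hr⟩⟩
  obtain ⟨f, hf⟩ := h
  exact nonempty_equiv_of_injective hL hf

lemma exponent_eq (hn : 2 < n) (hr : 1 ≤ r) {s : ℕ} (hrn : r < n) (hsn : s + 2 ≤ n)
    (hL : SystemSets G = SystemSets (Fin r → ZMod n))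
    (hs : ∀ p : ℕ, p.Prime → Nat.card {g : G // p • g = 0} ≤ p ^ s) : ∀ g : G, n • g = 0 := by
  have : NeZero n := ⟨by omega⟩
  obtain ⟨m, hm, hmG, g, hg⟩ := exists_exponent G
  have hmn : m ≤ n := hg ▸ order_le_of_systemSets_eq (by omega) hrn hL g
  have hQ := (((embeds_pi n r).mono hr).qProp_one hn).congr hL.symm
  have : m = n := by
    rcases hQ.cases hm hmG hn hs with h | h | h <;> omega
  exact this ▸ hmG

/-- The characterization once the `p`-ranks of `G` are known to be small. -/
lemma equiv_of_rank_le (hn : 2 < n) (hr : 1 ≤ r) {s : ℕ} (hrn : 2 * r < n) (hsn : s + 2 * r ≤ n)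
    (hL : SystemSets G = SystemSets (Fin r → ZMod n))
    (hs : ∀ p : ℕ, p.Prime → Nat.card {g : G // p • g = 0} ≤ p ^ s) :
    Nonempty (G ≃+ (Fin r → ZMod n)) := by
  have hnG := exponent_eq hn hr (by omega) (by omega) hL hs
  have hQ := ((embeds_pi n r).qProp_basis hr (by omega)).congr hL.symm
  rcases hQ.cases (by omega) hnG (by omega) hs with ⟨-, h⟩ | h | h
  · have h := h (by omega)
    rw [show n - (n - r - 1) - 1 = r by omega] at h
    exact equiv_of_embeds (by omega) hr hL h
  · omega
  · omega

lemma equiv_of_large (hn : 2 < n) (hr : 1 ≤ r)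
    (h : r = 1 ∧ 5 ≤ n ∨ r = 2 ∧ 8 ≤ n ∨ 3 ≤ r ∧ 6 * r ≤ n + 2)
    (hL : SystemSets G = SystemSets (Fin r → ZMod n)) : Nonempty (G ≃+ (Fin r → ZMod n)) := by
  refine equiv_of_rank_le (s := (n + r - 1) / 2) hn hr (by omega) (by omega) hL fun p hp => ?_
  by_contra hc
  obtain ⟨hQ, hlt⟩ := qProp_of_lt_card (by omega) hp hc
  rcases (hQ.congr hL).cases_pi (by omega) hlt with h | h | h <;> omega

end Finite

open MvPolynomial in
lemma exists_finset_sum_eq_zero {p : ℕ} [Fact p.Prime] {ι κ : Type*} [Fintype ι] [Fintype κ]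
    (v : ι → κ → ZMod p) (h : Fintype.card κ * (p - 1) < Fintype.card ι) :
    ∃ I : Finset ι, I.Nonempty ∧ ∑ i ∈ I, v i = 0 := by
  classical
  have hp : p.Prime := Fact.out
  let f : κ → MvPolynomial ι (ZMod p) := fun j => ∑ i, v i j • X i ^ (p - 1)
  have hdeg : ∑ j, (f j).totalDegree < Fintype.card ι := by
    refine lt_of_le_of_lt (Finset.sum_le_card_nsmul _ _ (p - 1) fun j _ => ?_) (by simpa using h)
    refine totalDegree_finsetSum_le fun i _ => ?_
    exact (totalDegree_smul_le ..).trans (totalDegree_X_pow ..).le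
  have hdvd := char_dvd_card_solutions_of_fintype_sum_lt p hdeg
  let z : {x : ι → ZMod p // ∀ j, eval x (f j) = 0} :=
    ⟨0, fun j => by simp [f, map_sum, hp.one_lt, tsub_eq_zero_iff_le]⟩
  rw [← Nat.card_eq_fintype_card] at hdvd
  have : Nonempty {x : ι → ZMod p // ∀ j, eval x (f j) = 0} := ⟨z⟩
  have : Nontrivial {x : ι → ZMod p // ∀ j, eval x (f j) = 0} := Finite.one_lt_card_iff_nontrivial.1
    (hp.one_lt.trans_le (Nat.le_of_dvd Nat.card_pos hdvd))
  obtain ⟨x, hx⟩ := exists_ne z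
  refine ⟨Finset.univ.filter fun i => x.1 i ≠ 0, ?_, ?_⟩
  · rw [← Subtype.coe_ne_coe, Function.ne_iff] at hx
    obtain ⟨i, hi⟩ := hx
    exact ⟨i, by simpa [z] using hi⟩
  · ext j
    have := x.2 j
    simp only [f, map_sum, smul_eval, map_pow, eval_X, ZMod.pow_card_sub_one] at this
    rw [Finset.sum_apply, Pi.zero_apply, Finset.sum_filter]
    refine Eq.trans (Finset.sum_congr rfl fun i _ => ?_) this
    split_ifs <;> simp

lemma exists_zero_sum_of_module {p s : ℕ} [Fact p.Prime] {K : Type*} [AddCommGroup K] [Finite K]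
    [Module (ZMod p) K] (hc : Nat.card K ≤ p ^ s) {ι : Type*} [Fintype ι] (g : ι → K)
    (h : s * (p - 1) < Fintype.card ι) : ∃ I : Finset ι, I.Nonempty ∧ ∑ i ∈ I, g i = 0 := by
  rw [Module.natCard_eq_pow_finrank (K := ZMod p), Nat.card_zmod,
    Nat.pow_le_pow_iff_right (Fact.out : p.Prime).one_lt] at hc
  let e := (Module.finBasis (ZMod p) K).equivFun
  obtain ⟨I, hI, hs⟩ := exists_finset_sum_eq_zero (fun i => e (g i))
    (lt_of_le_of_lt (Nat.mul_le_mul_right _ (by simpa using hc)) h)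
  refine ⟨I, hI, e.injective ?_⟩
  rw [map_sum, hs, map_zero]

lemma exists_zero_sum_sub [Finite G] {p s : ℕ} (hp : p.Prime)
    (hc : Nat.card {g : G // p • g = 0} ≤ p ^ s) {S : Multiset G} (hS : ∀ g ∈ S, p • g = 0)
    (h : s * (p - 1) < S.card) : ∃ T ≤ S, T ≠ 0 ∧ T.sum = 0 := by
  have := Fact.mk hp
  let K : AddSubgroup G := (nsmulAddMonoidHom p : G →+ G).ker
  have hmem : ∀ x, x ∈ K ↔ p • x = 0 := fun x => by simp [K, AddMonoidHom.mem_ker]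
  let : Module (ZMod p) K := AddCommGroup.zmodModule fun x => Subtype.ext (by
    rw [AddSubgroup.coe_nsmul, (hmem x).1 x.2, AddSubgroup.coe_zero])
  have hcK : Nat.card {g : G // p • g = 0} = Nat.card K :=
    Nat.card_congr (Equiv.subtypeEquivRight fun x => (hmem x).symm)
  rw [hcK] at hc
  let l := S.toList
  have hl : ∀ i : Fin l.length, l.get i ∈ K := fun i =>
    (hmem _).2 (hS _ (Multiset.mem_toList.1 (List.get_mem l i)))
  obtain ⟨I, hI, hs⟩ := exists_zero_sum_of_module hc (fun i : Fin l.length => (⟨l.get i, hl i⟩ : K))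
    (by simpa [l] using h)
  have hS' : (Finset.univ : Finset (Fin l.length)).val.map l.get = S := by
    rw [Fin.univ_val_map, List.ofFn_get, Multiset.coe_toList]
  refine ⟨I.val.map l.get, ?_, ?_, ?_⟩
  · rw [← hS']
    exact Multiset.map_le_map (Finset.val_le_iff.2 (Finset.subset_univ I))
  · simpa using hI.ne_empty
  · have := congrArg (K.subtype) hs
    rw [map_sum, map_zero] at this
    exact this

/-- Disjoint blocks of an atom whose sums are `p`-torsion are few. -/
lemma Atom.card_blocks_le [Finite G] {p s : ℕ} (hp : p.Prime)
    (hc : Nat.card {g : G // p • g = 0} ≤ p ^ s) {A : Multiset G} (hA : Atom A)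
    {B : Multiset (Multiset G)} (hB : B.sum ≤ A) (hB' : ∀ T ∈ B, T ≠ 0 ∧ p • T.sum = 0) :
    B.card ≤ s * (p - 1) + 1 := by
  by_contra hlt
  have h0 : B ≠ 0 := by rintro rfl; simp at hlt
  obtain ⟨b, hb⟩ := Multiset.exists_mem_of_ne_zero h0
  obtain ⟨B, rfl⟩ := Multiset.exists_cons_of_mem hb
  obtain ⟨T', hT', hT0, hTs⟩ := exists_zero_sum_sub hp hc (S := B.map Multiset.sum) (by
    intro g hg
    obtain ⟨T, hT, rfl⟩ := Multiset.mem_map.1 hg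
    exact (hB' T (by simp [hT])).2) (by
    rw [Multiset.card_map]
    rw [Multiset.card_cons] at hlt
    omega)
  obtain ⟨T, hT, rfl⟩ := exists_le_map hT'
  obtain ⟨R, rfl⟩ := Multiset.le_iff_exists_add.1 hT
  have hs : T.sum.sum = 0 := by
    rw [← hTs]
    exact map_multiset_sum (Multiset.sumAddMonoidHom (M := G)) T
  have hT0' : T.sum ≠ 0 := by
    intro h
    obtain ⟨U, hU⟩ := Multiset.exists_mem_of_ne_zero (s := T) (by rintro rfl; simp at hT0)
    exact (hB' U (by simp [hU])).1 (Multiset.le_zero.1 (h ▸ le_sum_of_mem hU))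
  rw [Multiset.sum_cons, Multiset.sum_add] at hB
  have h1 := hA.eq_of_le (le_trans (by
    rw [add_left_comm]; exact Multiset.le_add_right _ _) hB) hT0' hs
  rw [← h1, add_left_comm] at hB
  have := Multiset.card_le_card hB
  rw [Multiset.card_add, Multiset.card_add] at this
  exact (hB' b (by simp)).1 (Multiset.card_eq_zero.1 (by omega))

lemma Atom.card_le_of_torsion [Finite G] {p s : ℕ} (hp : p.Prime)
    (hc : Nat.card {g : G // p • g = 0} ≤ p ^ s) {A : Multiset G} (hA : Atom A)
    (h : ∀ g ∈ A, p • g = 0) : A.card ≤ s * (p - 1) + 1 := by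
  have := hA.card_blocks_le hp hc (B := A.map fun g => {g}) (by simp) (by
    intro T hT
    obtain ⟨g, hg, rfl⟩ := Multiset.mem_map.1 hT
    simpa using h g hg)
  simpa using this

lemma exists_le_card_eq {α : Type*} {M : Multiset α} {c : ℕ} (h : c ≤ M.card) :
    ∃ S ≤ M, S.card = c := by
  have : 0 < (Multiset.powersetCard c M).card := by
    rw [Multiset.card_powersetCard]
    exact Nat.choose_pos h
  obtain ⟨S, hS⟩ := Multiset.card_pos_iff_exists_mem.1 this
  exact ⟨S, Multiset.mem_powersetCard.1 hS⟩

/-- Greedy extraction of short blocks. -/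
lemma exists_blocks {P : Multiset G → Prop} {c : ℕ} (M : Multiset G)
    (h : ∀ S ≤ M, S.card = c → ∃ T ≤ S, T ≠ 0 ∧ P T) :
    ∃ B : Multiset (Multiset G), B.sum ≤ M ∧ (∀ T ∈ B, T ≠ 0 ∧ P T) ∧
      M.card < c + c * B.card := by
  induction M using Multiset.strongInductionOn with
  | _ M ih =>
    by_cases hM : M.card < c
    · exact ⟨0, by simp, by simp, by simpa using hM⟩
    · obtain ⟨S, hS, hSc⟩ := exists_le_card_eq (not_lt.1 hM)
      obtain ⟨T, hT, hT0, hPT⟩ := h S hS hSc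
      obtain ⟨M', rfl⟩ := Multiset.le_iff_exists_add.1 (hT.trans hS)
      have hlt : M' < T + M' := by
        refine lt_of_le_of_ne (Multiset.le_add_left _ _) fun h => ?_
        have := congrArg Multiset.card h
        rw [Multiset.card_add] at this
        exact hT0 (Multiset.card_eq_zero.1 (by omega))
      obtain ⟨B, hB, hB', hcard⟩ := ih M' hlt fun S hS => h S (hS.trans (Multiset.le_add_left _ _))
      refine ⟨T ::ₘ B, ?_, ?_, ?_⟩
      · rw [Multiset.sum_cons]
        exact Multiset.add_le_add_iff_left.2 hB
      · intro U hU
        rcases Multiset.mem_cons.1 hU with rfl | hU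
        · exact ⟨hT0, hPT⟩
        · exact hB' U hU
      · have := Multiset.card_le_card hT
        rw [Multiset.card_add, Multiset.card_cons, mul_add]
        omega

lemma wt_ordWt_le_card_of_prime {p : ℕ} (hp : p.Prime) (hG : ∀ g : G, p • g = 0) {A : Multiset G}
    (h0 : (0 : G) ∉ A) : wt (ordWt p) A = A.card := by
  have : ∀ g ∈ A, ordWt p g = (fun _ => 1) g := by
    intro g hg
    have h1 : addOrderOf g = p := by
      have := Fact.mk hp
      exact addOrderOf_eq_prime (hG g) fun h => h0 (h ▸ hg)
    simp [ordWt, h1, Nat.div_self hp.pos]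
  rw [wt_congr this]
  simp [wt_apply]

lemma wt_pi_prime_le {p r : ℕ} (hp : p.Prime) {A : Multiset (Fin r → ZMod p)} (hA : Atom A) :
    wt (ordWt p) A ≤ max p (r * (p - 1) + 1) := by
  have : NeZero p := ⟨hp.ne_zero⟩
  by_cases h0 : (0 : Fin r → ZMod p) ∈ A
  · rw [hA.eq_zero_of_mem h0, wt_ordWt_eq_of_zero]
    exact le_max_left _ _
  · rw [wt_ordWt_le_card_of_prime hp (nsmul_pi_zmod p r) h0]
    have h1 : Nat.card {g : Fin r → ZMod p // p • g = 0} ≤ p ^ r := card_torsion_pi_le hp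
    have h2 := Atom.card_le_of_torsion hp h1 hA fun g _ => nsmul_pi_zmod p r g
    exact h2.trans (le_max_right _ _)

section Finite

variable [Finite G]

lemma equiv_seven_two (hL : SystemSets G = SystemSets (Fin 2 → ZMod 7)) :
    Nonempty (G ≃+ (Fin 2 → ZMod 7)) := by
  refine equiv_of_rank_le (s := 3) (by norm_num) (by norm_num) (by norm_num) (by norm_num) hL
    fun p hp => ?_
  by_contra hc
  obtain ⟨hQ, hlt⟩ := qProp_of_lt_card (by omega) hp hc
  rcases (hQ.congr hL).cases_pi (by omega) hlt with h | h | ⟨-, A, hA, h⟩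
  · omega
  · omega
  · have := wt_pi_prime_le (by norm_num) hA
    norm_num at this
    omega

lemma nontrivial_of_systemSets_eq {n r : ℕ} (hn : 2 < n) (hr : 1 ≤ r)
    (hL : SystemSets G = SystemSets (Fin r → ZMod n)) : Nontrivial G := by
  have : NeZero n := ⟨by omega⟩
  by_contra hc
  rw [not_nontrivial_iff_subsingleton] at hc
  have hQ := (((embeds_pi n r).mono hr).qProp_one hn).congr hL.symm
  rcases hQ.cases (n := 1) (s := 0) one_pos (fun g => Subsingleton.elim _ _) hn
    (fun p _ => by simp) with h | h | h <;> omega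

lemma equiv_three_two (hL : SystemSets G = SystemSets (Fin 2 → ZMod 3)) :
    Nonempty (G ≃+ (Fin 2 → ZMod 3)) := by
  have := Fintype.ofFinite G
  have hnt := nontrivial_of_systemSets_eq (by norm_num) (by norm_num) hL
  obtain ⟨A, hA, hAc⟩ := (embeds_pi 3 2).exists_atom (by norm_num) (by norm_num)
  obtain ⟨B, hB, hBc⟩ := atom_card_le_of_systemSets_eq hL.symm hA
  have hcard : 5 ≤ Nat.card G := by
    have := hB.card_le
    rw [Nat.card_eq_fintype_card]
    omega
  have hs : ∀ p : ℕ, p.Prime → Nat.card {g : G // p • g = 0} ≤ p ^ 2 := by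
    intro p hp
    by_contra hc
    obtain ⟨hQ, hlt⟩ := qProp_of_lt_card (by omega) hp hc
    rcases (hQ.congr hL).cases_pi (by omega) hlt with h | h | h <;> omega
  obtain ⟨m, hm, hmG, g, hg⟩ := exists_exponent G
  have hm3 : m ≤ 3 := hg ▸ order_le_of_systemSets_eq (by norm_num) (by norm_num) hL g
  have htor : ∀ p : ℕ, (∀ g : G, p • g = 0) → Nat.card {g : G // p • g = 0} = Nat.card G :=
    fun (p : ℕ) h => Nat.card_congr (Equiv.subtypeUnivEquiv h)
  interval_cases m
  · have : Nat.card G = 1 := by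
      have : Subsingleton G := ⟨fun a b => by
        have h1 := hmG a
        have h2 := hmG b
        rw [one_nsmul] at h1 h2
        rw [h1, h2]⟩
      exact Nat.card_unique
    omega
  · have := hs 2 Nat.prime_two
    rw [htor 2 hmG] at this
    omega
  · refine equiv_of_embeds (by norm_num) (by norm_num) hL ?_
    refine embeds_of_lt_card (k := 1) Nat.prime_three ?_
    rw [htor 3 hmG]
    omega

end Finite

lemma atom_iff_powerset {A : Multiset G} :
    Atom A ↔ A.sum = 0 ∧ A ≠ 0 ∧ ∀ B ∈ A.powerset, B ≠ 0 → B.sum = 0 → B = A := by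
  simp only [Multiset.mem_powerset, atom_iff]

lemma sum_map_pair {α β : Type*} (f : α → β) (M : Multiset α) :
    (M.map fun x => ({x, x} : Multiset α).map f).sum = (2 • M).map f := by
  induction M using Multiset.induction_on with
  | empty => simp
  | cons x M ih =>
    rw [Multiset.map_cons, Multiset.sum_cons, ih, ← Multiset.map_add, Multiset.nsmul_cons]
    congr 1

lemma exists_three_six (h : Embeds 2 3 G) : ∃ L ∈ SystemSets G, 3 ∈ L ∧ 6 ∈ L := by
  obtain ⟨f, hf⟩ := h
  let P : Multiset (Fin 3 → ZMod 2) := {![1, 0, 0], ![1, 0, 1]}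
  let Q : Multiset (Fin 3 → ZMod 2) := {![0, 1, 0], ![0, 1, 1]}
  let R : Multiset (Fin 3 → ZMod 2) := {![1, 1, 0], ![1, 1, 1]}
  have h1 : Atom (P + Q) := atom_iff_powerset.2 (by decide)
  have h2 : Atom (P + R) := atom_iff_powerset.2 (by decide)
  have h3 : Atom (Q + R) := atom_iff_powerset.2 (by decide)
  have h4 : ∀ x ∈ P + Q + R, Atom ({x, x} : Multiset (Fin 3 → ZMod 2)) := by
    intro x hx
    have := atom_pair (g := x) (by revert x; decide)
    rwa [show -x = x by ext i; exact ZModModule.neg_eq_self _] at this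
  refine ⟨LengthSet Set.univ ((2 • (P + Q + R)).map f), ⟨_, ?_, rfl⟩, ?_, ?_⟩
  · rw [← map_multiset_sum, show (2 • (P + Q + R)).sum = 0 by decide, map_zero]
  · refine ⟨{(P + Q).map f, (P + R).map f, (Q + R).map f}, by simp, ?_, ?_⟩
    · intro A hA
      simp only [Multiset.insert_eq_cons, Multiset.mem_cons, Multiset.mem_singleton] at hA
      rcases hA with rfl | rfl | rfl
      · exact atom_map hf h1
      · exact atom_map hf h2
      · exact atom_map hf h3
    · simp only [Multiset.insert_eq_cons, Multiset.sum_cons, Multiset.sum_singleton,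
        ← Multiset.map_add]
      congr 1
      rw [two_nsmul]
      ac_rfl
  · refine ⟨(P + Q + R).map fun x => ({x, x} : Multiset _).map f, by simp [P, Q, R], ?_, ?_⟩
    · intro A hA
      obtain ⟨x, hx, rfl⟩ := Multiset.mem_map.1 hA
      exact atom_map hf (h4 x hx)
    · exact sum_map_pair f _

/-- Two explicit zero-sum subsequences rule each other out in an atom. -/
lemma Atom.card_eq_of_count_le [DecidableEq G] {A : Multiset G} (hA : Atom A) {U : Multiset G}
    (hU : U ≠ 0) (hs : U.sum = 0) (h : ∀ g ∈ U, U.count g ≤ A.count g) : A = U := by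
  refine (hA.eq_of_le (Multiset.le_iff_count.2 fun g => ?_) hU hs).symm
  by_cases hg : g ∈ U
  · exact h g hg
  · rw [Multiset.count_eq_zero.2 hg]
    exact Nat.zero_le _

lemma card_cyclic_four (A : Multiset (Fin 1 → ZMod 4)) :
    A.card = A.count 0 + A.count 1 + A.count 2 + A.count 3 ∧
      A.sum 0 = ((A.count 1 + 2 * A.count 2 + 3 * A.count 3 : ℕ) : ZMod 4) := by
  have h01 : (0 : Fin 1 → ZMod 4) ≠ 1 := by decide
  have h02 : (0 : Fin 1 → ZMod 4) ≠ 2 := by decide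
  have h03 : (0 : Fin 1 → ZMod 4) ≠ 3 := by decide
  have h12 : (1 : Fin 1 → ZMod 4) ≠ 2 := by decide
  have h13 : (1 : Fin 1 → ZMod 4) ≠ 3 := by decide
  have h23 : (2 : Fin 1 → ZMod 4) ≠ 3 := by decide
  induction A using Multiset.induction_on with
  | empty => simp
  | cons g A ih =>
    rw [Multiset.card_cons, ih.1, Multiset.sum_cons, Pi.add_apply, ih.2]
    simp only [Multiset.count_cons]
    have : g = 0 ∨ g = 1 ∨ g = 2 ∨ g = 3 := by clear ih; revert g; decide
    rcases this with rfl | rfl | rfl | rfl <;>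
      simp [h01, h02, h03, h12, h13, h23, h01.symm, h02.symm, h03.symm, h12.symm, h13.symm,
        h23.symm] <;>
        first | (constructor <;> ring) | ring

lemma forall_cyclic_four : ∀ g : Fin 1 → ZMod 4, g = 0 ∨ g = 1 ∨ g = 2 ∨ g = 3 := by
  decide

lemma counts_of_minimal {a b c d : ℕ} (hsum : 4 ∣ b + 2 * c + 3 * d) (hpos : 0 < a + b + c + d)
    (h : ∀ x y z w : ℕ, (x, y, z, w) ∈ ({(1, 0, 0, 0), (0, 4, 0, 0), (0, 0, 0, 4), (0, 1, 0, 1),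
      (0, 0, 2, 0), (0, 2, 1, 0), (0, 0, 1, 2)} : Finset (ℕ × ℕ × ℕ × ℕ)) →
      x ≤ a → y ≤ b → z ≤ c → w ≤ d → a = x ∧ b = y ∧ c = z ∧ d = w) :
    (a = 1 ∧ b = 0 ∧ c = 0 ∧ d = 0) ∨ (a = 0 ∧ (b = 4 ∧ c = 0 ∧ d = 0 ∨ b = 0 ∧ c = 0 ∧ d = 4 ∨
      b = 1 ∧ c = 0 ∧ d = 1 ∨ b = 0 ∧ c = 2 ∧ d = 0 ∨ b = 2 ∧ c = 1 ∧ d = 0 ∨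
      b = 0 ∧ c = 1 ∧ d = 2)) := by
  have k0 := h 1 0 0 0 (by decide)
  have k1 := h 0 4 0 0 (by decide)
  have k2 := h 0 0 0 4 (by decide)
  have k3 := h 0 1 0 1 (by decide)
  have k4 := h 0 0 2 0 (by decide)
  have k5 := h 0 2 1 0 (by decide)
  have k6 := h 0 0 1 2 (by decide)
  clear h
  have z := Nat.zero_le
  rcases Nat.eq_zero_or_pos a with ha | ha
  swap
  · exact .inl (k0 ha (z _) (z _) (z _))
  refine .inr ⟨ha, ?_⟩
  rcases Nat.eq_zero_or_pos b with hb | hb <;> rcases Nat.eq_zero_or_pos d with hd | hd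
  · have := (k4 (z _) (z _) (by clear k0 k1 k2 k3 k4 k5 k6; omega) (z _)).2
    clear k0 k1 k2 k3 k4 k5 k6
    omega
  · rcases Nat.eq_zero_or_pos c with hc | hc
    · have := (k2 (z _) (z _) (z _) (by clear k0 k1 k2 k3 k4 k5 k6; omega)).2
      clear k0 k1 k2 k3 k4 k5 k6
      omega
    · have := (k6 (z _) (z _) hc (by clear k0 k1 k2 k3 k4 k5 k6; omega)).2
      clear k0 k1 k2 k3 k4 k5 k6
      omega
  · rcases Nat.eq_zero_or_pos c with hc | hc
    · have := (k1 (z _) (by clear k0 k1 k2 k3 k4 k5 k6; omega) (z _) (z _)).2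
      clear k0 k1 k2 k3 k4 k5 k6
      omega
    · have := (k5 (z _) (by clear k0 k1 k2 k3 k4 k5 k6; omega) hc (z _)).2
      clear k0 k1 k2 k3 k4 k5 k6
      omega
  · have := (k3 (z _) hb (z _) hd).2
    clear k0 k1 k2 k3 k4 k5 k6
    omega

lemma Atom.cyclic_four {A : Multiset (Fin 1 → ZMod 4)} (hA : Atom A) :
    (A.count 0 = 1 ∧ A.count 1 = 0 ∧ A.count 2 = 0 ∧ A.count 3 = 0) ∨
      (A.count 0 = 0 ∧ (A.count 1 = 4 ∧ A.count 2 = 0 ∧ A.count 3 = 0 ∨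
        A.count 1 = 0 ∧ A.count 2 = 0 ∧ A.count 3 = 4 ∨
        A.count 1 = 1 ∧ A.count 2 = 0 ∧ A.count 3 = 1 ∨
        A.count 1 = 0 ∧ A.count 2 = 2 ∧ A.count 3 = 0 ∨
        A.count 1 = 2 ∧ A.count 2 = 1 ∧ A.count 3 = 0 ∨
        A.count 1 = 0 ∧ A.count 2 = 1 ∧ A.count 3 = 2)) := by
  have key : ∀ U : Multiset (Fin 1 → ZMod 4), U ≠ 0 → U.sum = 0 →
      U.count 0 ≤ A.count 0 → U.count 1 ≤ A.count 1 → U.count 2 ≤ A.count 2 →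
      U.count 3 ≤ A.count 3 → A = U := by
    intro U hU hs h0 h1 h2 h3
    refine hA.card_eq_of_count_le hU hs fun g _ => ?_
    rcases forall_cyclic_four g with rfl | rfl | rfl | rfl
    · exact h0
    · exact h1
    · exact h2
    · exact h3
  obtain ⟨hcard, hsum⟩ := card_cyclic_four A
  rw [hA.sum_eq, Pi.zero_apply, eq_comm, ZMod.natCast_eq_zero_iff] at hsum
  have hpos := Multiset.card_pos.2 hA.ne_zero
  rw [hcard] at hpos
  have key' : ∀ U : Multiset (Fin 1 → ZMod 4), U ≠ 0 → U.sum = 0 → ∀ a b c d : ℕ,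
      U.count 0 = a ∧ U.count 1 = b ∧ U.count 2 = c ∧ U.count 3 = d →
      a ≤ A.count 0 → b ≤ A.count 1 → c ≤ A.count 2 → d ≤ A.count 3 →
      A.count 0 = a ∧ A.count 1 = b ∧ A.count 2 = c ∧ A.count 3 = d := by
    rintro U hU hs a b c d ⟨rfl, rfl, rfl, rfl⟩ h0 h1 h2 h3
    rw [key U hU hs h0 h1 h2 h3]
    exact ⟨rfl, rfl, rfl, rfl⟩
  refine counts_of_minimal hsum hpos fun x y z w hm => ?_
  simp only [Finset.mem_insert, Finset.mem_singleton, Prod.mk.injEq] at hm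
  rcases hm with ⟨rfl, rfl, rfl, rfl⟩ | ⟨rfl, rfl, rfl, rfl⟩ | ⟨rfl, rfl, rfl, rfl⟩ |
    ⟨rfl, rfl, rfl, rfl⟩ | ⟨rfl, rfl, rfl, rfl⟩ | ⟨rfl, rfl, rfl, rfl⟩ | ⟨rfl, rfl, rfl, rfl⟩
  · exact key' {0} (by decide) (by decide) _ _ _ _ (by decide)
  · exact key' {1, 1, 1, 1} (by decide) (by decide) _ _ _ _ (by decide)
  · exact key' {3, 3, 3, 3} (by decide) (by decide) _ _ _ _ (by decide)
  · exact key' {1, 3} (by decide) (by decide) _ _ _ _ (by decide)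
  · exact key' {2, 2} (by decide) (by decide) _ _ _ _ (by decide)
  · exact key' {1, 1, 2} (by decide) (by decide) _ _ _ _ (by decide)
  · exact key' {2, 3, 3} (by decide) (by decide) _ _ _ _ (by decide)

lemma not_three_six {B : Multiset (Fin 1 → ZMod 4)} (h3 : 3 ∈ LengthSet Set.univ B)
    (h6 : 6 ∈ LengthSet Set.univ B) : False := by
  obtain ⟨F, hFc, hF, rfl⟩ := h3
  obtain ⟨F', hFc', hF', hs⟩ := h6
  have key : ∀ F' : Multiset (Multiset (Fin 1 → ZMod 4)), (∀ A ∈ F', Atom A) →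
      4 * F'.card + F'.sum.count 1 ≤ 2 * F'.sum.card + 2 * F'.sum.count 0 + F'.sum.count 3 ∧
      4 * F'.card + F'.sum.count 3 ≤ 2 * F'.sum.card + 2 * F'.sum.count 0 + F'.sum.count 1 := by
    intro F'
    induction F' using Multiset.induction_on with
    | empty => simp
    | cons A F' ih =>
      intro h
      have := ih fun A hA => h A (by simp [hA])
      have hA := Atom.cyclic_four (h A (by simp))
      have hc := (card_cyclic_four A).1
      simp only [Multiset.sum_cons, Multiset.count_add, Multiset.card_add, Multiset.card_cons]
      omega
  have hk := key F' hF'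
  rw [hs, hFc'] at hk
  obtain ⟨A, B, C, rfl⟩ := Multiset.card_eq_three.1 hFc
  have hA := Atom.cyclic_four (hF A (by simp))
  have hB := Atom.cyclic_four (hF B (by simp))
  have hC := Atom.cyclic_four (hF C (by simp))
  have cA := (card_cyclic_four A).1
  have cB := (card_cyclic_four B).1
  have cC := (card_cyclic_four C).1
  simp only [Multiset.insert_eq_cons, Multiset.sum_cons, Multiset.sum_singleton,
    Multiset.count_add, Multiset.card_add] at hk
  omega

lemma equiv_four_one [Finite G] (hL : SystemSets G = SystemSets (Fin 1 → ZMod 4)) :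
    Nonempty (G ≃+ (Fin 1 → ZMod 4)) := by
  have : Fact (1 < 4) := ⟨by norm_num⟩
  have : Nontrivial (Fin 1 → ZMod 4) := Function.nontrivial
  refine equiv_of_rank_le (s := 2) (by norm_num) (by norm_num) (by norm_num) (by norm_num) hL
    fun p hp => ?_
  by_contra hc
  have hE := embeds_of_lt_card hp hc
  obtain ⟨A, hA, hAc⟩ := hE.exists_atom (by norm_num) hp.one_lt
  obtain ⟨B, hB, hBc⟩ := atom_card_le_of_systemSets_eq hL hA
  have hB4 : B.card ≤ 4 := by simpa using hB.card_le
  have hp2 := hp.two_le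
  have : p = 2 := by omega
  subst this
  obtain ⟨L, hLG, h3, h6⟩ := exists_three_six hE
  rw [hL] at hLG
  obtain ⟨B, -, rfl⟩ := hLG
  exact not_three_six h3 h6

lemma atom_add_replicate_two {g : G} (hg : addOrderOf g = 4) {T : Multiset G} (hT : T ≠ 0)
    (hmin : ∀ T' ≤ T, T' ≠ 0 → T'.sum ∈ AddSubgroup.zmultiples g → T' = T)
    (hs : T.sum = 2 • g) : Atom (T + Multiset.replicate 2 g) := by
  refine atom_iff.2 ⟨?_, ?_, ?_⟩
  · rw [Multiset.sum_add, hs, Multiset.sum_replicate, ← add_nsmul]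
    exact addOrderOf_dvd_iff_nsmul_eq_zero.1 (by rw [hg])
  · intro h
    exact hT (add_eq_zero.1 h).1
  · intro B hB hB0 hBs
    obtain ⟨T', R, rfl, hT', hR⟩ := exists_add_of_le_add hB
    obtain ⟨j, hj, rfl⟩ := Multiset.le_replicate_iff.1 hR
    rw [Multiset.sum_add, Multiset.sum_replicate] at hBs
    by_cases h0 : T' = 0
    · subst h0
      rw [Multiset.sum_zero, zero_add, ← addOrderOf_dvd_iff_nsmul_eq_zero, hg] at hBs
      have : j = 0 := by omega
      subst this
      simp at hB0
    · have := hmin T' hT' h0 (by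
        rw [eq_neg_of_add_eq_zero_left hBs]
        exact neg_mem (AddSubgroup.nsmul_mem_zmultiples _ _))
      subst this
      rw [hs, ← add_nsmul, ← addOrderOf_dvd_iff_nsmul_eq_zero, hg] at hBs
      have : j = 2 := by omega
      rw [this]

lemma Uniform.sum_ne_two_nsmul {G₀ : Set G} (h : Uniform 2 G₀) {g : G} (hg : addOrderOf g = 4)
    (hgG : g ∈ G₀) (hgn : -g ∈ G₀) {T : Multiset G} (hT : ∀ x ∈ T, x ∈ G₀) (hT0 : T ≠ 0)
    (hmin : ∀ T' ≤ T, T' ≠ 0 → T'.sum ∈ AddSubgroup.zmultiples g → T' = T) :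
    T.sum ≠ 2 • g := by
  intro hs
  have hg4 : 4 • g = 0 := addOrderOf_dvd_iff_nsmul_eq_zero.1 (by rw [hg])
  have h1 := atom_add_replicate_two hg hT0 hmin hs
  have h2 := atom_add_replicate_two (g := -g) (by rw [addOrderOf_neg, hg]) hT0
    (by rwa [AddSubgroup.zmultiples_neg]) (by
      rw [hs, smul_neg, eq_neg_iff_add_eq_zero, ← add_nsmul, hg4])
  have h3 := atom_replicate (-g) (by rw [addOrderOf_neg, hg]; norm_num)
  rw [addOrderOf_neg, hg] at h3
  have h4 : Atom ({g, -g} : Multiset G) := atom_pair (by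
    rintro rfl
    simp at hg)
  have := h {T + Multiset.replicate 2 g, Multiset.replicate 4 (-g)}
    {T + Multiset.replicate 2 (-g), {g, -g}, {g, -g}} (by
      intro A hA
      simp only [Multiset.insert_eq_cons, Multiset.mem_cons, Multiset.mem_singleton] at hA
      rcases hA with rfl | rfl
      · exact h1
      · exact h3) (by
      intro A hA
      simp only [Multiset.insert_eq_cons, Multiset.mem_cons, Multiset.mem_singleton] at hA
      rcases hA with rfl | rfl | rfl
      · exact h2
      · exact h4
      · exact h4) (by
      simp only [Multiset.insert_eq_cons, Multiset.sum_cons, Multiset.sum_singleton, add_assoc]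
      congr 1
      simp only [Multiset.replicate_succ, Multiset.replicate_zero, ← Multiset.singleton_add,
        add_zero]
      ac_rfl) (by
      intro x hx
      simp only [Multiset.insert_eq_cons, Multiset.sum_cons, Multiset.sum_singleton,
        Multiset.mem_add, Multiset.mem_replicate] at hx
      rcases hx with (hx | hx) | hx
      · exact hT x hx
      · exact hx.2 ▸ hgG
      · exact hx.2 ▸ hgn)
  revert this
  simp only [Multiset.insert_eq_cons, Multiset.card_cons, Multiset.card_singleton]
  decide

lemma wt_cyclic_four {A : Multiset (Fin 1 → ZMod 4)} (hA : Atom A) (h0 : 0 ∉ A) :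
    wt (fun y => if y = 2 then 2 else 1) A = 2 ∨ wt (fun y => if y = 2 then 2 else 1) A = 4 := by
  have key : ∀ A : Multiset (Fin 1 → ZMod 4),
      wt (fun y => if y = 2 then 2 else 1) A = A.card + A.count 2 := by
    intro A
    induction A using Multiset.induction_on with
    | empty => simp
    | cons y A ih =>
      rw [wt_cons, ih, Multiset.card_cons, Multiset.count_cons]
      by_cases hy : y = 2
      · rw [if_pos hy, if_pos hy.symm]
        omega
      · rw [if_neg hy, if_neg (Ne.symm hy)]
        omega
  have h1 := hA.cyclic_four
  have h2 := (card_cyclic_four A).1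
  have h3 := Multiset.count_eq_zero.2 h0
  rw [key]
  omega

lemma ordWt_four_of_two {x : G} (h0 : x ≠ 0) (h : 2 • x = 0) : ordWt 4 x = 2 := by
  have : Fact (Nat.Prime 2) := ⟨Nat.prime_two⟩
  rw [ordWt, addOrderOf_eq_prime h h0]

lemma ordWt_four_of_ne {x : G} (h4 : 4 • x = 0) (h : 2 • x ≠ 0) : ordWt 4 x = 1 := by
  have : Fact (Nat.Prime 2) := ⟨Nat.prime_two⟩
  rw [ordWt, addOrderOf_eq_prime_pow (p := 2) (n := 1) (by simpa using h) (by simpa using h4)]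
  norm_num

/-- The determinant with first row `g`, as a homomorphism. -/
def detHom {n : ℕ} (g : Fin 2 → ZMod n) : (Fin 2 → ZMod n) →+ (Fin 1 → ZMod n) where
  toFun x := fun _ => g 0 * x 1 - g 1 * x 0
  map_zero' := by ext; simp
  map_add' x y := by ext; simp; ring

lemma detHom_self {n : ℕ} (g : Fin 2 → ZMod n) : detHom g g = 0 := by
  ext i
  simp [detHom, mul_comm]

lemma eq_of_detHom_four {g x : Fin 2 → ZMod 4} (hg : 2 • g ≠ 0) (hx : detHom g x = 0) :
    x = 0 ∨ x = g ∨ x = -g ∨ x = 2 • g := by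
  have key : ∀ a b c d : ZMod 4, ¬ (2 • a = 0 ∧ 2 • b = 0) → a * d - b * c = 0 →
      (c = 0 ∧ d = 0) ∨ (c = a ∧ d = b) ∨ (c = -a ∧ d = -b) ∨ (c = 2 • a ∧ d = 2 • b) := by
    decide
  have := key (g 0) (g 1) (x 0) (x 1) (fun h => hg (by
    ext i
    fin_cases i
    · exact h.1
    · exact h.2)) (congrFun hx 0)
  simpa [funext_iff, Fin.forall_fin_two] using this

lemma Uniform.wt_le_four {G₀ : Set (Fin 2 → ZMod 4)} (h : Uniform 2 G₀) {g : Fin 2 → ZMod 4}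
    (hg : addOrderOf g = 4) (hgG : g ∈ G₀) (hgn : -g ∈ G₀) {A : Multiset (Fin 2 → ZMod 4)}
    (hA : Atom A) (hA' : ∀ x ∈ A, x ∈ G₀) : wt (ordWt 4) A ≤ 4 := by
  have h4 : ∀ x : Fin 2 → ZMod 4, 4 • x = 0 := nsmul_pi_zmod 4 2
  have hg2 : 2 • g ≠ 0 := by
    rw [Ne, ← addOrderOf_dvd_iff_nsmul_eq_zero, hg]
    norm_num
  have hwg : ordWt 4 g = 1 := ordWt_four_of_ne (h4 g) hg2
  have hwn : ordWt 4 (-g) = 1 := ordWt_four_of_ne (h4 _) (by simpa using hg2)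
  have hrep : ∀ x : Fin 2 → ZMod 4, addOrderOf x = 4 → (∀ y ∈ A, y = x) → A.card ≤ 4 := by
    intro x hx hAx
    by_contra hc
    have := atom_eq_replicate hA (by norm_num) hx (by
      rw [Multiset.eq_replicate_card.2 hAx]
      exact Multiset.replicate_le_replicate _ |>.2 (by omega))
    rw [this] at hc
    simp at hc
  have heven : ∀ B : Multiset (Fin 2 → ZMod 4), B.sum = 0 → (∀ x ∈ B, x ∈ G₀) →
      2 ∣ wt (ordWt 4) B := by
    intro B hB hBG
    obtain ⟨F, hF, rfl⟩ := exists_fact hB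
    rw [wt_sum]
    refine Multiset.dvd_sum fun w hw => ?_
    obtain ⟨V, hV, rfl⟩ := Multiset.mem_map.1 hw
    have := h.wt_modEq (n := 4) (by norm_num) (fun x _ => h4 x) (hF V hV)
      fun x hx => hBG x (mem_msum.2 ⟨V, hV, hx⟩)
    exact (Nat.modEq_zero_iff_dvd.1 (this.trans (by decide)))
  by_cases h0 : (0 : Fin 2 → ZMod 4) ∈ A
  · rw [hA.eq_zero_of_mem h0, wt_ordWt_eq_of_zero]
  let T := A.filter fun x => x ≠ g ∧ x ≠ -g
  have hTA : T ≤ A := Multiset.filter_le _ _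
  by_cases hT : T = 0
  · have hpm : ∀ x ∈ A, x = g ∨ x = -g := by
      intro x hx
      by_contra hc
      have : x ∈ T := Multiset.mem_filter.2 ⟨hx, not_or.1 hc⟩
      rw [hT] at this
      simp at this
    have hw : wt (ordWt 4) A ≤ A.card * 1 := wt_le_card _ fun x hx => by
      rcases hpm x hx with rfl | rfl
      · exact hwg.le
      · exact hwn.le
    refine hw.trans ?_
    rw [mul_one]
    by_cases h1 : g ∈ A
    · by_cases h2 : -g ∈ A
      · have hne : g ≠ -g := by
          intro h
          apply hg2
          rw [two_nsmul]
          nth_rewrite 2 [h]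
          exact add_neg_cancel g
        have : ({g, -g} : Multiset (Fin 2 → ZMod 4)) ≤ A := by
          refine (Multiset.le_iff_subset ?_).2 ?_
          · simpa using hne
          · intro x hx
            simp only [Multiset.insert_eq_cons, Multiset.mem_cons, Multiset.mem_singleton] at hx
            rcases hx with rfl | rfl
            · exact h1
            · exact h2
        rw [← hA.eq_of_le this (by simp) (by simp)]
        simp
      · exact hrep g hg fun x hx => (hpm x hx).resolve_right (by rintro rfl; exact h2 hx)
    · exact hrep (-g) (by rw [addOrderOf_neg, hg]) fun x hx =>
        (hpm x hx).resolve_left (by rintro rfl; exact h1 hx)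
  have hDg : ∀ x ∈ AddSubgroup.zmultiples g, detHom g x = 0 := by
    intro x hx
    obtain ⟨k, rfl⟩ := AddSubgroup.mem_zmultiples_iff.1 hx
    rw [map_zsmul, detHom_self, smul_zero]
  have hDT : (T.map (detHom g)).sum = 0 := by
    have h1 := Multiset.filter_add_not (fun x => x ≠ g ∧ x ≠ -g) A
    have h2 : ((A.filter fun x => ¬ (x ≠ g ∧ x ≠ -g)).map (detHom g)).sum = 0 := by
      refine Multiset.sum_eq_zero fun y hy => ?_
      obtain ⟨x, hx, rfl⟩ := Multiset.mem_map.1 hy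
      have := (Multiset.mem_filter.1 hx).2
      by_cases hxg : x = g
      · rw [hxg, detHom_self]
      · have : x = -g := by tauto
        rw [this, map_neg, detHom_self, neg_zero]
    have h3 := congrArg (fun M => (M.map (detHom g)).sum) h1
    simp only [Multiset.map_add, Multiset.sum_add] at h3
    rw [h2, add_zero, ← map_multiset_sum, ← map_multiset_sum, hA.sum_eq, map_zero] at h3
    rw [← map_multiset_sum]
    exact h3
  obtain ⟨V, hVT, hV⟩ := exists_atom_le hDT (by simpa using hT)
  obtain ⟨T', hT'T, rfl⟩ := exists_le_map hVT
  have hT'0 : T' ≠ 0 := by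
    rintro rfl
    exact hV.ne_zero rfl
  have hT'A : T' ≤ A := hT'T.trans hTA
  have hT'G : ∀ x ∈ T', x ∈ G₀ := fun x hx => hA' x (Multiset.mem_of_le hT'A hx)
  have hmin : ∀ S ≤ T', S ≠ 0 → S.sum ∈ AddSubgroup.zmultiples g → S = T' := by
    intro S hS hS0 hSs
    have := hV.eq_of_le (Multiset.map_le_map hS) (by simpa using hS0)
      (by rw [← map_multiset_sum, hDg _ hSs])
    refine Multiset.eq_of_le_of_card_le hS ?_
    rw [← Multiset.card_map (detHom g) T', ← this, Multiset.card_map]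
  have hD0 : ∀ x ∈ T', detHom g x ≠ 0 := by
    intro x hx hDx
    have hx' := (Multiset.mem_filter.1 (Multiset.mem_of_le hT'T hx)).2
    rcases eq_of_detHom_four hg2 hDx with hx0 | hx0 | hx0 | hx0
    · exact h0 (hx0 ▸ Multiset.mem_of_le hT'A hx)
    · exact hx'.1 hx0
    · exact hx'.2 hx0
    · refine h.sum_ne_two_nsmul hg hgG hgn (T := {x}) (by simpa using hT'G x hx) (by simp) ?_
        (by simpa using hx0)
      intro S hS hS0 _
      rcases Multiset.le_singleton.1 hS with h | h
      · exact absurd h hS0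
      · exact h
  have hwt : wt (ordWt 4) T' = wt (fun y => if y = 2 then 2 else 1) (T'.map (detHom g)) := by
    rw [wt_apply, wt_apply, Multiset.map_map]
    refine congrArg _ (Multiset.map_congr rfl fun x hx => ?_)
    have hD2 : 2 • x = 0 ↔ detHom g x = 2 := by
      constructor
      · intro hx2
        have : 2 • detHom g x = 0 := by rw [← map_nsmul, hx2, map_zero]
        have key : ∀ y : Fin 1 → ZMod 4, 2 • y = 0 → y ≠ 0 → y = 2 := by decide
        exact key _ this (hD0 x hx)
      · intro hx2
        have h22 : (2 : ℕ) • (2 : Fin 1 → ZMod 4) = 0 := by decide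
        have hx4 : 2 • 2 • x = 0 := by rw [← mul_nsmul]; exact h4 x
        rcases eq_of_detHom_four (x := 2 • x) hg2 (by rw [map_nsmul, hx2, h22]) with
          hx0 | hx0 | hx0 | hx0
        · exact hx0
        · exact absurd (by rw [← hx0, hx4]) hg2
        · rw [hx0, smul_neg, neg_eq_zero] at hx4
          exact absurd hx4 hg2
        · exfalso
          refine h.sum_ne_two_nsmul hg hgG hgn (T := {x, x}) (by simpa using hT'G x hx) (by simp)
            ?_ (by
              simpa only [Multiset.insert_eq_cons, Multiset.sum_cons, Multiset.sum_singleton,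
                two_nsmul] using hx0)
          intro S hS hS0 hSz
          by_contra hne
          have hlt : S.card < 2 := Multiset.card_lt_card (lt_of_le_of_ne hS hne)
          have hpos := Multiset.card_pos.2 hS0
          obtain ⟨y, rfl⟩ := Multiset.card_eq_one.1 (by omega : S.card = 1)
          have hy : y = x := by simpa using Multiset.mem_of_le hS (Multiset.mem_singleton_self y)
          rw [Multiset.sum_singleton, hy] at hSz
          exact hD0 x hx (hDg x hSz)
    have hx0 : x ≠ 0 := by
      rintro rfl
      exact hD0 0 hx (map_zero _)
    simp only [Function.comp_apply]
    split_ifs with hc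
    · exact ordWt_four_of_two hx0 (hD2.2 hc)
    · exact ordWt_four_of_ne (h4 x) fun h => hc (hD2.1 h)
  have hw := wt_cyclic_four hV (by
    intro hmem
    obtain ⟨x, hx, hx0⟩ := Multiset.mem_map.1 hmem
    exact hD0 x hx hx0)
  rw [← hwt] at hw
  rcases eq_of_detHom_four (x := T'.sum) hg2 (by rw [map_multiset_sum, hV.sum_eq]) with
    hs | hs | hs | hs
  · rw [← hA.eq_of_le hT'A hT'0 hs]
    omega
  · have := heven (-g ::ₘ T') (by rw [Multiset.sum_cons, hs, neg_add_cancel]) (by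
      simpa using ⟨hgn, hT'G⟩)
    rw [wt_cons, hwn] at this
    omega
  · have := heven (g ::ₘ T') (by rw [Multiset.sum_cons, hs, add_neg_cancel]) (by
      simpa using ⟨hgG, hT'G⟩)
    rw [wt_cons, hwg] at this
    omega
  · exact absurd hs (h.sum_ne_two_nsmul hg hgG hgn hT'G hT'0 hmin)

lemma not_qProp_four : ¬ QProp (Fin 2 → ZMod 4) 2 3 7 := by
  intro hQ
  have h4 : ∀ x : Fin 2 → ZMod 4, 4 • x = 0 := nsmul_pi_zmod 4 2
  obtain ⟨G₀, hU, hG₀⟩ := hQ.exists_uniform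
  by_cases hex : ∃ A₀ : Multiset (Fin 2 → ZMod 4), Atom A₀ ∧ (∀ g ∈ A₀, g ∈ G₀) ∧
      wt (ordWt 4) A₀ < 4
  · obtain ⟨A₀, hA₀, hA₀', hlt⟩ := hex
    obtain ⟨A, hA, hAG, hnd, hc, hord, -⟩ :=
      hU.exists_basis_atom (fun g _ => h4 g) (by norm_num) hA₀ hA₀' hlt
    obtain ⟨g, g', rfl⟩ := Multiset.card_eq_two.1 (by omega : A.card = 2)
    have hg' : g' = -g := by
      have := hA.sum_eq
      simp only [Multiset.insert_eq_cons, Multiset.sum_cons, Multiset.sum_singleton] at this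
      exact eq_neg_of_add_eq_zero_right this
    subst hg'
    have := hG₀ (ordWt 4) 2 4 fun B hB hBG => ⟨?_, hU.wt_le_four (hord g (by simp))
      (hAG g (by simp)) (hAG (-g) (by simp)) hB hBG⟩
    · omega
    · by_cases hlt' : wt (ordWt 4) B < 4
      · exact two_le_wt (by norm_num) hB (fun x _ => h4 x) hlt'
      · omega
  · push Not at hex
    by_cases hex2 : ∃ A : Multiset (Fin 2 → ZMod 4), Atom A ∧ (∀ g ∈ A, g ∈ G₀) ∧
        4 < wt (ordWt 4) A
    · rcases hU.lcn (n := 4) (s := 2) (by norm_num) (fun g _ => h4 g)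
        (fun p hp => card_torsion_pi_le hp) hex hex2 with h | h
      · omega
      · omega
    · push Not at hex2
      have := hG₀ (ordWt 4) 4 4 fun B hB hBG => ⟨hex B hB hBG, hex2 B hB hBG⟩
      omega

lemma coord_ne_of_pairing {f : (Fin 3 → ZMod 2) →+ G} {i j k : Fin 3}
    (hijk : i ≠ j ∧ j ≠ k ∧ i ≠ k) {a b c d e : G} (hi : f (Pi.single i 1) = a + b)
    (hj : f (Pi.single j 1) = c + d) (hk : f (Pi.single k 1) = e) {q : Fin 3 → ZMod 2}
    (hq : f q = a + c) (h1 : a + c ≠ 0) (h2 : b + d ≠ 0) (h3 : a + c + e ≠ 0)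
    (h4 : b + d + e ≠ 0) : q i ≠ q j := by
  intro hqij
  have hee : e + e = 0 := by
    rw [← hk, ← map_add, show (Pi.single k 1 + Pi.single k 1 : Fin 3 → ZMod 2) = 0 from ?_, map_zero]
    ext t
    exact CharTwo.add_self_eq_zero _
  have key : ∀ i j k : Fin 3, i ≠ j ∧ j ≠ k ∧ i ≠ k → ∀ q : Fin 3 → ZMod 2, q i = q j →
      q = 0 ∨ q = Pi.single k 1 ∨ q = Pi.single i 1 + Pi.single j 1 ∨
        q = Pi.single i 1 + Pi.single j 1 + Pi.single k 1 := by
    decide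
  rcases key i j k hijk q hqij with rfl | rfl | rfl | rfl
  · exact h1 (by rw [← hq, map_zero])
  · apply h3
    rw [← hq, hk, hee]
  · apply h2
    rw [map_add, hi, hj] at hq
    have : a + c + (b + d) = a + c := Eq.trans (by abel) hq
    exact left_eq_add.1 this.symm
  · apply h4
    rw [map_add, map_add, hi, hj, hk] at hq
    have : a + c + (b + d + e) = a + c := Eq.trans (by abel) hq
    exact left_eq_add.1 this.symm

lemma coord_ne_of_pairings {f : (Fin 3 → ZMod 2) →+ G} {i j k : Fin 3}
    (hf : ∀ y : G, 2 • y = 0 → ∃ q, f q = y)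
    (hijk : i ≠ j ∧ j ≠ k ∧ i ≠ k) {a b c d e : G} (hi : f (Pi.single i 1) = a + b)
    (hj : f (Pi.single j 1) = c + d) (hk : f (Pi.single k 1) = e) {u : Fin 3 → ZMod 2}
    (ha : f u = 2 • a) (hc : f u = 2 • c) (h1 : a + c ≠ 0) (h2 : b + d ≠ 0) (h3 : a + c + e ≠ 0)
    (h4 : b + d + e ≠ 0) (h1' : a + d ≠ 0) (h2' : b + c ≠ 0) (h3' : a + d + e ≠ 0)
    (h4' : b + c + e ≠ 0) : u i ≠ u j := by
  obtain ⟨q, hq⟩ := hf (a + c) (by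
    rw [nsmul_add, ← ha, ← hc, ← map_add, show u + u = 0 from ?_, map_zero]
    ext t
    exact CharTwo.add_self_eq_zero _)
  have e1 := coord_ne_of_pairing hijk hi hj hk hq h1 h2 h3 h4
  have e2 := coord_ne_of_pairing (q := Pi.single j 1 + q - u) hijk hi (by rw [hj, add_comm]) hk
    (by rw [map_sub, map_add, hj, hq, hc]; abel) h1' h2' h3' h4'
  simp only [Pi.sub_apply, Pi.add_apply, Pi.single_eq_same, Pi.single_eq_of_ne hijk.1,
    zero_add] at e2
  have key : ∀ x y u v : ZMod 2, x ≠ y → x - u ≠ 1 + y - v → u ≠ v := by decide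
  exact key _ _ _ _ e1 e2

lemma exists_zero_sum_of_six [Finite G] (hc : Nat.card {g : G // 2 • g = 0} ≤ 2 ^ 3)
    (x : Fin 6 → G) {u : G} (hx : ∀ i, 2 • x i = u) (h2u : 2 • u = 0) :
    ∃ I : Finset (Fin 6), I.Nonempty ∧ ∑ i ∈ I, x i = 0 := by
  by_contra! hN
  have hp : ∀ i j, 2 • (x i + x j) = 0 := by
    intro i j
    rw [nsmul_add, hx, hx, ← two_nsmul, h2u]
  obtain ⟨f, hf⟩ := exists_hom_pi (n := 2) ![x 0 + x 1, x 2 + x 3, x 4 + x 5] (by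
    intro i
    fin_cases i
    · exact hp 0 1
    · exact hp 2 3
    · exact hp 4 5)
  have hinj : Function.Injective f := by
    rw [injective_iff_map_eq_zero]
    intro c h0
    by_contra hc0
    have h01 : ∀ t : ZMod 2, t = 0 ∨ t = 1 := by decide
    have h1 : (1 : ZMod 2).val = 1 := rfl
    rw [hf] at h0
    have hN' := hN (Finset.univ.filter fun i : Fin 6 => c ⟨i / 2, by omega⟩ = 1) (by
      by_contra hne
      rw [Finset.not_nonempty_iff_eq_empty, Finset.filter_eq_empty_iff] at hne
      apply hc0
      ext i
      have := hne (Finset.mem_univ ⟨2 * i, by omega⟩)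
      simp only [Nat.mul_div_cancel_left _ (Nat.zero_lt_two)] at this
      simpa using (h01 (c i)).resolve_right this)
    apply hN'
    rw [Finset.sum_filter, Fin.sum_univ_six]
    rw [Fin.sum_univ_three] at h0
    refine Eq.trans ?_ h0
    simp only [Fin.isValue, Fin.coe_ofNat_eq_mod]
    norm_num
    rcases h01 (c 0) with h | h <;> rcases h01 (c 1) with h' | h' <;>
      rcases h01 (c 2) with h'' | h'' <;> simp [h, h', h'', h1] <;> abel
  have hsurj : ∀ y : G, 2 • y = 0 → ∃ q, f q = y := by
    intro y hy
    have hb := Function.Injective.bijective_of_nat_card_le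
      (f := fun q : Fin 3 → ZMod 2 => (⟨f q, by rw [← map_nsmul, nsmul_pi_zmod, map_zero]⟩ :
        {g : G // 2 • g = 0})) (fun q q' h => hinj (Subtype.ext_iff.1 h)) (by
        simpa using hc)
    obtain ⟨q, hq⟩ := hb.2 ⟨y, hy⟩
    exact ⟨q, Subtype.ext_iff.1 hq⟩
  obtain ⟨U, hU⟩ := hsurj u h2u
  have hs0 : f (Pi.single 0 1) = x 0 + x 1 := by
    rw [hf, Fin.sum_univ_three]
    simp [show (1 : ZMod 2).val = 1 from rfl]
  have hs1 : f (Pi.single 1 1) = x 2 + x 3 := by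
    rw [hf, Fin.sum_univ_three]
    simp [show (1 : ZMod 2).val = 1 from rfl]
  have hs2 : f (Pi.single 2 1) = x 4 + x 5 := by
    rw [hf, Fin.sum_univ_three]
    simp [show (1 : ZMod 2).val = 1 from rfl]
  have hx' : ∀ i, f U = 2 • x i := fun i => by rw [hU, hx]
  have n2 : ∀ i j : Fin 6, i ≠ j → x i + x j ≠ 0 := by
    intro i j hij
    have := hN {i, j} (by simp)
    rwa [Finset.sum_pair hij] at this
  have n4 : ∀ i j k l : Fin 6, i ≠ j ∧ i ≠ k ∧ i ≠ l ∧ j ≠ k ∧ j ≠ l ∧ k ≠ l →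
      x i + x j + (x k + x l) ≠ 0 := by
    rintro i j k l ⟨h1, h2, h3, h4, h5, h6⟩
    have := hN {i, j, k, l} (by simp)
    rw [Finset.sum_insert (by simp [h1, h2, h3]), Finset.sum_insert (by simp [h4, h5]),
      Finset.sum_pair h6] at this
    rwa [add_assoc]
  have h01 := coord_ne_of_pairings hsurj (by decide) hs0 hs1 hs2 (hx' 0) (hx' 2)
    (n2 _ _ (by decide)) (n2 _ _ (by decide)) (n4 _ _ _ _ (by decide)) (n4 _ _ _ _ (by decide))
    (n2 _ _ (by decide)) (n2 _ _ (by decide)) (n4 _ _ _ _ (by decide)) (n4 _ _ _ _ (by decide))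
  have h02 := coord_ne_of_pairings hsurj (by decide) hs0 hs2 hs1 (hx' 0) (hx' 4)
    (n2 _ _ (by decide)) (n2 _ _ (by decide)) (n4 _ _ _ _ (by decide)) (n4 _ _ _ _ (by decide))
    (n2 _ _ (by decide)) (n2 _ _ (by decide)) (n4 _ _ _ _ (by decide)) (n4 _ _ _ _ (by decide))
  have h12 := coord_ne_of_pairings hsurj (by decide) hs1 hs2 hs0 (hx' 2) (hx' 4)
    (n2 _ _ (by decide)) (n2 _ _ (by decide)) (n4 _ _ _ _ (by decide)) (n4 _ _ _ _ (by decide))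
    (n2 _ _ (by decide)) (n2 _ _ (by decide)) (n4 _ _ _ _ (by decide)) (n4 _ _ _ _ (by decide))
  have key : ∀ a b c : ZMod 2, a ≠ b → a ≠ c → b ≠ c → False := by decide
  exact key _ _ _ h01 h02 h12

lemma exists_zero_sum_le_of_six [Finite G] (hc : Nat.card {g : G // 2 • g = 0} ≤ 2 ^ 3)
    {S : Multiset G} (hS : S.card = 6) {u : G} (hx : ∀ x ∈ S, 2 • x = u) (h2u : 2 • u = 0) :
    ∃ T ≤ S, T ≠ 0 ∧ T.sum = 0 := by
  induction S using Quotient.inductionOn with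
  | _ l =>
    simp only [Multiset.quot_mk_to_coe, Multiset.coe_card] at hS hx ⊢
    have hmap : (Finset.univ : Finset (Fin l.length)).val.map l.get = (l : Multiset G) := by
      rw [Fin.univ_val_map, List.ofFn_get]
    obtain ⟨I, hI, hs⟩ := exists_zero_sum_of_six hc (fun i => l.get (Fin.cast hS.symm i))
      (fun i => hx _ (by simp)) h2u
    refine ⟨(I.map (finCongr hS.symm).toEmbedding).val.map l.get, ?_, ?_, ?_⟩
    · rw [← hmap]
      exact Multiset.map_le_map (Finset.val_le_iff.2 (Finset.subset_univ _))
    · simpa using hI.ne_empty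
    · rw [← hs]
      simp

lemma Atom.card_le_six [Finite G] (h4 : ∀ g : G, 4 • g = 0)
    (hc : Nat.card {g : G // 2 • g = 0} ≤ 2 ^ 3)
    (hu : ∀ x y : G, 2 • x ≠ 0 → 2 • y ≠ 0 → 2 • x = 2 • y) {A : Multiset G} (hA : Atom A) :
    A.card ≤ 6 := by
  classical
  by_contra! hcard
  have h22 : ∀ x : G, 2 • 2 • x = 0 := fun x => by rw [← mul_nsmul]; exact h4 x
  have hsplit := Multiset.filter_add_not (fun x : G => 2 • x = 0) A
  set I := A.filter fun x : G => 2 • x = 0 with hI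
  set M := A.filter fun x : G => ¬ 2 • x = 0 with hM
  have hIM : A.card = I.card + M.card := by rw [← hsplit, Multiset.card_add]
  have hIz : ∀ x ∈ I, 2 • x = 0 := fun x hx => (Multiset.mem_filter.1 hx).2
  have hMz : ∀ x ∈ M, 2 • x ≠ 0 := fun x hx => (Multiset.mem_filter.1 hx).2
  obtain ⟨B, hB, hB', hBc⟩ := exists_blocks (P := fun T : Multiset G => 2 • T.sum = 0) (c := 2) M
    fun S hS hSc => by
      obtain ⟨x, y, rfl⟩ := Multiset.card_eq_two.1 hSc
      refine ⟨_, le_rfl, by simp, ?_⟩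
      rw [Multiset.insert_eq_cons, Multiset.sum_cons, Multiset.sum_singleton, nsmul_add,
        hu x y (hMz x (Multiset.mem_of_le hS (by simp))) (hMz y (Multiset.mem_of_le hS (by simp))),
        ← two_nsmul, h22]
  have hblocks := hA.card_blocks_le (B := I.map (fun x => {x}) + B) Nat.prime_two hc (by
    rw [Multiset.sum_add, Multiset.sum_map_singleton, ← hsplit]
    exact add_le_add le_rfl hB) (by
    intro T hT
    rcases Multiset.mem_add.1 hT with hT | hT
    · obtain ⟨x, hx, rfl⟩ := Multiset.mem_map.1 hT
      exact ⟨by simp, by simpa using hIz x hx⟩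
    · exact hB' T hT)
  rw [Multiset.card_add, Multiset.card_map] at hblocks
  obtain ⟨x₀, hx₀⟩ : ∃ x, x ∈ M := Multiset.exists_mem_of_ne_zero (by
    intro h0
    rw [h0, Multiset.card_zero] at hIM
    omega)
  have hMu : ∀ x ∈ M, 2 • x = 2 • x₀ := fun x hx => hu x x₀ (hMz x hx) (hMz x₀ hx₀)
  have hsum : M.card • 2 • x₀ = 0 := by
    have h1 : ∀ N : Multiset G, (N.map fun x => 2 • x).sum = 2 • N.sum := fun N => by
      simpa using Multiset.sum_map_nsmul (m := N) (f := id) (n := 2)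
    have h2 : 2 • A.sum = 2 • I.sum + 2 • M.sum := by
      rw [← hsplit, Multiset.sum_add, nsmul_add]
    rw [hA.sum_eq, nsmul_zero, ← h1, ← h1, Multiset.map_congr rfl hMu,
      Multiset.map_congr rfl hIz] at h2
    simpa using h2.symm
  have heven : 2 ∣ M.card := by
    have : Fact (Nat.Prime 2) := ⟨Nat.prime_two⟩
    rw [← addOrderOf_eq_prime (h22 x₀) (hMz x₀ hx₀)]
    exact addOrderOf_dvd_iff_nsmul_eq_zero.2 hsum
  obtain ⟨S, hSM, hSc⟩ := exists_le_card_eq (M := M) (c := 6) (by omega)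
  obtain ⟨T, hTS, hT0, hTs⟩ := exists_zero_sum_le_of_six hc hSc
    (fun x hx => hMu x (Multiset.mem_of_le hSM hx)) (h22 x₀)
  have hTA := hA.eq_of_le (hTS.trans (hSM.trans (Multiset.filter_le _ _))) hT0 hTs
  have := Multiset.card_le_card hTS
  rw [hTA] at this
  omega

lemma embeds_four_two {x y : G} (h4 : ∀ g : G, 4 • g = 0) (hx : 2 • x ≠ 0) (hy : 2 • y ≠ 0)
    (hxy : 2 • x ≠ 2 • y) : Embeds 4 2 G := by
  have h22 : ∀ x : G, 2 • 2 • x = 0 := fun x => by rw [← mul_nsmul]; exact h4 x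
  refine embeds_of_indep ![x, y] (by simp [h4]) fun c hc h => ?_
  rw [Fin.sum_univ_two] at h
  have h' : c 0 • x + c 1 • y = 0 := h
  have h2 : c 0 • 2 • x + c 1 • 2 • y = 0 := by
    rw [smul_comm (c 0), smul_comm (c 1), ← nsmul_add, h', nsmul_zero]
  have hm : ∀ (k : ℕ) (z : G), k • 2 • z = (k % 2) • 2 • z := by
    intro k z
    conv_lhs => rw [← Nat.mod_add_div k 2, add_nsmul, mul_nsmul, h22, nsmul_zero, add_zero]
  rw [hm, hm (c 1)] at h2
  have he : c 0 % 2 = 0 ∧ c 1 % 2 = 0 := by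
    rcases Nat.mod_two_eq_zero_or_one (c 0) with h0 | h0 <;>
      rcases Nat.mod_two_eq_zero_or_one (c 1) with h1 | h1 <;>
      rw [h0, h1] at h2 <;> simp only [zero_nsmul, one_nsmul, zero_add, add_zero] at h2
    · exact ⟨h0, h1⟩
    · exact absurd h2 hy
    · exact absurd h2 hx
    · refine absurd ?_ hxy
      rw [eq_neg_of_add_eq_zero_left h2, neg_eq_iff_add_eq_zero, ← two_nsmul, h22]
  obtain ⟨⟨a, ha⟩, ⟨b, hb⟩⟩ := he.imp Nat.dvd_of_mod_eq_zero Nat.dvd_of_mod_eq_zero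
  rw [ha, hb, mul_comm 2 a, mul_comm 2 b, mul_nsmul', mul_nsmul'] at h'
  have ha2 : a < 2 := by have := hc 0; omega
  have hb2 : b < 2 := by have := hc 1; omega
  have hab : a = 0 ∧ b = 0 := by
    interval_cases a <;> interval_cases b <;>
      simp only [zero_nsmul, one_nsmul, zero_add, add_zero] at h'
    · exact ⟨rfl, rfl⟩
    · exact absurd h' hy
    · exact absurd h' hx
    · refine absurd ?_ hxy
      rw [eq_neg_of_add_eq_zero_left h', neg_eq_iff_add_eq_zero, ← two_nsmul, h22]
  intro i
  fin_cases i
  · exact ha.trans (by rw [hab.1])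
  · exact hb.trans (by rw [hab.2])

lemma card_torsion_le_one [Finite G] {p m : ℕ} (h : ∀ g : G, m • g = 0) (hpm : p.Coprime m) :
    Nat.card {g : G // p • g = 0} ≤ 1 := by
  rw [Finite.card_le_one_iff_subsingleton]
  refine ⟨fun x y => Subtype.ext ?_⟩
  have key : ∀ z : G, p • z = 0 → z = 0 := fun z hz => by
    have h1 := Nat.dvd_gcd (addOrderOf_dvd_iff_nsmul_eq_zero.2 hz)
      (addOrderOf_dvd_iff_nsmul_eq_zero.2 (h z))
    rw [hpm.gcd_eq_one, Nat.dvd_one, AddMonoid.addOrderOf_eq_one_iff] at h1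
    exact h1
  rw [key x.1 x.2, key y.1 y.2]

lemma equiv_four_two [Finite G] (hL : SystemSets G = SystemSets (Fin 2 → ZMod 4)) :
    Nonempty (G ≃+ (Fin 2 → ZMod 4)) := by
  have hnt := nontrivial_of_systemSets_eq (by norm_num) (by norm_num) hL
  have hord := order_le_of_systemSets_eq (by norm_num) (by norm_num) hL
  obtain ⟨A, hA, hAc⟩ := (embeds_pi 4 2).exists_atom (by norm_num) (by norm_num)
  obtain ⟨B, hB, hBc⟩ := atom_card_le_of_systemSets_eq hL.symm hA
  have hB7 : 7 ≤ B.card := by omega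
  have h2 : Nat.card {g : G // 2 • g = 0} ≤ 2 ^ 3 := by
    by_contra hc
    obtain ⟨hQ, hlt⟩ := qProp_of_lt_card (by norm_num) Nat.prime_two hc
    rcases (hQ.congr hL).cases_pi (by norm_num) hlt with h | h | h <;> omega
  have h3 : Nat.card {g : G // 3 • g = 0} ≤ 3 ^ 2 := by
    by_contra hc
    obtain ⟨hQ, hlt⟩ := qProp_of_lt_card (by norm_num) Nat.prime_three hc
    exact not_qProp_four (hQ.congr hL)
  obtain ⟨m, hm0, hm, x, hx⟩ := exists_exponent G
  have hm4 : m ≤ 4 := hx ▸ hord x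
  have hm' : (∀ g : G, 2 • g = 0) ∨ (∀ g : G, 3 • g = 0) ∨ ∀ g : G, 4 • g = 0 := by
    interval_cases m
    · exact .inl fun g => by rw [two_nsmul, ← one_nsmul g, hm, add_zero]
    · exact .inl hm
    · exact .inr (.inl hm)
    · exact .inr (.inr hm)
  rcases hm' with h | h | h
  · have := hB.card_le_of_torsion Nat.prime_two h2 fun g _ => h g
    omega
  · have := hB.card_le_of_torsion Nat.prime_three h3 fun g _ => h g
    omega
  · by_cases hu : ∀ x y : G, 2 • x ≠ 0 → 2 • y ≠ 0 → 2 • x = 2 • y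
    · have := hB.card_le_six h h2 hu
      omega
    · push Not at hu
      obtain ⟨x, y, hx, hy, hxy⟩ := hu
      exact equiv_of_embeds (by norm_num) (by norm_num) hL (embeds_four_two h hx hy hxy)

/-- `a` and `b` are independent elements of order `n`. -/
def Indep (n : ℕ) (a b : G) : Prop :=
  ∀ i j : ℕ, i < n → j < n → i • a + j • b = 0 → i = 0 ∧ j = 0

lemma Indep.symm {n : ℕ} {a b : G} (h : Indep n a b) : Indep n b a := fun i j hi hj hij =>
  (h j i hj hi (by rwa [add_comm])).symm

/-- `a`, `b`, `c` have sum zero and are pairwise independent of order `n`. -/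
structure Simplex (n : ℕ) (a b c : G) : Prop where
  sum_eq : a + b + c = 0
  ab : Indep n a b
  bc : Indep n b c
  ca : Indep n c a

namespace Simplex

variable {n : ℕ} {a b c x : G} {G₀ : Set G}

lemma rotate (h : Simplex n a b c) : Simplex n b c a :=
  ⟨by rw [← h.sum_eq]; abel, h.bc, h.ca, h.ab⟩

lemma swap (h : Simplex n a b c) : Simplex n b a c :=
  ⟨by rw [← h.sum_eq]; abel, h.ab.symm, h.ca.symm, h.bc.symm⟩

end Simplex

section

variable {n : ℕ} {a b c x : G} {G₀ : Set G}

lemma Indep.atom_cons (h : Indep n a b) {i j : ℕ} (hi : i < n) (hj : j < n)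
    (hx : x + i • a + j • b = 0) :
    Atom ({x} + (Multiset.replicate i a + Multiset.replicate j b)) := by
  have hfree : ∀ S ≤ Multiset.replicate i a + Multiset.replicate j b, S.sum = 0 → S = 0 := by
    intro S hS hs
    obtain ⟨S₁, S₂, rfl, h1, h2⟩ := exists_add_of_le_add hS
    obtain ⟨k, hk, rfl⟩ := Multiset.le_replicate_iff.1 h1
    obtain ⟨l, hl, rfl⟩ := Multiset.le_replicate_iff.1 h2
    rw [Multiset.sum_add, Multiset.sum_replicate, Multiset.sum_replicate] at hs
    obtain ⟨rfl, rfl⟩ := h k l (by omega) (by omega) hs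
    simp
  have hsum : ({x} + (Multiset.replicate i a + Multiset.replicate j b) : Multiset G).sum = 0 := by
    simpa [add_assoc] using hx
  refine atom_iff.2 ⟨hsum, by simp, fun B hB hB0 hBs => ?_⟩
  obtain ⟨X, S, rfl, hX, hS⟩ := exists_add_of_le_add hB
  rcases Multiset.le_singleton.1 hX with rfl | rfl
  · rw [zero_add] at hBs hB0
    exact absurd (hfree S hS hBs) hB0
  · obtain ⟨R, hR⟩ := Multiset.le_iff_exists_add.1 hS
    have : R = 0 := hfree R (hR ▸ Multiset.le_add_left _ _) (by
      rw [hR, ← add_assoc, Multiset.sum_add, hBs, zero_add] at hsum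
      exact hsum)
    rw [hR, this, add_zero]

lemma Indep.addOrderOf_eq (h : Indep n a b) (hn : 0 < n) (ha : n • a = 0) : addOrderOf a = n := by
  have hdvd := addOrderOf_dvd_iff_nsmul_eq_zero.2 ha
  refine (Nat.le_of_dvd hn hdvd).antisymm (not_lt.1 fun hlt => ?_)
  have := (h (addOrderOf a) 0 hlt hn (by simp)).1
  rw [this] at hdvd
  have := zero_dvd_iff.1 hdvd
  omega

lemma Simplex.modEq_one {d : ℕ} (h : Simplex n a b c) (hn : 1 < n) (hU : Uniform d G₀)
    (hc : n • c = 0) (ha' : a ∈ G₀) (hb' : b ∈ G₀) (hc' : c ∈ G₀) (hx' : x ∈ G₀) {α β : ℕ}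
    (hβ : 0 < β) (hβα : β ≤ α) (hα : α < n) (hx : x + α • a + β • b = 0) : 1 ≡ β [MOD d] := by
  have h1 := h.ab.atom_cons hα (by omega) hx
  obtain ⟨t, rfl⟩ := Nat.exists_eq_add_of_le hβα
  obtain ⟨s, hs⟩ := Nat.exists_eq_add_of_le (show β ≤ n by omega)
  have h2 : Atom ({x} + (Multiset.replicate t a + Multiset.replicate s c)) := by
    refine h.ca.symm.atom_cons (by omega) (by omega) ?_
    have e1 : β • (a + b + c) = 0 := by rw [h.sum_eq, nsmul_zero]
    have e2 : x + t • a + s • c + β • (a + b + c) =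
        (x + (β + t) • a + β • b) + (β + s) • c := by
      simp only [nsmul_add, add_nsmul]
      abel
    rw [e1, hx, ← hs, hc, add_zero, add_zero] at e2
    exact e2
  have h3 : Atom ({c} + (Multiset.replicate 1 a + Multiset.replicate 1 b)) :=
    h.ab.atom_cons hn hn (by rw [one_nsmul, one_nsmul, ← h.sum_eq]; abel)
  have h4 : Atom (Multiset.replicate n c) := by
    have := h.ca.addOrderOf_eq (by omega) hc
    have h5 := atom_replicate c (by omega)
    rwa [this] at h5
  have := hU {{x} + (Multiset.replicate (β + t) a + Multiset.replicate β b),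
      Multiset.replicate n c}
    (({x} + (Multiset.replicate t a + Multiset.replicate s c)) ::ₘ
      Multiset.replicate β ({c} + (Multiset.replicate 1 a + Multiset.replicate 1 b))) (by
      intro A hA
      simp only [Multiset.insert_eq_cons, Multiset.mem_cons, Multiset.mem_singleton] at hA
      rcases hA with rfl | rfl
      · exact h1
      · exact h4) (by
      intro A hA
      simp only [Multiset.mem_cons, Multiset.mem_replicate] at hA
      rcases hA with rfl | ⟨-, rfl⟩
      · exact h2
      · exact h3) (by
      rw [Multiset.insert_eq_cons, Multiset.sum_cons, Multiset.sum_singleton, Multiset.sum_cons,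
        Multiset.sum_replicate]
      rw [show Multiset.replicate n c = Multiset.replicate (β + s) c by rw [hs], Multiset.replicate_add]
      simp only [nsmul_add, ← Multiset.nsmul_singleton, add_nsmul, one_nsmul]
      abel) (by
      intro y hy
      simp only [Multiset.insert_eq_cons, Multiset.sum_cons, Multiset.sum_singleton,
        Multiset.mem_add, Multiset.mem_replicate, Multiset.mem_singleton] at hy
      rcases hy with (rfl | ⟨-, rfl⟩ | ⟨-, rfl⟩) | ⟨-, rfl⟩ <;> assumption)
  rw [Multiset.insert_eq_cons, Multiset.card_cons, Multiset.card_singleton, Multiset.card_cons,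
    Multiset.card_replicate] at this
  exact Nat.ModEq.add_right_cancel' 1 this

lemma ordWt_eq_one {e : G} (hn : 0 < n) (h : addOrderOf e = n) : ordWt n e = 1 := by
  rw [ordWt, h, Nat.div_self hn]

lemma Simplex.wt_modEq {d : ℕ} (h : Simplex n a b c) (hn : 0 < n) (hU : Uniform d G₀)
    (hG : ∀ g : G, n • g = 0) (ha' : a ∈ G₀) (hb' : b ∈ G₀) (hx' : x ∈ G₀) {α β : ℕ}
    (hα : α < n) (hβ : β < n) (hx : x + α • a + β • b = 0) :
    ordWt n x + α + β ≡ n [MOD d] := by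
  have := hU.wt_modEq hn (fun g _ => hG g) (h.ab.atom_cons hα hβ hx) (by
    intro y hy
    simp only [Multiset.mem_add, Multiset.mem_replicate, Multiset.mem_singleton] at hy
    rcases hy with rfl | ⟨-, rfl⟩ | ⟨-, rfl⟩ <;> assumption)
  rwa [map_add, map_add, wt_singleton, wt_replicate, wt_replicate,
    ordWt_eq_one hn (h.ab.addOrderOf_eq hn (hG a)),
    ordWt_eq_one hn (h.bc.addOrderOf_eq hn (hG b)), mul_one, mul_one, ← add_assoc] at this

lemma Simplex.eq_of_multiple (h : Simplex n a b c) (hn : n = 5 ∨ n = 6)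
    (hU : Uniform (n - 3) G₀) (hG : ∀ g : G, n • g = 0) (ha' : a ∈ G₀) (hb' : b ∈ G₀)
    (hc' : c ∈ G₀) (hx' : x ∈ G₀) {γ : ℕ} (hγ : 0 < γ) (hγn : γ < n) (hx : x = γ • c) :
    γ = 1 := by
  have hordc := h.ca.addOrderOf_eq (by omega) (hG c)
  have h1 := h.modEq_one (by omega) hU (hG c) ha' hb' hc' hx' hγ le_rfl hγn (by
    rw [hx, show γ • c + γ • a + γ • b = γ • (a + b + c) by simp only [nsmul_add]; abel, h.sum_eq,
      nsmul_zero])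
  by_contra hne
  rcases hn with rfl | rfl
  · have hγ3 : γ = 3 := by
      unfold Nat.ModEq at h1
      omega
    subst hγ3
    have hA : Atom (Multiset.replicate 3 x + Multiset.replicate 1 c) := by
      refine atom_iff.2 ⟨?_, by simp, fun B hB hB0 hBs => ?_⟩
      · rw [Multiset.sum_add, Multiset.sum_replicate, Multiset.sum_replicate, hx, ← mul_nsmul,
          ← add_nsmul, ← addOrderOf_dvd_iff_nsmul_eq_zero, hordc]
        norm_num
      · obtain ⟨S₁, S₂, rfl, h1, h2⟩ := exists_add_of_le_add hB
        obtain ⟨k, hk, rfl⟩ := Multiset.le_replicate_iff.1 h1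
        obtain ⟨l, hl, rfl⟩ := Multiset.le_replicate_iff.1 h2
        rw [Multiset.sum_add, Multiset.sum_replicate, Multiset.sum_replicate, hx, ← mul_nsmul,
          ← add_nsmul, ← addOrderOf_dvd_iff_nsmul_eq_zero, hordc] at hBs
        have hkl : k = 0 ∧ l = 0 ∨ k = 3 ∧ l = 1 := by
          interval_cases k <;> interval_cases l <;> simp_all
        rcases hkl with ⟨rfl, rfl⟩ | ⟨rfl, rfl⟩
        · simp at hB0
        · rfl
    have hx5 : addOrderOf x = 5 := by
      have : Fact (Nat.Prime 5) := ⟨by norm_num⟩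
      refine addOrderOf_eq_prime (hG x) ?_
      rw [hx, Ne, ← addOrderOf_dvd_iff_nsmul_eq_zero, hordc]
      norm_num
    have := hU.wt_modEq (n := 5) (by norm_num) (fun g _ => hG g) hA (by
      intro y hy
      simp only [Multiset.mem_add, Multiset.mem_replicate] at hy
      rcases hy with ⟨-, rfl⟩ | ⟨-, rfl⟩ <;> assumption)
    rw [map_add, wt_replicate, wt_replicate, ordWt_eq_one (by norm_num) hx5,
      ordWt_eq_one (by norm_num) hordc] at this
    revert this
    decide
  · have hγ4 : γ = 4 := by
      unfold Nat.ModEq at h1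
      omega
    subst hγ4
    have hx3 : addOrderOf x = 3 := by
      have : Fact (Nat.Prime 3) := ⟨by norm_num⟩
      refine addOrderOf_eq_prime ?_ ?_
      · rw [hx, ← mul_nsmul, ← addOrderOf_dvd_iff_nsmul_eq_zero, hordc]
        norm_num
      · rw [hx, Ne, ← addOrderOf_dvd_iff_nsmul_eq_zero, hordc]
        norm_num
    have := h.rotate.rotate.wt_modEq (by norm_num) hU hG hc' ha' hx' (α := 2) (β := 0)
      (by norm_num) (by norm_num) (by
        rw [hx, ← add_nsmul, zero_nsmul, add_zero, ← addOrderOf_dvd_iff_nsmul_eq_zero, hordc])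
    rw [ordWt, hx3] at this
    revert this
    decide

lemma Simplex.mem_of_le (h : Simplex n a b c) (hn : n = 5 ∨ n = 6)
    (hU : Uniform (n - 3) G₀) (hG : ∀ g : G, n • g = 0) (ha' : a ∈ G₀) (hb' : b ∈ G₀)
    (hc' : c ∈ G₀) (hx' : x ∈ G₀) (hx0 : x ≠ 0) {α β : ℕ} (hβα : β ≤ α) (hα : α < n)
    (hx : x + α • a + β • b = 0) : x = a ∨ x = b ∨ x = c := by
  have hneg : ∀ (k : ℕ) (e : G), k ≤ n → k • e + (n - k) • e = 0 := fun k e hk => by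
    rw [← add_nsmul, Nat.add_sub_cancel' hk, hG]
  rcases Nat.eq_zero_or_pos β with rfl | hβ
  · rw [zero_nsmul, add_zero] at hx
    have hα0 : 0 < α := Nat.pos_of_ne_zero (by
      rintro rfl
      rw [zero_nsmul, add_zero] at hx
      exact hx0 hx)
    have hxa : x = (n - α) • a := by
      rw [eq_neg_of_add_eq_zero_left hx, ← eq_neg_of_add_eq_zero_right (hneg α a hα.le)]
    have := h.rotate.eq_of_multiple hn hU hG hb' hc' ha' hx' (by omega) (by omega) hxa
    rw [this, one_nsmul] at hxa
    exact .inl hxa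
  rcases hβα.eq_or_lt with rfl | hlt
  · have hxc : x = β • c := by
      have e : β • (a + b + c) = 0 := by rw [h.sum_eq, nsmul_zero]
      rw [nsmul_add, nsmul_add] at e
      rw [add_assoc] at hx
      rw [eq_neg_of_add_eq_zero_left hx, ← eq_neg_of_add_eq_zero_right e]
    have := h.eq_of_multiple hn hU hG ha' hb' hc' hx' hβ hα hxc
    rw [this, one_nsmul] at hxc
    exact .inr (.inr hxc)
  exfalso
  have h1 := h.modEq_one (by omega) hU (hG c) ha' hb' hc' hx' hβ hβα hα hx
  have h2 := h.rotate.rotate.modEq_one (α := n - β) (β := α - β) (by omega) hU (hG b) hc' ha' hb'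
    hx' (by omega) (by omega) (by omega) (by
      obtain ⟨t, rfl⟩ := Nat.exists_eq_add_of_le hβα
      have e1 : β • (a + b + c) = 0 := by rw [h.sum_eq, nsmul_zero]
      have e2 : x + (n - β) • c + t • a + β • (a + b + c) =
          (x + (β + t) • a + β • b) + (β • c + (n - β) • c) := by
        simp only [nsmul_add, add_nsmul]
        abel
      rw [e1, hx, hneg β c (by omega), add_zero, add_zero] at e2
      rw [Nat.add_sub_cancel_left]
      exact e2)
  have h3 := h.wt_modEq (by omega) hU hG ha' hb' hx' hα (by omega) hx
  have hdvd := addOrderOf_dvd_iff_nsmul_eq_zero.2 (hG x)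
  have hne1 : addOrderOf x ≠ 1 := by rwa [Ne, AddMonoid.addOrderOf_eq_one_iff]
  unfold Nat.ModEq at h1 h2 h3
  rcases hn with rfl | rfl
  · rw [ordWt, (Nat.dvd_prime (by norm_num)).1 hdvd |>.resolve_left hne1] at h3
    omega
  · have hle := Nat.le_of_dvd (by norm_num) hdvd
    have h2x : addOrderOf x = 2 := by
      rw [ordWt] at h3
      generalize addOrderOf x = o at *
      interval_cases o <;> omega
    have hxx : 2 • x = 0 := by rw [← h2x, addOrderOf_nsmul_eq_zero]
    have e : (2 * α) • a + (2 * β) • b = 0 := by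
      have := congrArg (fun y => 2 • y) hx
      simp only [nsmul_add, nsmul_zero, hxx, zero_add] at this
      rwa [mul_comm 2 α, mul_comm 2 β, mul_nsmul, mul_nsmul]
    have hm : ∀ (k : ℕ) (z : G), k • z = (k % 6) • z := by
      intro k z
      conv_lhs => rw [← Nat.mod_add_div k 6, add_nsmul, mul_nsmul, hG, nsmul_zero, add_zero]
    rw [hm, hm (2 * β)] at e
    have := h.ab _ _ (Nat.mod_lt _ (by norm_num)) (Nat.mod_lt _ (by norm_num)) e
    omega

end

lemma exists_coord {n : ℕ} [NeZero n] {a b : Fin 2 → ZMod n} (h : Indep n a b)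
    (y : Fin 2 → ZMod n) : ∃ i j : ℕ, i < n ∧ j < n ∧ y = i • a + j • b := by
  obtain ⟨f, hf⟩ := exists_hom_pi (n := n) ![a, b] fun i => nsmul_pi_zmod _ _ _
  have hinj : Function.Injective f := by
    rw [injective_iff_map_eq_zero]
    intro c hc
    rw [hf, Fin.sum_univ_two] at hc
    have := h _ _ (ZMod.val_lt (c 0)) (ZMod.val_lt (c 1)) hc
    ext i
    fin_cases i
    · simpa using this.1
    · simpa using this.2
  obtain ⟨c, rfl⟩ := Finite.injective_iff_surjective.1 hinj y
  exact ⟨_, _, ZMod.val_lt (c 0), ZMod.val_lt (c 1), by rw [hf, Fin.sum_univ_two]; rfl⟩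

lemma indep_of_atoms {n : ℕ} {a b c : G} (hab : a ≠ b) (hac : a ≠ c) (hbc : b ≠ c)
    (hn : 0 < n)
    (h : ∀ U : Multiset G, Atom U → (∀ g ∈ U, g ∈ ({a, b, c} : Multiset G)) →
      U = {a, b, c} ∨ ∃ g ∈ ({a, b, c} : Multiset G), U = Multiset.replicate n g) :
    Indep n a b := by
  classical
  intro i j hi hj hij
  by_contra hne
  obtain ⟨U, hU, hUA⟩ := exists_atom_le (B := Multiset.replicate i a + Multiset.replicate j b)
    (by rw [Multiset.sum_add, Multiset.sum_replicate, Multiset.sum_replicate, hij]) (by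
      intro h0
      have := congrArg Multiset.card h0
      simp only [Multiset.card_add, Multiset.card_replicate, Multiset.card_zero] at this
      omega)
  have hmem : ∀ g ∈ U, g = a ∨ g = b := by
    intro g hg
    have := Multiset.mem_of_le hU hg
    simp only [Multiset.mem_add, Multiset.mem_replicate] at this
    tauto
  rcases h U hUA (fun g hg => by rcases hmem g hg with rfl | rfl <;> simp) with rfl | ⟨g, -, rfl⟩
  · rcases hmem c (by simp) with h | h
    · exact hac h.symm
    · exact hbc h.symm
  · have hle := Multiset.count_le_of_le g hU
    rcases hmem g (Multiset.mem_replicate.2 ⟨by omega, rfl⟩) with rfl | rfl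
    · simp [Multiset.count_replicate, hab.symm] at hle
      omega
    · simp [Multiset.count_replicate, hab] at hle
      omega

lemma not_qProp_five_six {n p : ℕ} (hn : n = 5 ∨ n = 6) {b : ℕ} (hpb : p * n < b * 3) :
    ¬ QProp (Fin 2 → ZMod n) (n - 3) p b := by
  intro hQ
  have : NeZero n := ⟨by omega⟩
  have hG : ∀ g : Fin 2 → ZMod n, n • g = 0 := nsmul_pi_zmod n 2
  obtain ⟨G₀, hU, hG₀⟩ := hQ.exists_uniform
  by_cases hex : ∃ A₀ : Multiset (Fin 2 → ZMod n), Atom A₀ ∧ (∀ g ∈ A₀, g ∈ G₀) ∧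
      wt (ordWt n) A₀ < n
  · obtain ⟨A₀, hA₀, hA₀', hlt⟩ := hex
    obtain ⟨A, hA, hAG, hnd, hc, hord, hat⟩ :=
      hU.exists_basis_atom (fun g _ => hG g) (by omega) hA₀ hA₀' hlt
    obtain ⟨a, b, c, rfl⟩ := Multiset.card_eq_three.1 (by omega : A.card = 3)
    simp only [Multiset.insert_eq_cons, Multiset.nodup_cons, Multiset.mem_cons,
      Multiset.mem_singleton, not_or, Multiset.nodup_singleton, and_true] at hnd
    obtain ⟨⟨hab, hac⟩, hbc⟩ := hnd
    have e1 : ({b, c, a} : Multiset (Fin 2 → ZMod n)) = {a, b, c} := by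
      simp only [Multiset.insert_eq_cons, ← Multiset.singleton_add]
      abel
    have e2 : ({c, a, b} : Multiset (Fin 2 → ZMod n)) = {a, b, c} := by
      simp only [Multiset.insert_eq_cons, ← Multiset.singleton_add]
      abel
    have hS : Simplex n a b c := by
      refine ⟨?_, indep_of_atoms hab hac hbc (by omega) hat,
        indep_of_atoms hbc (Ne.symm hab) (Ne.symm hac) (by omega) (by rwa [e1]),
        indep_of_atoms (Ne.symm hac) (Ne.symm hbc) hab (by omega) (by rwa [e2])⟩
      simpa [add_assoc] using hA.sum_eq
    have ha' := hAG a (by simp)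
    have hb' := hAG b (by simp)
    have hc' := hAG c (by simp)
    have hmem : ∀ x ∈ G₀, x ≠ 0 → x = a ∨ x = b ∨ x = c := by
      intro x hx hx0
      obtain ⟨i, j, hi, hj, hij⟩ := exists_coord hS.ab (-x)
      have hij' : x + i • a + j • b = 0 := by rw [add_assoc, ← hij, add_neg_cancel]
      rcases le_total j i with hle | hle
      · exact hS.mem_of_le hn hU hG ha' hb' hc' hx hx0 hle hi hij'
      · have := hS.swap.mem_of_le hn hU hG hb' ha' hc' hx hx0 hle hj (by
          rw [← hij']; abel)
        tauto
    have := hG₀ (ordWt n) 3 n fun B hB hBG => by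
      by_cases h0 : (0 : Fin 2 → ZMod n) ∈ B
      · rw [hB.eq_zero_of_mem h0, wt_ordWt_eq_of_zero]
        omega
      have hone : ∀ g ∈ ({a, b, c} : Multiset (Fin 2 → ZMod n)), ordWt n g = 1 := fun g hg =>
        ordWt_eq_one (by omega) (hord g hg)
      rcases hat B hB (fun g hg => by
        rcases hmem g (hBG g hg) (by rintro rfl; exact h0 hg) with rfl | rfl | rfl <;> simp) with
        rfl | ⟨g, hg, rfl⟩
      · have := hone a (by simp)
        have := hone b (by simp)
        have := hone c (by simp)
        simp only [Multiset.insert_eq_cons, wt_cons, wt_singleton]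
        omega
      · rw [wt_replicate, hone g hg, mul_one]
        omega
    omega
  · push Not at hex
    by_cases hex2 : ∃ A : Multiset (Fin 2 → ZMod n), Atom A ∧ (∀ g ∈ A, g ∈ G₀) ∧
        n < wt (ordWt n) A
    · rcases hU.lcn (n := n) (s := 2) (by omega) (fun g _ => hG g)
        (fun p hp => card_torsion_pi_le hp) hex hex2 with h | ⟨h, A, hA, -, hAw⟩
      · omega
      · have : n = 5 := by omega
        subst this
        have := wt_pi_prime_le (by norm_num) hA
        norm_num at this hAw
        omega
    · push Not at hex2
      have := hG₀ (ordWt n) n n fun B hB hBG => ⟨hex B hB hBG, hex2 B hB hBG⟩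
      have := Nat.le_of_mul_le_mul_right this (by omega)
      rcases hn with rfl | rfl <;> omega

lemma not_qProp_of_lt_card [Finite G] {n p s : ℕ} (hn : n = 5 ∨ n = 6) (hs : s + 3 = n)
    (hL : SystemSets G = SystemSets (Fin 2 → ZMod n)) (hp : p.Prime) :
    Nat.card {g : G // p • g = 0} ≤ p ^ s := by
  by_contra hc
  obtain ⟨hQ, -⟩ := qProp_of_lt_card (by omega) hp hc
  have hp2 := hp.two_le
  obtain rfl : s = n - 3 := by omega
  refine not_qProp_five_six hn ?_ (hQ.congr hL)
  obtain ⟨q, rfl⟩ : ∃ q, p = q + 2 := ⟨p - 2, by omega⟩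
  rcases hn with rfl | rfl <;> norm_num <;> ring_nf <;> omega

lemma equiv_five_two [Finite G] (hL : SystemSets G = SystemSets (Fin 2 → ZMod 5)) :
    Nonempty (G ≃+ (Fin 2 → ZMod 5)) := by
  have hnt := nontrivial_of_systemSets_eq (by norm_num) (by norm_num) hL
  have h5 : ∀ g : G, 5 • g = 0 :=
    exponent_eq (s := 2) (by norm_num) (by norm_num) (by norm_num) (by norm_num) hL
      fun p hp => not_qProp_of_lt_card (.inl rfl) rfl hL hp
  refine equiv_of_embeds (by norm_num) (by norm_num) hL ?_
  by_cases hc : Nat.card {g : G // 5 • g = 0} ≤ 5 ^ 1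
  · have hs : ∀ p : ℕ, p.Prime → Nat.card {g : G // p • g = 0} ≤ p ^ 1 := by
      intro p hp
      by_cases hp5 : p = 5
      · exact hp5 ▸ hc
      · refine (card_torsion_le_one h5 ((Nat.coprime_primes hp (by norm_num)).2 hp5)).trans ?_
        exact Nat.one_le_pow _ _ hp.pos
    have hQ : QProp G 2 3 5 :=
      ((embeds_pi 5 2).qProp_basis (by norm_num) (by norm_num)).congr hL.symm
    rcases hQ.cases (by norm_num) h5 (by norm_num) hs with h | h | h
    · exact h.2 (by norm_num)
    · omega
    · omega
  · exact embeds_of_lt_card (by norm_num) hc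

lemma Atom.exists_card_le_of_mul [Finite G] {p q s : ℕ} (hp : p.Prime) (hq : q.Prime)
    (hG : ∀ g : G, (p * q) • g = 0) (hcp : Nat.card {g : G // p • g = 0} ≤ p ^ 1)
    (hcq : Nat.card {g : G // q • g = 0} ≤ q ^ s) [DecidableEq G] {A : Multiset G} (hA : Atom A) :
    ∃ b, (A.filter fun x => q • x = 0).card + b ≤ s * (q - 1) + 1 ∧
      A.card < (A.filter fun x => q • x = 0).card + (p + p * b) ∧
      (A.filter fun x => p • x = 0).card ≤ p := by
  have hp2 := hp.two_le
  have hsplit := Multiset.filter_add_not (fun x : G => q • x = 0) A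
  set I := A.filter fun x : G => q • x = 0 with hI
  set M := A.filter fun x : G => ¬ q • x = 0 with hM
  have hIM : A.card = I.card + M.card := by rw [← hsplit, Multiset.card_add]
  have hIz : ∀ x ∈ I, q • x = 0 := fun x hx => (Multiset.mem_filter.1 hx).2
  obtain ⟨B, hB, hB', hBc⟩ := exists_blocks (P := fun T : Multiset G => q • T.sum = 0) (c := p) M
    fun S hS hSc => by
      obtain ⟨T', hT', hT0, hTs⟩ := exists_zero_sum_sub hp hcp (S := S.map fun x => q • x) (by
        intro g hg
        obtain ⟨x, -, rfl⟩ := Multiset.mem_map.1 hg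
        rw [← mul_nsmul', hG]) (by
        rw [Multiset.card_map]
        omega)
      obtain ⟨T, hT, rfl⟩ := exists_le_map hT'
      refine ⟨T, hT, fun h => hT0 (by rw [h, Multiset.map_zero]), ?_⟩
      rw [← hTs]
      simpa using (Multiset.sum_map_nsmul (m := T) (f := id) (n := q)).symm
  have hblocks := hA.card_blocks_le (B := I.map (fun x => {x}) + B) hq hcq (by
    rw [Multiset.sum_add, Multiset.sum_map_singleton, ← hsplit]
    exact add_le_add le_rfl hB) (by
    intro T hT
    rcases Multiset.mem_add.1 hT with hT | hT
    · obtain ⟨x, hx, rfl⟩ := Multiset.mem_map.1 hT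
      exact ⟨by simp, by simpa using hIz x hx⟩
    · exact hB' T hT)
  rw [Multiset.card_add, Multiset.card_map] at hblocks
  refine ⟨B.card, hblocks, by omega, ?_⟩
  have hbp := hA.card_blocks_le (B := (A.filter fun x : G => p • x = 0).map fun x => {x}) hp hcp
    (by
      rw [Multiset.sum_map_singleton]
      exact Multiset.filter_le _ _) (by
      intro T hT
      obtain ⟨x, hx, rfl⟩ := Multiset.mem_map.1 hT
      exact ⟨by simp, by simpa using (Multiset.mem_filter.1 hx).2⟩)
  rw [Multiset.card_map] at hbp
  omega

lemma ordWt_six_le {x : G} (h6 : 6 • x = 0) (h0 : x ≠ 0) [DecidableEq G] :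
    ordWt 6 x ≤ 1 + (if 3 • x = 0 then 1 else 0) + 2 * (if 2 • x = 0 then 1 else 0) := by
  have h1 : addOrderOf x ≠ 1 := by rwa [Ne, AddMonoid.addOrderOf_eq_one_iff]
  have hd := addOrderOf_dvd_iff_nsmul_eq_zero.2 h6
  have hle := Nat.le_of_dvd (by norm_num) hd
  have hpos := Nat.pos_of_dvd_of_pos hd (by norm_num)
  simp only [ordWt, ← addOrderOf_dvd_iff_nsmul_eq_zero]
  generalize addOrderOf x = m at *
  interval_cases m <;> simp_all

lemma wt_six_le (h6 : ∀ g : G, 6 • g = 0) [DecidableEq G] {A : Multiset G} (h0 : (0 : G) ∉ A) :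
    wt (ordWt 6) A ≤ A.card + (A.filter fun x => 3 • x = 0).card +
      2 * (A.filter fun x => 2 • x = 0).card := by
  induction A using Multiset.induction_on with
  | empty => simp
  | cons x A ih =>
    rw [Multiset.mem_cons, not_or] at h0
    have h1 := ordWt_six_le (h6 x) (Ne.symm h0.1)
    have h2 := ih h0.2
    rw [← Multiset.singleton_add, map_add, wt_singleton, Multiset.singleton_add,
      Multiset.filter_cons, Multiset.filter_cons, Multiset.card_cons, Multiset.card_add,
      Multiset.card_add]
    split_ifs at h1 ⊢ <;> simp <;> omega

lemma Embeds.mul_coprime {m n k : ℕ} [NeZero m] [NeZero n] (hmn : m.Coprime n)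
    (hm : Embeds m k G) (hn : Embeds n k G) : Embeds (m * n) k G := by
  obtain ⟨f, hf⟩ := hm
  obtain ⟨g, hg⟩ := hn
  have hm0 := NeZero.pos m
  have hn0 := NeZero.pos n
  have hfm : ∀ x, m • f x = 0 := fun x => by rw [← map_nsmul, nsmul_pi_zmod, map_zero]
  have hgn : ∀ x, n • g x = 0 := fun x => by rw [← map_nsmul, nsmul_pi_zmod, map_zero]
  have : NeZero (m * n) := ⟨(Nat.mul_pos hm0 hn0).ne'⟩
  refine embeds_of_indep (fun i => f (Pi.single i 1) + g (Pi.single i 1)) (fun i => ?_)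
    fun c hc h => ?_
  · rw [nsmul_add, mul_nsmul, hfm, nsmul_zero, mul_nsmul', hgn, nsmul_zero, add_zero]
  · have hsum : ∀ l : ℕ, (Finset.univ.sum fun i => c i • (Pi.single i 1 : Fin k → ZMod l)) =
        fun i => (c i : ZMod l) := by
      intro l
      ext j
      simp [Finset.sum_apply, Pi.single_apply]
    have h1 : f (fun i => (c i : ZMod m)) + g (fun i => (c i : ZMod n)) = 0 := by
      rw [← hsum, ← hsum, map_sum, map_sum, ← h, ← Finset.sum_add_distrib]
      simp only [map_nsmul, nsmul_add]
    have hf0 : f (fun i => (c i : ZMod m)) = 0 := by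
      have h2 := eq_neg_of_add_eq_zero_left h1
      have h3 : n • f (fun i => (c i : ZMod m)) = 0 := by rw [h2, smul_neg, hgn, neg_zero]
      have h4 := Nat.dvd_gcd (addOrderOf_dvd_iff_nsmul_eq_zero.2 (hfm _))
        (addOrderOf_dvd_iff_nsmul_eq_zero.2 h3)
      rw [hmn.gcd_eq_one, Nat.dvd_one, AddMonoid.addOrderOf_eq_one_iff] at h4
      exact h4
    have hg0 : g (fun i => (c i : ZMod n)) = 0 := by rwa [hf0, zero_add] at h1
    intro i
    have e1 := congrFun ((injective_iff_map_eq_zero f).1 hf _ hf0) i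
    have e2 := congrFun ((injective_iff_map_eq_zero g).1 hg _ hg0) i
    simp only [Pi.zero_apply, ZMod.natCast_eq_zero_iff] at e1 e2
    exact Nat.eq_zero_of_dvd_of_lt (hmn.mul_dvd_of_dvd_of_dvd e1 e2) (hc i)

lemma Atom.wt_six_lt [Finite G] (h6 : ∀ g : G, 6 • g = 0)
    (hs : ∀ p : ℕ, p.Prime → Nat.card {g : G // p • g = 0} ≤ p ^ 3)
    (h : Nat.card {g : G // 2 • g = 0} ≤ 2 ^ 1 ∨ Nat.card {g : G // 3 • g = 0} ≤ 3 ^ 1)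
    {A : Multiset G} (hA : Atom A) : wt (ordWt 6) A < 24 := by
  classical
  by_cases h0 : (0 : G) ∈ A
  · have : ({0} : Multiset G) = A :=
      hA.eq_of_le (Multiset.singleton_le.2 h0) (by simp) (by simp)
    rw [← this, wt_ordWt_eq_of_zero]
    norm_num
  · have hw := wt_six_le h6 h0
    rcases h with h | h
    · obtain ⟨b, h1, h2, h3⟩ := hA.exists_card_le_of_mul Nat.prime_two Nat.prime_three h6 h
        (hs 3 Nat.prime_three)
      omega
    · obtain ⟨b, h1, h2, h3⟩ := hA.exists_card_le_of_mul Nat.prime_three Nat.prime_two h6 h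
        (hs 2 Nat.prime_two)
      omega

lemma equiv_six_two [Finite G] (hL : SystemSets G = SystemSets (Fin 2 → ZMod 6)) :
    Nonempty (G ≃+ (Fin 2 → ZMod 6)) := by
  have hnt := nontrivial_of_systemSets_eq (by norm_num) (by norm_num) hL
  have hs : ∀ p : ℕ, p.Prime → Nat.card {g : G // p • g = 0} ≤ p ^ 3 :=
    fun p hp => not_qProp_of_lt_card (.inr rfl) rfl hL hp
  have h6 : ∀ g : G, 6 • g = 0 :=
    exponent_eq (s := 3) (by norm_num) (by norm_num) (by norm_num) (by norm_num) hL hs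
  refine equiv_of_embeds (by norm_num) (by norm_num) hL ?_
  have hQ : QProp G 3 3 6 :=
    ((embeds_pi 6 2).qProp_basis (by norm_num) (by norm_num)).congr hL.symm
  rcases hQ.cases (by norm_num) h6 (by norm_num) hs with h | h | ⟨-, A, hA, hw⟩
  · exact h.2 (by norm_num)
  · omega
  · by_contra hE
    refine absurd (hA.wt_six_lt h6 hs ?_) (by omega)
    by_contra! hlt
    exact hE (Embeds.mul_coprime (m := 2) (n := 3) (by norm_num)
      (embeds_of_lt_card Nat.prime_two hlt.1.not_ge)
      (embeds_of_lt_card Nat.prime_three hlt.2.not_ge))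

end ZeroSum

theorem stmt_18 (n r : ℕ) (hn : 2 ≤ n) (hr : 1 ≤ r)
    (hne : (n, r) ∉ ({(2, 1), (2, 2), (3, 1)} : Set (ℕ × ℕ)))
    (hbound : (r : ℚ) ≤ max 2 (((n : ℚ) + 2) / 6))
    (G : Type*) [AddCommGroup G] [Fintype G]
    (hL : SystemSets G = SystemSets (Fin r → ZMod n)) :
    Nonempty (G ≃+ (Fin r → ZMod n)) := by
  have hb : r ≤ 2 ∨ 6 * r ≤ n + 2 := by
    rcases le_max_iff.1 hbound with h | h
    · exact .inl (by exact_mod_cast h)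
    · rw [le_div_iff₀ (by norm_num)] at h
      have h' : r * 6 ≤ n + 2 := by exact_mod_cast h
      omega
  simp only [Set.mem_insert_iff, Set.mem_singleton_iff, Prod.mk.injEq, not_or, not_and] at hne
  obtain ⟨h1, h2, h3⟩ := hne
  by_cases hlarge : r = 1 ∧ 5 ≤ n ∨ r = 2 ∧ 8 ≤ n ∨ 3 ≤ r ∧ 6 * r ≤ n + 2
  · exact ZeroSum.equiv_of_large (by omega) hr hlarge hL
  · have hsmall : r = 1 ∧ n = 4 ∨ r = 2 ∧ 3 ≤ n ∧ n ≤ 7 := by omega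
    rcases hsmall with ⟨rfl, rfl⟩ | ⟨rfl, hn3, hn7⟩
    · exact ZeroSum.equiv_four_one hL
    · interval_cases n
      · exact ZeroSum.equiv_three_two hL
      · exact ZeroSum.equiv_four_two hL
      · exact ZeroSum.equiv_five_two hL
      · exact ZeroSum.equiv_six_two hL
      · exact ZeroSum.equiv_seven_two hL
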